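/- arXiv:2301.02202 — 4 statements merged into one kernel-verified Lean document; each statement's English description precedes it below -/
import Mathlib

section
/- Let (S,m) be a Cohen-Macaulay local domain of dimension d and M a finitely generated S-module with ht(Ann_S M) = h. Then Ext^h_S(M,S) satisfies Serre's condition (S_2) as a module over its support; in particular if d - h ≥ 2 then depth(Ext^h_S(M,S)) ≥ 2. -/
open IsLocalRing

noncomputable section

/-- `r` is integral over the ideal `J`. -/
def memIntCl {R : Type} [CommRing R] (J : Ideal R) (r : R) : Prop :=
  ∃ t : ℕ, 0 < t ∧ ∃ a : ℕ → R, (∀ j, 1 ≤ j → j ≤ t → a j ∈ J ^ j) ∧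
    r ^ t + ∑ j ∈ Finset.Icc 1 t, a j * r ^ (t - j) = 0

/-- `J` is a reduction of `I`. -/
def Ideal.IsReductionOf {R : Type} [CommRing R] (J I : Ideal R) : Prop :=
  J ≤ I ∧ ∃ n : ℕ, I ^ (n + 1) = J * I ^ n

/-- Height of an ideal. -/
def idealHeight {R : Type} [CommRing R] (I : Ideal R) : ℕ∞ :=
  ⨅ (p : PrimeSpectrum R) (_ : I ≤ p.asIdeal), Order.height p

/-- Depth of a module over a local ring, via weakly regular sequences in the maximal ideal. -/
def moduleDepth (R M : Type) [CommRing R] [IsLocalRing R] [AddCommGroup M] [Module R M] : ℕ∞ :=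
  sSup {n : ℕ∞ | ∃ rs : List R, (rs.length : ℕ∞) = n ∧ (∀ r ∈ rs, r ∈ maximalIdeal R) ∧
    RingTheory.Sequence.IsWeaklyRegular M rs}

/-- Cohen–Macaulay local ring. -/
def IsCMLocalRing (R : Type) [CommRing R] [IsLocalRing R] : Prop :=
  (moduleDepth R R : WithBot ℕ∞) = ringKrullDim R

/-- Regular local ring. -/
def IsRegLocal (R : Type) [CommRing R] [IsLocalRing R] : Prop :=
  IsNoetherianRing R ∧ ∃ s : Finset R, Ideal.span (s : Set R) = maximalIdeal R ∧
    (s.card : WithBot ℕ∞) = ringKrullDim R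

open CategoryTheory in
/-- The Ext module `Ext^n_R(M, N)`. -/
def ExtMod (R : Type) [CommRing R] (n : ℕ) (M N : ModuleCat R) : ModuleCat R :=
  ((Ext R (ModuleCat R) n).obj (Opposite.op M)).obj N

/-- `J` is a canonical ideal of the local ring `R`: `R/J` is Gorenstein of dimension
`dim R - 1`. -/
def IsCanonicalIdeal (R : Type) [CommRing R] [IsLocalRing R] (J : Ideal R) : Prop :=
  J ≠ ⊥ ∧ J ≠ ⊤ ∧ ∃ d' : ℕ,
    ringKrullDim (R ⧸ J) = (d' : WithBot ℕ∞) ∧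
    (d' : WithBot ℕ∞) + 1 = ringKrullDim R ∧
    moduleDepth R (R ⧸ J) = (d' : ℕ∞) ∧
    Nonempty ((ExtMod R d' (ModuleCat.of R (ResidueField R)) (ModuleCat.of R (R ⧸ J))) ≅
      ModuleCat.of R (ResidueField R))

/-- The `n`-th symbolic power of an ideal `I`: the saturation of `I^n` with respect to
the complement of the union of the minimal primes of `I`. -/
def symb {R : Type} [CommRing R] (I : Ideal R) (n : ℕ) : Ideal R where
  carrier := {r | ∃ s : R, (∀ P ∈ I.minimalPrimes, s ∉ P) ∧ s * r ∈ I ^ n}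
  zero_mem' := ⟨1, fun P hP h1 => hP.1.1.ne_top ((Ideal.eq_top_iff_one P).mpr h1), by simp⟩
  add_mem' := by
    rintro a b ⟨s, hs, h⟩ ⟨t, ht, h'⟩
    refine ⟨s * t, fun P hP hm => ?_, ?_⟩
    · rcases hP.1.1.mem_or_mem hm with h'' | h''
      · exact hs P hP h''
      · exact ht P hP h''
    · have : s * t * (a + b) = t * (s * a) + s * (t * b) := by ring
      rw [this]
      exact add_mem (Ideal.mul_mem_left _ _ h) (Ideal.mul_mem_left _ _ h')
  smul_mem' := by
    rintro c r ⟨s, hs, h⟩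
    refine ⟨s, hs, ?_⟩
    have : s * (c • r) = c * (s * r) := by simp [smul_eq_mul]; ring
    rw [this]
    exact Ideal.mul_mem_left _ _ h

/-- An ideal of pure height one. -/
def PureHeightOne {R : Type} [CommRing R] (I : Ideal R) : Prop :=
  I ≠ ⊥ ∧ I ≠ ⊤ ∧ ∀ P ∈ I.minimalPrimes, idealHeight P = 1

/-- `E` is an injective hull of the residue field of the local ring `R`. -/
def IsInjHullOfResidueField (R E : Type) [CommRing R] [IsLocalRing R] [AddCommGroup E]
    [Module R E] : Prop :=
  Module.Injective R E ∧ ∃ ι : ResidueField R →ₗ[R] E, Function.Injective ι ∧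
    ∀ N : Submodule R E, N ≠ ⊥ → ∃ v ∈ N, v ≠ 0 ∧ v ∈ LinearMap.range ι


section helpers
open RingTheory.Sequence
open scoped Pointwise

namespace ExtS2

/-- existence of weakly regular sequences of length `r` inside the maximal ideal -/
def HasDep (R N : Type) [CommRing R] [IsLocalRing R] [AddCommGroup N] [Module R N] (r : ℕ) : Prop :=
  ∃ rs : List R, rs.length = r ∧ (∀ x ∈ rs, x ∈ maximalIdeal R) ∧ IsWeaklyRegular N rs

section alg
variable {R : Type} [CommRing R]

lemma exists_regular_of_ass [IsNoetherianRing R] {N : Type} [AddCommGroup N] [Module R N]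
    [Module.Finite R N] (I : Ideal R) (hI : ∀ P ∈ associatedPrimes R N, ¬ I ≤ P) :
    ∃ c ∈ I, IsSMulRegular N c := by
  by_contra hcon
  push Not at hcon
  have hsub : (I : Set R) ⊆ ⋃ P ∈ associatedPrimes R N, (P : Set R) := by
    rw [biUnion_associatedPrimes_eq_compl_regular]
    intro c hc
    exact hcon c hc
  obtain ⟨P, hP, hle⟩ := (I.subset_union_prime_finite (associatedPrimes.finite R N) (f := id) 0 0
    fun _ h _ _ ↦ h.1).1 hsub
  exact hI P hP hle

lemma exists_regular_of_socle [IsLocalRing R] [IsNoetherianRing R] {N : Type} [AddCommGroup N]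
    [Module R N] [Module.Finite R N]
    (hN : ∀ u : N, (∀ s ∈ maximalIdeal R, s • u = 0) → u = 0) :
    ∃ c ∈ maximalIdeal R, IsSMulRegular N c := by
  refine exists_regular_of_ass _ fun P hP hle => ?_
  obtain ⟨hPp, u, rfl⟩ := isAssociatedPrime_iff.1 hP
  apply hPp.ne_top
  have hu : u = 0 := hN u fun s hs => by
    simpa [Submodule.mem_colon_singleton] using hle hs
  subst hu
  rw [Ideal.eq_top_iff_one, Submodule.mem_colon_singleton]
  simp

lemma mem_smul_top {N : Type} [AddCommGroup N] [Module R N] {a : R} {u : N} :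
    u ∈ a • (⊤ : Submodule R N) ↔ ∃ v, u = a • v := by
  constructor
  · intro h
    obtain ⟨v, -, hv⟩ := (Submodule.mem_smul_pointwise_iff_exists _ _ _).1 h
    exact ⟨v, hv.symm⟩
  · rintro ⟨v, rfl⟩
    exact Submodule.smul_mem_pointwise_smul _ _ _ Submodule.mem_top

lemma quot_reg_iff {N : Type} [AddCommGroup N] [Module R N] {a c : R} :
    IsSMulRegular (QuotSMulTop a N) c ↔ ∀ u v : N, c • u = a • v → ∃ w, u = a • w := by
  rw [isSMulRegular_quotient_iff_mem_of_smul_mem]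
  simp only [mem_smul_top]
  exact ⟨fun h u v huv => h u ⟨v, huv⟩, fun h u ⟨v, huv⟩ => h u v huv⟩

lemma swap_reg {N : Type} [AddCommGroup N] [Module R N] {a c : R} (ha : IsSMulRegular N a)
    (hc : IsSMulRegular (QuotSMulTop a N) c) : IsSMulRegular (QuotSMulTop c N) a := by
  rw [quot_reg_iff] at hc ⊢
  intro u v h
  obtain ⟨w, rfl⟩ := hc v u h.symm
  exact ⟨w, ha (by simp only [h]; rw [smul_comm])⟩

/-- auxiliary map -/
noncomputable def quotCommMap (N : Type) [AddCommGroup N] [Module R N] (a c : R) :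
    QuotSMulTop c (QuotSMulTop a N) →ₗ[R] QuotSMulTop a (QuotSMulTop c N) :=
  Submodule.liftQ _ (Submodule.liftQ _ (Submodule.mkQ _ ∘ₗ Submodule.mkQ _) (by
    intro u hu
    obtain ⟨v, rfl⟩ := mem_smul_top.1 hu
    simp only [LinearMap.mem_ker, LinearMap.comp_apply, map_smul]
    rw [← map_smul, Submodule.mkQ_apply, Submodule.Quotient.mk_eq_zero]
    exact mem_smul_top.2 ⟨_, rfl⟩)) (by
    intro u hu
    obtain ⟨v, rfl⟩ := mem_smul_top.1 hu
    obtain ⟨v, rfl⟩ := Submodule.Quotient.mk_surjective _ v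
    rw [LinearMap.mem_ker, map_smul, Submodule.liftQ_apply, LinearMap.comp_apply, ← map_smul,
      ← map_smul, Submodule.mkQ_apply _ (c • v), (Submodule.Quotient.mk_eq_zero _).2, map_zero]
    exact mem_smul_top.2 ⟨_, rfl⟩)

/-- double quotients commute -/
noncomputable def quotComm (N : Type) [AddCommGroup N] [Module R N] (a c : R) :
    QuotSMulTop c (QuotSMulTop a N) ≃ₗ[R] QuotSMulTop a (QuotSMulTop c N) :=
  LinearEquiv.ofLinearMap (quotCommMap N a c) (quotCommMap N c a)
    (by ext u; rfl) (by ext u; rfl)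

lemma IsSMulRegular.of_prod {N N' : Type} [AddCommGroup N] [Module R N] [AddCommGroup N'] [Module R N']
   {c : R} (h : IsSMulRegular (N × N') c) : IsSMulRegular N c ∧ IsSMulRegular N' c := by
  constructor
  · intro u v huv
    have := @h (u, 0) (v, 0) (by simpa using huv)
    exact congrArg Prod.fst this
  · intro u v huv
    have := @h (0, u) (0, v) (by simpa using huv)
    exact congrArg Prod.snd this

lemma HasDep.congr [IsLocalRing R] {N N' : Type} [AddCommGroup N] [Module R N] [AddCommGroup N']
    [Module R N'] (e : N ≃ₗ[R] N') {r : ℕ} (h : HasDep R N r) : HasDep R N' r := by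
  obtain ⟨rs, h1, h2, h3⟩ := h
  exact ⟨rs, h1, h2, (e.isWeaklyRegular_congr rs).1 h3⟩

lemma HasDep.succ_iff [IsLocalRing R] {N : Type} [AddCommGroup N] [Module R N] {r : ℕ} :
    HasDep R N (r + 1) ↔ ∃ c ∈ maximalIdeal R, IsSMulRegular N c ∧ HasDep R (QuotSMulTop c N) r := by
  constructor
  · rintro ⟨rs, h1, h2, h3⟩
    obtain _ | ⟨c, rs⟩ := rs
    · simp at h1
    · rw [isWeaklyRegular_cons_iff] at h3
      simp only [List.length_cons, Nat.add_right_cancel_iff, List.mem_cons, forall_eq_or_imp] at h1 h2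
      exact ⟨c, h2.1, h3.1, rs, h1, h2.2, h3.2⟩
  · rintro ⟨c, hc, hr, rs, h1, h2, h3⟩
    exact ⟨c :: rs, by simp [h1], by simpa using ⟨hc, h2⟩, (isWeaklyRegular_cons_iff ..).2 ⟨hr, h3⟩⟩

lemma exchange [IsLocalRing R] [IsNoetherianRing R] (r : ℕ) : ∀ (N : Type) [AddCommGroup N] [Module R N]
    [Module.Finite R N] (a b : R), a ∈ maximalIdeal R → b ∈ maximalIdeal R →
    IsSMulRegular N a → IsSMulRegular N b →
    HasDep R (QuotSMulTop a N) r → HasDep R (QuotSMulTop b N) r := by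
  induction r with
  | zero => intro N _ _ _ a b _ _ _ _ _; exact ⟨[], rfl, by simp, IsWeaklyRegular.nil _ _⟩
  | succ r ih =>
    intro N _ _ _ a b ham hbm ha hb h
    obtain ⟨y, hym, hy, hyr⟩ := HasDep.succ_iff.1 h
    obtain ⟨c, hcm, hc⟩ := exists_regular_of_socle (R := R)
      (N := N × QuotSMulTop a N × QuotSMulTop b N) (by
        rintro ⟨u, v, w⟩ hs
        simp only [Prod.smul_mk, Prod.mk_eq_zero] at hs ⊢
        refine ⟨ha (by simpa using (hs a ham).1), hy (by simpa using (hs y hym).2.1), ?_⟩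
        have hw := fun s hsm => (hs s hsm).2.2
        obtain ⟨u, rfl⟩ := Submodule.Quotient.mk_surjective _ w
        simp only [← Submodule.Quotient.mk_smul, Submodule.Quotient.mk_eq_zero, mem_smul_top] at hw ⊢
        -- `s u ∈ b N` for all `s`
        obtain ⟨v, hv⟩ := hw a ham
        obtain ⟨w, hvw⟩ := hw y hym
        have hva : ∃ w, v = a • w := by
          refine quot_reg_iff.1 hy v w (hb ?_)
          simp only
          rw [smul_comm, ← hv, smul_comm, hvw, smul_comm]
        obtain ⟨w, rfl⟩ := hva
        exact ⟨w, ha (by simp only [hv]; rw [smul_comm])⟩)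
    obtain ⟨hcN, hc⟩ := IsSMulRegular.of_prod hc
    obtain ⟨hca, hcb⟩ := IsSMulRegular.of_prod hc
    have h1 := ih (QuotSMulTop a N) y c hym hcm hy hca hyr
    have h2 := ih (QuotSMulTop c N) a b ham hbm (swap_reg ha hca) (swap_reg hb hcb)
      (HasDep.congr (quotComm N a c) h1)
    exact HasDep.succ_iff.2 ⟨c, hcm, hcb, HasDep.congr (quotComm N c b) h2⟩

lemma ass_step [IsLocalRing R] [IsNoetherianRing R] (N : Type) [AddCommGroup N] [Module R N]
    [Module.Finite R N] (P : Ideal R) (hP : P ∈ associatedPrimes R N) (x : R)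
    (hxm : x ∈ maximalIdeal R) (hx : IsSMulRegular N x) :
    ∃ Q ∈ associatedPrimes R (QuotSMulTop x N), P < Q := by
  obtain ⟨hPp, u, hu⟩ := isAssociatedPrime_iff.1 hP
  have hu0 : u ≠ 0 := by
    rintro rfl
    apply hPp.ne_top
    rw [hu, Ideal.eq_top_iff_one, Submodule.mem_colon_singleton]
    simp
  have hmem : ∀ s, s ∈ P ↔ s • u = 0 := fun s => by
    rw [hu, Submodule.mem_colon_singleton, Submodule.mem_bot]
  have hxP : x ∉ P := fun h => hu0 (hx (by simpa using (hmem x).1 h))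
  let N' : Submodule R N :=
    { carrier := {v | ∀ s ∈ P, s • v = 0}
      add_mem' := fun {a b} ha hb s hs => by rw [smul_add, ha s hs, hb s hs, add_zero]
      zero_mem' := fun s _ => smul_zero s
      smul_mem' := fun c v hv s hs => by rw [smul_comm, hv s hs, smul_zero] }
  have hex : ∃ v ∈ N', ∀ w, v ≠ x • w := by
    by_contra hcon
    push Not at hcon
    have hle : N' ≤ maximalIdeal R • N' := by
      intro v hv
      obtain ⟨w, rfl⟩ := hcon v hv
      refine Submodule.smul_mem_smul hxm fun s hs => hx ?_
      simp only [smul_zero]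
      rw [smul_comm]
      exact hv s hs
    have hbot := Submodule.eq_bot_of_le_smul_of_le_jacobson_bot (maximalIdeal R) N'
      (IsNoetherian.noetherian N') hle (IsLocalRing.maximalIdeal_le_jacobson _)
    have : u ∈ N' := fun s hs => (hmem s).1 hs
    rw [hbot] at this
    exact hu0 this
  obtain ⟨v, hv, hvx⟩ := hex
  have hv0 : (Submodule.Quotient.mk v : QuotSMulTop x N) ≠ 0 := by
    rw [Ne, Submodule.Quotient.mk_eq_zero, mem_smul_top]
    push Not
    exact hvx
  obtain ⟨Q, hQ, hle⟩ := exists_le_isAssociatedPrime_of_isNoetherianRing R _ hv0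
  refine ⟨Q, hQ, lt_of_le_of_ne ?_ ?_⟩
  · intro s hs
    apply hle
    rw [Submodule.mem_colon_singleton, Submodule.mem_bot, ← Submodule.Quotient.mk_smul, hv s hs,
      Submodule.Quotient.mk_zero]
  · rintro rfl
    apply hxP
    apply hle
    rw [Submodule.mem_colon_singleton, Submodule.mem_bot, ← Submodule.Quotient.mk_smul,
      Submodule.Quotient.mk_eq_zero, mem_smul_top]
    exact ⟨v, rfl⟩

lemma dep_le_dim [IsLocalRing R] [IsNoetherianRing R] (r : ℕ) : ∀ (N : Type) [AddCommGroup N] [Module R N]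
    [Module.Finite R N] (P : PrimeSpectrum R) (_ : P.asIdeal ∈ associatedPrimes R N) (_ : HasDep R N r),
    (r : ℕ∞) ≤ Order.coheight P := by
  induction r with
  | zero => intros; simp
  | succ r ih =>
    intro N _ _ _ P hP h
    obtain ⟨c, hcm, hc, h⟩ := HasDep.succ_iff.1 h
    obtain ⟨Q, hQ, hlt⟩ := ass_step N P.asIdeal hP c hcm hc
    have := ih _ ⟨Q, hQ.1⟩ hQ h
    have h2 := Order.coheight_add_one_le (show P < ⟨Q, hQ.1⟩ from hlt)
    push_cast
    exact (add_le_add_left this 1).trans h2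

lemma ass_height [IsLocalRing R] [IsNoetherianRing R] (d n r : ℕ) (hdim : ringKrullDim R = d)
    (hd : d = n + r) (N : Type) [AddCommGroup N] [Module R N] [Module.Finite R N]
    (hdep : HasDep R N r) (P : PrimeSpectrum R) (hP : P.asIdeal ∈ associatedPrimes R N) :
    Order.height P ≤ n := by
  have h1 := dep_le_dim r N P hP hdep
  have h2 : ((Order.height P + Order.coheight P : ℕ∞) : WithBot ℕ∞) ≤
      Order.krullDim (PrimeSpectrum R) := by
    rw [Order.krullDim_eq_iSup_height_add_coheight_of_nonempty, WithBot.coe_le_coe]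
    exact le_iSup (fun a : PrimeSpectrum R => Order.height a + Order.coheight a) P
  rw [← ringKrullDim, hdim, hd] at h2
  have h3 : Order.height P + Order.coheight P ≤ ((n + r : ℕ) : ℕ∞) := by exact_mod_cast h2
  have h4 : Order.height P + (r : ℕ∞) ≤ n + r := by
    refine (add_le_add_right h1 _).trans (h3.trans (by simp))
  exact (ENat.add_le_add_iff_right (ENat.natCast_ne_top r)).1 h4

lemma seq_exists [IsLocalRing R] [IsNoetherianRing R] (d : ℕ) (hdim : ringKrullDim R = d)
    (I : Ideal R) (hI : I ≤ maximalIdeal R) (k : ℕ) : ∀ (n r : ℕ) (_ : d = n + r)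
    (N : Type) [AddCommGroup N] [Module R N] [Module.Finite R N] (_ : HasDep R N r)
    (_ : ∀ P : PrimeSpectrum R, I ≤ P.asIdeal → ((n + k : ℕ) : ℕ∞) ≤ Order.height P),
    ∃ xs : List R, xs.length = k ∧ (∀ x ∈ xs, x ∈ I) ∧ IsWeaklyRegular N xs := by
  induction k with
  | zero => intros; exact ⟨[], rfl, by simp, IsWeaklyRegular.nil _ _⟩
  | succ k ih =>
    intro n r hd N _ _ _ hdep hht
    obtain ⟨c, hcI, hc⟩ := exists_regular_of_ass (N := N) I fun P hP hle => by
      have h1 := ass_height d n r hdim hd N hdep ⟨P, hP.1⟩ hP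
      have h2 := (hht ⟨P, hP.1⟩ hle).trans h1
      have h3 : n + (k + 1) ≤ n := by exact_mod_cast h2
      omega
    obtain _ | r := r
    · have h1 := hht ⟨maximalIdeal R, inferInstance⟩ hI
      have h2 := Order.height_le_krullDim (⟨maximalIdeal R, inferInstance⟩ : PrimeSpectrum R)
      rw [← ringKrullDim, hdim] at h2
      have h3 := (WithBot.coe_le_coe.2 h1).trans h2
      have h4 : n + (k + 1) ≤ d := by exact_mod_cast h3
      omega
    obtain ⟨y, hym, hy, hyr⟩ := HasDep.succ_iff.1 hdep
    obtain ⟨xs, h1, h2, h3⟩ := ih (n + 1) r (by omega) (QuotSMulTop c N)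
      (exchange r N y c hym (hI hcI) hy hc hyr)
      (fun P hP => by rw [show n + 1 + k = n + (k + 1) by omega]; exact hht P hP)
    exact ⟨c :: xs, by simp [h1], by simpa using ⟨hcI, h2⟩, (isWeaklyRegular_cons_iff ..).2 ⟨hc, h3⟩⟩

lemma seq_exists₂ [IsLocalRing R] [IsNoetherianRing R] (d : ℕ) (hdim : ringKrullDim R = d)
    (I J : Ideal R) (hI : I ≤ maximalIdeal R) (hJ : J ≤ maximalIdeal R) (k j : ℕ) :
    ∀ (n r : ℕ) (_ : d = n + r)
    (N : Type) [AddCommGroup N] [Module R N] [Module.Finite R N] (_ : HasDep R N r)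
    (_ : ∀ P : PrimeSpectrum R, I ≤ P.asIdeal → ((n + k : ℕ) : ℕ∞) ≤ Order.height P)
    (_ : ∀ P : PrimeSpectrum R, J ≤ P.asIdeal → ((n + k + j : ℕ) : ℕ∞) ≤ Order.height P),
    ∃ xs ys : List R, xs.length = k ∧ (∀ x ∈ xs, x ∈ I) ∧ ys.length = j ∧ (∀ y ∈ ys, y ∈ J) ∧
      IsWeaklyRegular N (xs ++ ys) := by
  induction k with
  | zero =>
    intro n r hd N _ _ _ hdep hht hht'
    obtain ⟨ys, h1, h2, h3⟩ := seq_exists d hdim J hJ j n r hd N hdep hht'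
    exact ⟨[], ys, rfl, by simp, h1, h2, h3⟩
  | succ k ih =>
    intro n r hd N _ _ _ hdep hht hht'
    obtain ⟨c, hcI, hc⟩ := exists_regular_of_ass (N := N) I fun P hP hle => by
      have h1 := ass_height d n r hdim hd N hdep ⟨P, hP.1⟩ hP
      have h2 := (hht ⟨P, hP.1⟩ hle).trans h1
      have h3 : n + (k + 1) ≤ n := by exact_mod_cast h2
      omega
    obtain _ | r := r
    · have h1 := hht ⟨maximalIdeal R, inferInstance⟩ hI
      have h2 := Order.height_le_krullDim (⟨maximalIdeal R, inferInstance⟩ : PrimeSpectrum R)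
      rw [← ringKrullDim, hdim] at h2
      have h3 := (WithBot.coe_le_coe.2 h1).trans h2
      have h4 : n + (k + 1) ≤ d := by exact_mod_cast h3
      omega
    obtain ⟨y, hym, hy, hyr⟩ := HasDep.succ_iff.1 hdep
    obtain ⟨xs, ys, h1, h2, h3, h4, h5⟩ := ih (n + 1) r (by omega) (QuotSMulTop c N)
      (exchange r N y c hym (hI hcI) hy hc hyr)
      (fun P hP => by rw [show n + 1 + k = n + (k + 1) by omega]; exact hht P hP)
      (fun P hP => by rw [show n + 1 + k + j = n + (k + 1) + j by omega]; exact hht' P hP)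
    exact ⟨c :: xs, ys, by simp [h1], by simpa using ⟨hcI, h2⟩, h3, h4,
      (isWeaklyRegular_cons_iff ..).2 ⟨hc, h5⟩⟩

end alg
section hom
open CategoryTheory
variable {R : Type} [CommRing R] {M : ModuleCat.{0} R} (P : ProjectiveResolution M)

/-- functoriality of the Hom complex -/
noncomputable def yMap {N N' : ModuleCat.{0} R} (f : N ⟶ N') :
    P.complex.linearYonedaObj R N ⟶ P.complex.linearYonedaObj R N' where
  f n := ((linearYoneda R (ModuleCat R)).map f).app (.op (P.complex.X n))
  comm' i j _ := by
    ext x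
    exact (Category.assoc (P.complex.d j i) (show P.complex.X i ⟶ N from x) f).symm

lemma yMap_f_apply {N N' : ModuleCat.{0} R} (f : N ⟶ N') (n : ℕ) (u : P.complex.X n ⟶ N) :
    ((yMap P f).f n).hom u = u ≫ f := rfl

/-- the short complex of Hom complexes -/
noncomputable def yS (S : ShortComplex (ModuleCat.{0} R)) :
    ShortComplex (CochainComplex (ModuleCat R) ℕ) where
  f := yMap P S.f
  g := yMap P S.g
  zero := by
    ext n x
    change ((show P.complex.X n ⟶ S.X₁ from x) ≫ S.f) ≫ S.g = 0
    rw [Category.assoc, S.zero, Limits.comp_zero]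

lemma yS_shortExact (S : ShortComplex (ModuleCat.{0} R)) (hS : S.ShortExact) :
    (yS P S).ShortExact := by
  apply HomologicalComplex.shortExact_of_degreewise_shortExact
  intro i
  have := hS.mono_f
  have := hS.epi_g
  refine @ShortComplex.ShortExact.mk _ _ _ _ ?_ ?_ ?_
  · rw [ShortComplex.moduleCat_exact_iff]
    intro (x : P.complex.X i ⟶ S.X₂) (hx : x ≫ S.g = 0)
    exact ⟨hS.exact.lift x hx, hS.exact.lift_f x hx⟩
  · rw [ModuleCat.mono_iff_injective]
    intro (x : P.complex.X i ⟶ S.X₁) (y : P.complex.X i ⟶ S.X₁) (hxy : x ≫ S.f = y ≫ S.f)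
    exact (cancel_mono S.f).1 hxy
  · rw [ModuleCat.epi_iff_surjective]
    intro (x : P.complex.X i ⟶ S.X₃)
    exact ⟨Projective.factorThru x S.g, Projective.factorThru_comp x S.g⟩

/-- N → N → N/x -/
noncomputable def mulS (N : Type) [AddCommGroup N] [Module R N] (x : R) :
    ShortComplex (ModuleCat.{0} R) where
  X₁ := ModuleCat.of R N
  X₂ := ModuleCat.of R N
  X₃ := ModuleCat.of R (QuotSMulTop x N)
  f := x • 𝟙 _
  g := ModuleCat.ofHom (Submodule.mkQ _)
  zero := by
    ext u
    change Submodule.Quotient.mk (x • u) = 0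
    rw [Submodule.Quotient.mk_eq_zero]
    exact Submodule.smul_mem_pointwise_smul _ _ _ Submodule.mem_top

lemma mulS_shortExact (N : Type) [AddCommGroup N] [Module R N] (x : R) (hx : IsSMulRegular N x) :
    (mulS N x).ShortExact := by
  refine @ShortComplex.ShortExact.mk _ _ _ _ ?_ ?_ ?_
  · rw [ShortComplex.moduleCat_exact_iff]
    intro (u : N) (hu : Submodule.Quotient.mk u = 0)
    rw [Submodule.Quotient.mk_eq_zero] at hu
    obtain ⟨v, -, hv⟩ := (Submodule.mem_smul_pointwise_iff_exists _ _ _).1 hu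
    exact ⟨v, hv⟩
  · rw [ModuleCat.mono_iff_injective]
    intro (u : N) (v : N) huv
    exact hx huv
  · rw [ModuleCat.epi_iff_surjective]
    exact Submodule.mkQ_surjective _

lemma homologyMap_smul_id (K : CochainComplex (ModuleCat.{0} R) ℕ) (φ : K ⟶ K) (x : R)
    (hφ : ∀ i (u : K.X i), (φ.f i).hom u = x • u) (n : ℕ) (t : K.homology n) :
    (HomologicalComplex.homologyMap φ n).hom t = x • t := by
  have hsurj : Function.Surjective (K.homologyπ n) :=
    (ModuleCat.epi_iff_surjective _).1 inferInstance
  have hinj : Function.Injective (K.iCycles n) :=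
    (ModuleCat.mono_iff_injective _).1 inferInstance
  obtain ⟨z, rfl⟩ := hsurj t
  have h1 := congrArg (fun f => f.hom z) (HomologicalComplex.homologyπ_naturality φ n)
  have h2 : (HomologicalComplex.cyclesMap φ n).hom z = x • z := by
    apply hinj
    have h3 := congrArg (fun f => f.hom z) (HomologicalComplex.cyclesMap_i φ n)
    have h4 := hφ n ((K.iCycles n).hom z)
    rw [map_smul]
    exact h3.trans h4
  have h5 : (HomologicalComplex.homologyMap φ n).hom ((K.homologyπ n).hom z) =
    (K.homologyπ n).hom ((HomologicalComplex.cyclesMap φ n).hom z) := h1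
  rw [h2, map_smul] at h5
  exact h5

/-- the cohomology modules -/
noncomputable abbrev T (n : ℕ) (N : Type) [AddCommGroup N] [Module R N] : ModuleCat.{0} R :=
  (P.complex.linearYonedaObj R (ModuleCat.of R N)).homology n

lemma T_kill (x : R) (hxM : x ∈ Module.annihilator R M) (n : ℕ) (N : Type) [AddCommGroup N]
    [Module R N] (t : T P n N) : x • t = 0 := by
  have h0 : Homotopy (x • 𝟙 P.complex) 0 := ProjectiveResolution.liftHomotopyZero _ (by
    have hM : x • 𝟙 M = 0 := by
      ext u
      exact (Module.mem_annihilator.1 hxM) u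
    have : (x • 𝟙 P.complex) ≫ P.π = P.π ≫ (ChainComplex.single₀ _).map (x • 𝟙 M) := by
      ext i
      rw [HomologicalComplex.comp_f, HomologicalComplex.comp_f, ChainComplex.single₀_map_f_zero]
      exact map_smul (P.π.f 0).hom x i
    rw [this, hM, Functor.map_zero, Limits.comp_zero])
  have h1 := ((((linearYoneda R (ModuleCat R)).obj (ModuleCat.of R N)).rightOp.mapHomotopy h0).unop).homologyMap_eq n
  have h2 := congrArg (fun f => f.hom t) h1
  have h3 := homologyMap_smul_id (P.complex.linearYonedaObj R (ModuleCat.of R N))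
    ((HomologicalComplex.unopFunctor _ _).map
      ((((linearYoneda R (ModuleCat R)).obj (ModuleCat.of R N)).rightOp.mapHomologicalComplex
        _).map (x • 𝟙 P.complex)).op) x
    (fun i (u : P.complex.X i ⟶ ModuleCat.of R N) => by
      change (x • 𝟙 (P.complex.X i)) ≫ u = x • u
      simp) n t
  have h4 := homologyMap_smul_id (P.complex.linearYonedaObj R (ModuleCat.of R N))
    ((HomologicalComplex.unopFunctor _ _).map
      ((((linearYoneda R (ModuleCat R)).obj (ModuleCat.of R N)).rightOp.mapHomologicalComplex
        _).map (0 : P.complex ⟶ P.complex)).op) 0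
    (fun i (u : P.complex.X i ⟶ ModuleCat.of R N) => by
      change (0 : P.complex.X i ⟶ P.complex.X i) ≫ u = (0 : R) • u
      simp) n t
  exact h3.symm.trans (h2.trans (h4.trans (zero_smul R t)))

variable (N : Type) [AddCommGroup N] [Module R N]

lemma T_map_mul (x : R) (n : ℕ) (t : T P n N) :
    (HomologicalComplex.homologyMap (yS P (mulS N x)).f n).hom t = x • t :=
  homologyMap_smul_id _ _ x (fun i (u : P.complex.X i ⟶ ModuleCat.of R N) => by
    change u ≫ (x • 𝟙 _) = x • u
    simp) n t

lemma T_zero_reg (x : R) (hx : IsSMulRegular N x) : IsSMulRegular (T P 0 N) x := by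
  rw [isSMulRegular_iff_right_eq_zero_of_smul]
  intro t ht
  let K := P.complex.linearYonedaObj R (ModuleCat.of R N)
  have hbij : Function.Bijective (K.homologyπ 0) :=
    ConcreteCategory.bijective_of_isIso (CochainComplex.isoHomologyπ₀ K).hom
  have hinj : Function.Injective (K.iCycles 0) :=
    (ModuleCat.mono_iff_injective _).1 inferInstance
  obtain ⟨z, rfl⟩ := hbij.2 t
  have h1 : x • z = 0 := hbij.1 (by
    rw [map_zero, ← ht]
    exact map_smul (K.homologyπ 0).hom x z)
  have h2 : x • (K.iCycles 0).hom z = 0 := by rw [← map_smul, h1, map_zero]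
  have h3 : (K.iCycles 0).hom z = 0 := by
    generalize (K.iCycles 0).hom z = c at h2
    change P.complex.X 0 ⟶ ModuleCat.of R N at c
    change c = 0
    ext u
    apply hx
    have := congrArg (fun f : P.complex.X 0 ⟶ ModuleCat.of R N => f.hom u) h2
    exact this.trans (smul_zero x).symm
  have h4 : z = 0 := hinj (h3.trans (map_zero (K.iCycles 0).hom).symm)
  rw [h4]
  exact map_zero (K.homologyπ 0).hom

lemma T_exact₂ (x : R) (hx : IsSMulRegular N x) (n : ℕ) :
    ∃ g : T P n N →ₗ[R] T P n (QuotSMulTop x N), (∀ s, g (x • s) = 0) ∧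
      ∀ t, g t = 0 → ∃ s, t = x • s := by
  have hS := yS_shortExact P _ (mulS_shortExact N x hx)
  refine ⟨(HomologicalComplex.homologyMap (yS P (mulS N x)).g n).hom, fun s => ?_, fun t ht => ?_⟩
  · rw [← T_map_mul]
    have h0 : HomologicalComplex.homologyMap (yS P (mulS N x)).f n ≫
        HomologicalComplex.homologyMap (yS P (mulS N x)).g n = 0 := by
      rw [← HomologicalComplex.homologyMap_comp, (yS P (mulS N x)).zero,
        HomologicalComplex.homologyMap_zero]
    exact congrArg (fun f => f.hom s) h0
  obtain ⟨s, hs⟩ := (ShortComplex.moduleCat_exact_iff _).1 (hS.homology_exact₂ n) t ht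
  exact ⟨s, hs.symm.trans (T_map_mul P N x n s)⟩

lemma T_exact₃ (x : R) (hx : IsSMulRegular N x) (n : ℕ) :
    ∃ δ : T P n (QuotSMulTop x N) →ₗ[R] T P (n + 1) N,
      (∀ t : T P (n + 1) N, x • t = 0 → ∃ s, δ s = t) ∧
      (Subsingleton (T P n N) → Function.Injective δ) := by
  have hS := yS_shortExact P _ (mulS_shortExact N x hx)
  refine ⟨(hS.δ n (n + 1) (by simp)).hom, fun t ht => ?_, fun hsub => ?_⟩
  · obtain ⟨s, hs⟩ := (ShortComplex.moduleCat_exact_iff _).1 (hS.homology_exact₁ n (n + 1) (by simp)) t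
      ((T_map_mul P N x (n + 1) t).trans ht)
    exact ⟨s, hs⟩
  · refine (injective_iff_map_eq_zero _).2 ?_
    intro u hu
    obtain ⟨s, hs⟩ := (ShortComplex.moduleCat_exact_iff _).1 (hS.homology_exact₃ n (n + 1) (by simp)) u hu
    rw [← hs, show s = 0 from @Subsingleton.elim _ hsub _ _]
    exact map_zero (HomologicalComplex.homologyMap (yS P (mulS N x)).g n).hom

lemma T_vanish (xs : List R) (hxs : ∀ x ∈ xs, x ∈ Module.annihilator R M) :
    ∀ (N : Type) [AddCommGroup N] [Module R N] (_ : IsWeaklyRegular N xs) (i : ℕ),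
      i < xs.length → Subsingleton (T P i N) := by
  induction xs with
  | nil => intro N _ _ _ i hi; simp at hi
  | cons x xs ih =>
    intro N _ _ hreg i hi
    rw [isWeaklyRegular_cons_iff] at hreg
    have hk := fun i => T_kill P x (hxs x (by simp)) i N
    suffices ∀ t : T P i N, t = 0 from ⟨fun a b => (this a).trans (this b).symm⟩
    intro t
    obtain _ | i := i
    · exact T_zero_reg P N x hreg.1 (by simp only [smul_zero]; exact hk 0 t)
    · obtain ⟨δ, hδ, -⟩ := T_exact₃ P N x hreg.1 i
      obtain ⟨s, rfl⟩ := hδ t (hk _ t)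
      have := ih (fun y hy => hxs y (by simp [hy])) _ hreg.2 i (by simpa using hi)
      rw [Subsingleton.elim s 0, map_zero]

lemma T_zero_two (ys : List R) (hl : ys.length ≤ 2) (hreg : IsWeaklyRegular N ys) :
    IsWeaklyRegular (T P 0 N) ys := by
  obtain _ | ⟨y, ys⟩ := ys
  · exact IsWeaklyRegular.nil _ _
  rw [isWeaklyRegular_cons_iff] at hreg ⊢
  refine ⟨T_zero_reg P N y hreg.1, ?_⟩
  obtain _ | ⟨z, ys⟩ := ys
  · exact IsWeaklyRegular.nil _ _
  obtain rfl : ys = [] := by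
    cases ys with
    | nil => rfl
    | cons => simp at hl
  rw [isWeaklyRegular_singleton_iff] at hreg ⊢
  have h1 := T_zero_reg P _ z hreg.2
  obtain ⟨g, hg0, hg⟩ := T_exact₂ P N y hreg.1 0
  rw [isSMulRegular_quotient_iff_mem_of_smul_mem]
  intro t ht
  obtain ⟨s, -, hs⟩ := (Submodule.mem_smul_pointwise_iff_exists _ _ _).1 ht
  have hgt : g t = 0 := by
    apply h1
    simp only [smul_zero]
    rw [← map_smul, ← hs]
    exact hg0 s
  obtain ⟨s, rfl⟩ := hg t hgt
  exact Submodule.smul_mem_pointwise_smul _ _ _ Submodule.mem_top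

lemma T_main (xs : List R) (hxs : ∀ x ∈ xs, x ∈ Module.annihilator R M) (ys : List R)
    (hl : ys.length ≤ 2) :
    ∀ (N : Type) [AddCommGroup N] [Module R N] (_ : IsWeaklyRegular N (xs ++ ys)),
      IsWeaklyRegular (T P xs.length N) ys := by
  induction xs with
  | nil => intro N _ _ h; exact T_zero_two P N ys hl h
  | cons x xs ih =>
    intro N _ _ h
    have hv := T_vanish P (x :: xs) hxs N ((isWeaklyRegular_append_iff _ _ _).1 h).1 xs.length
      (by simp)
    rw [List.cons_append, isWeaklyRegular_cons_iff] at h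
    obtain ⟨δ, hδ, hδ'⟩ := T_exact₃ P N x h.1 xs.length
    have := ih (fun y hy => hxs y (by simp [hy])) _ h.2
    let e := LinearEquiv.ofBijective δ ⟨hδ' hv, fun t => hδ t (T_kill P x (hxs x (by simp)) _ N t)⟩
    exact (e.isWeaklyRegular_congr ys).1 this

end hom
section core
open CategoryTheory
variable {S : Type} [CommRing S] [IsLocalRing S] [IsNoetherianRing S]

lemma hasDep_of_CM (hCM : IsCMLocalRing S) (d : ℕ) (hdim : ringKrullDim S = (d : WithBot ℕ∞)) :
    HasDep S S d := by
  rw [IsCMLocalRing, hdim] at hCM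
  have h1 : moduleDepth S S = (d : ℕ∞) := by exact_mod_cast hCM
  obtain _ | d := d
  · exact ⟨[], rfl, by simp, IsWeaklyRegular.nil _ _⟩
  by_contra hcon
  have h2 : moduleDepth S S ≤ (d : ℕ∞) := by
    refine sSup_le ?_
    rintro n ⟨rs, rfl, hm, hr⟩
    by_contra hlt
    have hlt' : d < rs.length := by
      have := not_le.1 hlt
      exact_mod_cast this
    apply hcon
    refine ⟨rs.take (d + 1), by simp; omega, fun x hx => hm x (List.mem_of_mem_take hx), ?_⟩
    rw [← List.take_append_drop (d + 1) rs, isWeaklyRegular_append_iff] at hr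
    exact hr.1
  rw [h1] at h2
  have : d + 1 ≤ d := by exact_mod_cast h2
  omega

variable (hCM : IsCMLocalRing S) (d h : ℕ) (hdim : ringKrullDim S = (d : WithBot ℕ∞))
    (M : Type) [AddCommGroup M] [Module S M]
    (hht : idealHeight (Module.annihilator S M) = (h : ℕ∞))

include hht in
lemma le_height_of_ann (P : PrimeSpectrum S) (hP : Module.annihilator S M ≤ P.asIdeal) :
    (h : ℕ∞) ≤ Order.height P := by
  rw [← hht]
  exact iInf₂_le P hP

include hCM hdim hht in
lemma ext_seq (p : PrimeSpectrum S) (j : ℕ) (hj : j ≤ 2) (hp : ((h + j : ℕ) : ℕ∞) ≤ Order.height p) :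
    ∃ ys : List S, ys.length = j ∧ (∀ y ∈ ys, y ∈ p.asIdeal) ∧
      IsWeaklyRegular (ExtMod S h (ModuleCat.of S M) (ModuleCat.of S S)) ys := by
  have hann : Module.annihilator S M ≤ maximalIdeal S := by
    apply IsLocalRing.le_maximalIdeal
    intro htop
    rw [htop, idealHeight] at hht
    have : (⊤ : ℕ∞) = h := by
      rw [← hht, eq_comm, iInf₂_eq_top]
      intro P hP
      exact absurd (top_le_iff.1 hP) P.2.ne_top
    exact ENat.natCast_ne_top h this.symm
  obtain ⟨xs, ys, h1, h2, h3, h4, h5⟩ := seq_exists₂ d hdim (Module.annihilator S M) p.asIdeal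
    hann (IsLocalRing.le_maximalIdeal p.2.ne_top) h j 0 d (by omega) S (hasDep_of_CM hCM d hdim)
    (fun P hP => by rw [zero_add]; exact le_height_of_ann h M hht P hP)
    (fun P hP => by rw [zero_add]; exact hp.trans (Order.height_mono hP))
  refine ⟨ys, h3, h4, ?_⟩
  let P : ProjectiveResolution (ModuleCat.of S M) := ProjectiveResolution.of _
  have h6 := T_main P xs h2 ys (by omega) S h5
  rw [h1] at h6
  exact ((P.isoExt (R := S) h (ModuleCat.of S S)).toLinearEquiv.isWeaklyRegular_congr ys).2 h6

lemma ext_kill (x : S) (hx : x ∈ Module.annihilator S M)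
    (t : ExtMod S h (ModuleCat.of S M) (ModuleCat.of S S)) : x • t = 0 := by
  let P : ProjectiveResolution (ModuleCat.of S M) := ProjectiveResolution.of _
  let e := (P.isoExt (R := S) h (ModuleCat.of S S)).toLinearEquiv
  apply e.injective
  have h1 := T_kill P x hx h S (e t)
  exact ((e.map_smul x t).trans h1).trans e.map_zero.symm

include hht in
lemma height_ge (p : PrimeSpectrum S) (E : Type) [AddCommGroup E] [Module S E]
    (hE : ∀ x ∈ Module.annihilator S M, ∀ t : E, x • t = 0) (j : ℕ)
    (hj : (j : WithBot ℕ∞) ≤ ringKrullDim ((Localization.AtPrime p.asIdeal) ⧸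
              Module.annihilator (Localization.AtPrime p.asIdeal)
                (LocalizedModule p.asIdeal.primeCompl E))) :
    ((h + j : ℕ) : ℕ∞) ≤ Order.height p := by
  rw [ringKrullDim_quotient, Order.le_krullDim_iff] at hj
  obtain ⟨l, hl⟩ := hj
  let q : PrimeSpectrum (Localization.AtPrime p.asIdeal) := l.head.1
  have hco : (j : ℕ∞) ≤ Order.coheight q := by
    have := Order.length_le_coheight_head (p := LTSeries.map l Subtype.val (fun _ _ hab => hab))
    have h2 : ((l.length : ℕ) : ℕ∞) ≤ Order.coheight q := this
    rwa [hl] at h2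
  have hht' : (h : ℕ∞) ≤ Order.height q := by
    rw [← PrimeSpectrum.height_eq_orderHeight, ← IsLocalization.height_under p.asIdeal.primeCompl]
    have := le_height_of_ann h M hht (PrimeSpectrum.comap (algebraMap S _) q) (by
      intro x hx
      apply l.head.2
      rw [SetLike.mem_coe, Module.mem_annihilator]
      intro t
      induction t using LocalizedModule.induction_on with
      | h t s =>
        rw [algebraMap_smul, LocalizedModule.smul'_mk, hE x hx, LocalizedModule.zero_mk])
    rwa [← PrimeSpectrum.height_eq_orderHeight] at this
  have h2 : ((Order.height q + Order.coheight q : ℕ∞) : WithBot ℕ∞) ≤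
      Order.krullDim (PrimeSpectrum (Localization.AtPrime p.asIdeal)) := by
    rw [Order.krullDim_eq_iSup_height_add_coheight_of_nonempty, WithBot.coe_le_coe]
    exact le_iSup (fun a : PrimeSpectrum (Localization.AtPrime p.asIdeal) =>
      Order.height a + Order.coheight a) q
  rw [← ringKrullDim, IsLocalization.AtPrime.ringKrullDim_eq_height p.asIdeal,
    PrimeSpectrum.height_eq_orderHeight, WithBot.coe_le_coe] at h2
  push_cast
  exact (add_le_add hht' hco).trans h2

end core
end ExtS2
end helpers

/-- Over a CM local domain `S` of dimension `d`, if `ht(Ann M) = h` then `Ext^h_S(M,S)`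
satisfies Serre's condition `(S₂)` over its support; in particular if `d - h ≥ 2` then
`depth Ext^h_S(M,S) ≥ 2`. -/
theorem ext_h_is_S2 {S : Type} [CommRing S] [IsLocalRing S] [IsNoetherianRing S] [IsDomain S]
    (hCM : IsCMLocalRing S) (d h : ℕ) (hdim : ringKrullDim S = (d : WithBot ℕ∞))
    (M : Type) [AddCommGroup M] [Module S M] [Module.Finite S M]
    (hht : idealHeight (Module.annihilator S M) = (h : ℕ∞)) :
    (∀ p : PrimeSpectrum S,
      p ∈ Module.support S (ExtMod S h (ModuleCat.of S M) (ModuleCat.of S S)) →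
        min (2 : WithBot ℕ∞)
            (ringKrullDim ((Localization.AtPrime p.asIdeal) ⧸
              Module.annihilator (Localization.AtPrime p.asIdeal)
                (LocalizedModule p.asIdeal.primeCompl
                  (ExtMod S h (ModuleCat.of S M) (ModuleCat.of S S))))) ≤
          (moduleDepth (Localization.AtPrime p.asIdeal)
            (LocalizedModule p.asIdeal.primeCompl
              (ExtMod S h (ModuleCat.of S M) (ModuleCat.of S S))) : WithBot ℕ∞)) ∧
    (2 ≤ d - h →
      (2 : ℕ∞) ≤ moduleDepth S (ExtMod S h (ModuleCat.of S M) (ModuleCat.of S S))) := by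
  constructor
  · intro p _
    set E := ExtMod S h (ModuleCat.of S M) (ModuleCat.of S S)
    have key : ∀ j : ℕ, j ≤ 2 → (j : WithBot ℕ∞) ≤ ringKrullDim ((Localization.AtPrime p.asIdeal) ⧸
              Module.annihilator (Localization.AtPrime p.asIdeal)
                (LocalizedModule p.asIdeal.primeCompl E)) →
        (j : WithBot ℕ∞) ≤ (moduleDepth (Localization.AtPrime p.asIdeal)
            (LocalizedModule p.asIdeal.primeCompl E) : WithBot ℕ∞) := by
      intro j hj hjD
      obtain ⟨ys, h1, h2, h3⟩ := ExtS2.ext_seq hCM d h hdim M hht p j hj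
        (ExtS2.height_ge h M hht p E (fun x hx t => ExtS2.ext_kill h M x hx t) j hjD)
      have h4 : (j : ℕ∞) ≤ moduleDepth (Localization.AtPrime p.asIdeal)
            (LocalizedModule p.asIdeal.primeCompl E) := by
        refine le_sSup ⟨ys.map (algebraMap S (Localization.AtPrime p.asIdeal)), by simp [h1], ?_,
          RingTheory.Sequence.IsWeaklyRegular.of_isLocalizedModule (Localization.AtPrime p.asIdeal)
            p.asIdeal.primeCompl (LocalizedModule.mkLinearMap p.asIdeal.primeCompl E) h3⟩
        intro r hr
        obtain ⟨y, hy, rfl⟩ := List.mem_map.1 hr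
        exact (IsLocalization.AtPrime.to_map_mem_maximal_iff _ p.asIdeal y).2 (h2 y hy)
      exact_mod_cast h4
    generalize ringKrullDim ((Localization.AtPrime p.asIdeal) ⧸
              Module.annihilator (Localization.AtPrime p.asIdeal)
                (LocalizedModule p.asIdeal.primeCompl E)) = D at key ⊢
    rcases le_total 2 D with hD | hD
    · exact (min_le_left _ _).trans (key 2 le_rfl hD)
    · refine (min_le_right _ _).trans ?_
      induction D with
      | bot => exact bot_le
      | coe D =>
        induction D with
        | top => exact absurd hD (by decide)
        | coe n =>
          have h2 : (n : ℕ∞) ≤ ((2 : ℕ) : ℕ∞) := WithBot.coe_le_coe.1 hD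
          exact key n (Nat.cast_le.1 h2) le_rfl
  · intro hd
    obtain ⟨ys, h1, h2, h3⟩ := ExtS2.ext_seq hCM d h hdim M hht (closedPoint S) 2 le_rfl (by
      have h1 := IsLocalRing.maximalIdeal_height_eq_ringKrullDim (R := S)
      rw [hdim] at h1
      have h2 : (maximalIdeal S).height = (d : ℕ∞) := by exact_mod_cast h1
      rw [← PrimeSpectrum.height_eq_orderHeight]
      change _ ≤ (maximalIdeal S).height
      rw [h2]
      exact_mod_cast (by omega : h + 2 ≤ d))
    exact le_sSup ⟨ys, by simp [h1], h2, h3⟩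

end
end

section
/- Let S be a regular local ring of dimension d, M a finitely generated S-module with ht(Ann_S M) = h and depth(M) = d - h (i.e., M is Cohen-Macaulay over its support). Then the natural map M → Ext^h_S(Ext^h_S(M,S), S) is an isomorphism. -/
open IsLocalRing

noncomputable section

section
open CategoryTheory Limits

variable {S : Type} [CommRing S]

/-- resolution from exactness -/
def resOfExact (D : ChainComplex (ModuleCat.{0} S) ℕ) (hproj : ∀ n, Projective (D.X n))
    {M : ModuleCat.{0} S} (p : D.X 0 ⟶ M) (hw : D.d 1 0 ≫ p = 0) (hp : Function.Surjective p.hom)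
    (h0 : ∀ x, p.hom x = 0 → ∃ y, (D.d 1 0).hom y = x)
    (h1 : ∀ n x, (D.d (n+1) n).hom x = 0 → ∃ y, (D.d (n+2) (n+1)).hom y = x) :
    ProjectiveResolution M where
  complex := D
  projective := hproj
  π := (ChainComplex.toSingle₀Equiv _ _).symm ⟨p, hw⟩
  quasiIso := ⟨fun n => by
    cases n
    · rw [ChainComplex.quasiIsoAt₀_iff, ShortComplex.quasiIso_iff_of_zeros']
      · have h : (ShortComplex.mk _ _ hw).Exact ∧ Epi p :=
          ⟨(ShortComplex.moduleCat_exact_iff _).2 h0, (ModuleCat.epi_iff_surjective _).2 hp⟩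
        refine (ShortComplex.exact_and_epi_g_iff_of_iso ?_).2 h
        exact ShortComplex.isoMk (Iso.refl _) (Iso.refl _) (Iso.refl _)
          ((Category.id_comp _).trans (Category.comp_id _).symm)
          (by simp; rfl)
      · exact D.shape 0 0 (by simp)
      all_goals rfl
    · rw [quasiIsoAt_iff_exactAt']
      · rename_i n
        rw [HomologicalComplex.exactAt_iff' _ (n + 1 + 1) (n + 1) n (by simp) (by simp)]
        exact (ShortComplex.moduleCat_exact_iff _).2 (h1 n)
      · apply ChainComplex.exactAt_succ_single_obj⟩

/-- A quotient description of homology. -/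
theorem homology_iso_of_surj (C : CochainComplex (ModuleCat.{0} S) ℕ) (n : ℕ) (hn : C.d n (n+1) = 0)
    (E : Type) [AddCommGroup E] [Module S E] (φ : C.X n →ₗ[S] E) (hφ : Function.Surjective φ)
    (hker : ∀ x, φ x = 0 ↔ ∃ y, (C.d ((ComplexShape.up ℕ).prev n) n).hom y = x) :
    Nonempty (C.homology n ≅ ModuleCat.of S E) := by
  let p : C.X n ⟶ ModuleCat.of S E := ModuleCat.ofHom φ
  have hw : C.d ((ComplexShape.up ℕ).prev n) n ≫ p = 0 := by
    ext y
    exact (hker _).2 ⟨y, rfl⟩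
  have : Epi p := (ModuleCat.epi_iff_surjective _).2 hφ
  have hex : (ShortComplex.mk _ _ hw).Exact := (ShortComplex.moduleCat_exact_iff _).2
      (fun x hx => (hker x).1 hx)
  have hcok := hex.gIsCokernel
  have hg : (C.sc n).g = 0 := by
    change C.d n ((ComplexShape.up ℕ).next n) = 0
    rw [CochainComplex.next]; exact hn
  let H := ShortComplex.HomologyData.ofIsColimitCokernelCofork (C.sc n) hg _ hcok
  exact ⟨H.left.homologyIso⟩


/-- Graded pieces of the dual complex. -/
def dualSub (P : ChainComplex (ModuleCat.{0} S) ℕ) (h i : ℕ) :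
    Submodule S (∀ j, (P.X j →ₗ[S] S)) where
  carrier := {f | ∀ j, i + j ≠ h → f j = 0}
  zero_mem' := fun _ _ => rfl
  add_mem' := fun {a b} ha hb j hj => by simp [ha j hj, hb j hj]
  smul_mem' := fun c a ha j hj => by simp [ha j hj]

/-- The differential of the dual complex. -/
def dualD (P : ChainComplex (ModuleCat.{0} S) ℕ) (h k : ℕ) :
    dualSub P h (k+1) →ₗ[S] dualSub P h k where
  toFun f := ⟨fun j => (f.1 (j-1)) ∘ₗ (P.d j (j-1)).hom, fun j hj => by
    rcases j with _ | j
    · have : P.d 0 (0-1) = 0 := P.shape _ _ (by simp)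
      simp only [this]; simp
    · have : f.1 (j + 1 - 1) = 0 := f.2 _ (by simp; omega)
      simp only [this]; simp⟩
  map_add' f g := by ext j x; simp
  map_smul' c f := by ext j x; simp

theorem dualD_comp (P : ChainComplex (ModuleCat.{0} S) ℕ) (h k : ℕ) (f) :
    dualD P h k (dualD P h (k+1) f) = 0 := by
  ext j x
  have := congrArg (fun t => t.hom x) (P.d_comp_d j (j-1) (j-1-1))
  simp only [ModuleCat.hom_comp, LinearMap.comp_apply] at this
  simp [dualD, this]

/-- The dual complex, reindexed. -/
def dualCx (P : ChainComplex (ModuleCat.{0} S) ℕ) (h : ℕ) : ChainComplex (ModuleCat.{0} S) ℕ :=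
  ChainComplex.of (fun i => ModuleCat.of S (dualSub P h i)) (fun k => ModuleCat.ofHom (dualD P h k))
    (fun k => by
      apply ModuleCat.hom_ext
      apply LinearMap.ext
      intro f; exact dualD_comp P h k f)

theorem dualCx_d (P : ChainComplex (ModuleCat.{0} S) ℕ) (h k : ℕ) :
    (dualCx P h).d (k+1) k = ModuleCat.ofHom (dualD P h k) := 
  ChainComplex.of_d (fun i => ModuleCat.of S (dualSub P h i)) (fun k => ModuleCat.ofHom (dualD P h k)) k

/-- Graded piece identification. -/
def dualE (P : ChainComplex (ModuleCat.{0} S) ℕ) (h i j : ℕ) (hij : i + j = h) :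
    dualSub P h i ≃ₗ[S] Module.Dual S (P.X j) where
  toFun f := f.1 j
  map_add' f g := rfl
  map_smul' c f := rfl
  invFun g := ⟨Pi.single j g, fun j' hj' => Pi.single_eq_of_ne (by omega) _⟩
  left_inv f := by
    ext j' : 2
    by_cases hj : j' = j
    · subst hj; simp
    · rw [f.2 j' (by omega)]; exact Pi.single_eq_of_ne hj _
  right_inv g := by simp

theorem dualE_d (P : ChainComplex (ModuleCat.{0} S) ℕ) (h k j : ℕ) (hij : k + 1 + j = h) (f) :
    dualE P h k (j+1) (by omega) (dualD P h k f) = dualE P h (k+1) j hij f ∘ₗ (P.d (j+1) j).hom :=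
  rfl

theorem dualSub_zero (P : ChainComplex (ModuleCat.{0} S) ℕ) (h i : ℕ) (hi : h < i)
    (f : dualSub P h i) : f = 0 := by
  ext j : 2
  exact f.2 j (by omega)

theorem dualCx_proj (P : ChainComplex (ModuleCat.{0} S) ℕ) (h : ℕ)
    (hproj : ∀ n, Projective (P.X n)) (hfin : ∀ n, Module.Finite S (P.X n)) (i : ℕ) :
    Projective ((dualCx P h).X i) := by
  change Projective (ModuleCat.of S (dualSub P h i))
  rw [← IsProjective.iff_projective]
  by_cases hi : i ≤ h
  · have := (IsProjective.iff_projective (R := S) (P.X (h-i))).2 (hproj _)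
    exact Module.Projective.of_equiv (dualE P h i (h-i) (by omega)).symm
  · have : Subsingleton (dualSub P h i) := ⟨fun a b => by
      rw [dualSub_zero P h i (by omega) a, dualSub_zero P h i (by omega) b]⟩
    infer_instance

theorem dualD_exact (P : ChainComplex (ModuleCat.{0} S) ℕ) (h : ℕ)
    (hv0 : 0 < h → ∀ f : Module.Dual S (P.X 0), f ∘ₗ (P.d 1 0).hom = 0 → f = 0)
    (hv1 : ∀ i, i + 1 < h → ∀ f : Module.Dual S (P.X (i+1)), f ∘ₗ (P.d (i+2) (i+1)).hom = 0 →
      ∃ g : Module.Dual S (P.X i), g ∘ₗ (P.d (i+1) i).hom = f)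
    (n : ℕ) (x) (hx : dualD P h n x = 0) : ∃ y, dualD P h (n+1) y = x := by
  rcases lt_trichotomy h (n+1) with hlt | heq | hgt
  · exact ⟨0, by rw [dualSub_zero P h (n+1) hlt x, map_zero]⟩
  · refine ⟨0, ?_⟩
    rw [map_zero]
    have := dualE_d P h n 0 (by omega) x
    rw [hx, map_zero] at this
    have := hv0 (by omega) _ this.symm
    exact ((LinearEquiv.map_eq_zero_iff _).1 this).symm
  · obtain ⟨i, rfl⟩ : ∃ i, h = n + 1 + (i + 1) := ⟨h - n - 2, by omega⟩
    have := dualE_d P _ n (i+1) rfl x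
    rw [hx, map_zero] at this
    obtain ⟨g, hg⟩ := hv1 i (by omega) _ this.symm
    refine ⟨(dualE P _ (n+2) i (by omega)).symm g, ?_⟩
    apply (dualE P _ (n+1) (i+1) rfl).injective
    rw [dualE_d P _ (n+1) i (by omega), LinearEquiv.apply_symm_apply, hg]

theorem linYo_d (P : ChainComplex (ModuleCat.{0} S) ℕ) (Y : ModuleCat.{0} S) (i j : ℕ)
    (y : P.X i ⟶ Y) : ((P.linearYonedaObj S Y).d i j).hom y = P.d j i ≫ y := rfl

end

section
open CategoryTheory Limits

variable {S : Type} [CommRing S]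

theorem linYo_d_zero' (P : ChainComplex (ModuleCat.{0} S) ℕ) (Y : ModuleCat.{0} S) (i j : ℕ)
    (hd : P.d j i = 0) (y : P.X i ⟶ Y) : P.d j i ≫ y = 0 := by
  rw [hd, zero_comp]

theorem linYo_d_zero (P : ChainComplex (ModuleCat.{0} S) ℕ) (Y : ModuleCat.{0} S) (i j : ℕ)
    (hd : P.d j i = 0) (y) : ((P.linearYonedaObj S Y).d i j).hom y = 0 :=
  linYo_d_zero' P Y i j hd y

theorem homology_linYo_zero (P : ChainComplex (ModuleCat.{0} S) ℕ) (hn : P.d 1 0 = 0)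
    (E : Type) [AddCommGroup E] [Module S E] (φ : (P.X 0 →ₗ[S] S) →ₗ[S] E)
    (hφ : Function.Surjective φ) (hker : ∀ f, φ f = 0 → f = 0) :
    Nonempty ((P.linearYonedaObj S (ModuleCat.of S S)).homology 0 ≅ ModuleCat.of S E) := by
  let e : (P.X 0 ⟶ ModuleCat.of S S) ≃ₗ[S] (P.X 0 →ₗ[S] S) :=
    ModuleCat.homLinearEquiv (S := S) (M := P.X 0) (N := ModuleCat.of S S)
  refine homology_iso_of_surj _ 0 ?_ _ (φ ∘ₗ e.toLinearMap) (hφ.comp e.surjective) ?_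
  · apply ModuleCat.hom_ext
    apply LinearMap.ext
    intro y
    exact linYo_d_zero P _ 0 1 hn y
  · intro f
    constructor
    · intro hf
      refine ⟨0, ?_⟩
      rw [map_zero]
      have := hker _ hf
      exact ((LinearEquiv.map_eq_zero_iff e).1 this).symm
    · rintro ⟨y, hy⟩
      have : f = 0 := by
        rw [← hy]
        exact linYo_d_zero P _ _ 0 (P.shape _ _ (by simp)) y
      rw [this, map_zero]

theorem homology_linYo_succ (P : ChainComplex (ModuleCat.{0} S) ℕ) (k : ℕ)
    (hn : P.d (k+2) (k+1) = 0)
    (E : Type) [AddCommGroup E] [Module S E] (φ : (P.X (k+1) →ₗ[S] S) →ₗ[S] E)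
    (hφ : Function.Surjective φ) (hker : ∀ f, φ f = 0 ↔ 
      ∃ g : P.X k →ₗ[S] S, g ∘ₗ (P.d (k+1) k).hom = f) :
    Nonempty ((P.linearYonedaObj S (ModuleCat.of S S)).homology (k+1) ≅ ModuleCat.of S E) := by
  let e : (P.X (k+1) ⟶ ModuleCat.of S S) ≃ₗ[S] (P.X (k+1) →ₗ[S] S) :=
    ModuleCat.homLinearEquiv (S := S) (M := P.X (k+1)) (N := ModuleCat.of S S)
  refine homology_iso_of_surj _ (k+1) ?_ _ (φ ∘ₗ e.toLinearMap) (hφ.comp e.surjective) ?_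
  · apply ModuleCat.hom_ext
    apply LinearMap.ext
    intro y
    exact linYo_d_zero P _ (k+1) (k+2) hn y
  · intro f
    rw [CochainComplex.prev_nat_succ]
    refine (hker (e f)).trans ?_
    constructor
    · rintro ⟨g, hg⟩
      refine ⟨ModuleCat.ofHom g, ?_⟩
      apply e.injective
      exact hg
    · rintro ⟨y, rfl⟩
      exact ⟨ModuleCat.Hom.hom y, rfl⟩

/-- Identification of terms of the dual complex. -/
def eD (P : ChainComplex (ModuleCat.{0} S) ℕ) (h i j : ℕ) (hij : i + j = h) :
    (dualCx P h).X i ≃ₗ[S] (P.X j →ₗ[S] S) := dualE P h i j hij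

theorem eD_d (P : ChainComplex (ModuleCat.{0} S) ℕ) (h k j : ℕ) (hij : k + 1 + j = h) (f) :
    eD P h k (j+1) (by omega) (((dualCx P h).d (k+1) k).hom f) =
      eD P h (k+1) j hij f ∘ₗ (P.d (j+1) j).hom := by
  rw [dualCx_d]; rfl

theorem dualCx_zero (P : ChainComplex (ModuleCat.{0} S) ℕ) (h i : ℕ) (hi : h < i)
    (f : (dualCx P h).X i) : f = 0 := dualSub_zero P h i hi f

theorem dual_step1 (P : ChainComplex (ModuleCat.{0} S) ℕ) (h : ℕ)
    (hz : ∀ n, h < n → Subsingleton (P.X n)) :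
    Nonempty ((P.linearYonedaObj S (ModuleCat.of S S)).homology h ≅
      ModuleCat.of S ((dualCx P h).X 0 ⧸ LinearMap.range ((dualCx P h).d 1 0).hom)) := by
  have hd : P.d (h+1) h = 0 := by
    have := hz (h+1) (by omega)
    apply ModuleCat.hom_ext
    apply LinearMap.ext
    intro x
    rw [Subsingleton.elim x 0, map_zero, map_zero]
  have hφ := (Submodule.mkQ_surjective (LinearMap.range ((dualCx P h).d 1 0).hom)).comp
    (eD P h 0 h (by simp)).symm.surjective
  have hk : ∀ f, ((LinearMap.range ((dualCx P h).d 1 0).hom).mkQ ∘ₗ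
      (eD P h 0 h (by simp)).symm.toLinearMap) f = 0 ↔
      ∃ y, ((dualCx P h).d 1 0).hom y = (eD P h 0 h (by simp)).symm f := by
    intro f
    refine (Submodule.Quotient.mk_eq_zero _).trans ?_
    rfl
  rcases h with _ | k
  · refine homology_linYo_zero P hd _ ((LinearMap.range ((dualCx P 0).d 1 0).hom).mkQ ∘ₗ
      (eD P 0 0 0 (by simp)).symm.toLinearMap) hφ ?_
    intro f hf
    obtain ⟨y, hy⟩ := (hk f).1 hf
    rw [dualCx_zero P 0 1 (by simp) y, map_zero] at hy
    exact (LinearEquiv.map_eq_zero_iff _).1 hy.symm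
  · refine homology_linYo_succ P k hd _ ((LinearMap.range ((dualCx P (k+1)).d 1 0).hom).mkQ ∘ₗ
      (eD P (k+1) 0 (k+1) (by simp)).symm.toLinearMap) hφ ?_
    intro f
    rw [hk]
    constructor
    · rintro ⟨y, hy⟩
      refine ⟨eD P (k+1) 1 k (by omega) y, ?_⟩
      rw [← eD_d P (k+1) 0 k (by omega), hy, LinearEquiv.apply_symm_apply]
    · rintro ⟨g, hg⟩
      refine ⟨(eD P (k+1) 1 k (by omega)).symm g, ?_⟩
      rw [LinearEquiv.eq_symm_apply, eD_d P (k+1) 0 k (by omega), LinearEquiv.apply_symm_apply, hg]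

theorem dual_step2 {M : ModuleCat.{0} S} (P : ProjectiveResolution M) (h : ℕ)
    (hfin : ∀ n, Module.Finite S (P.complex.X n))
    (hz : ∀ n, h < n → Subsingleton (P.complex.X n)) :
    Nonempty (((dualCx P.complex h).linearYonedaObj S (ModuleCat.of S S)).homology h ≅
      ModuleCat.of S M) := by
  have hproj : ∀ n, Module.Projective S (P.complex.X n) := fun n =>
    (IsProjective.iff_projective (R := S) (P.complex.X n)).2 (P.projective n)
  -- general element construction
  let ev : ∀ (i j : ℕ) (hij : i + j = h), ((dualCx P.complex h).X i →ₗ[S] S) ≃ₗ[S] P.complex.X j :=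
    fun i j hij => ((eD P.complex h i j hij).symm.dualMap).trans
        (Module.evalEquiv S (P.complex.X j)).symm
  have hev : ∀ i j hij f x, eD P.complex h i j hij x (ev i j hij f) = f x := by
    intro i j hij f x
    have h1 : Module.evalEquiv S (P.complex.X j) (ev i j hij f) =
      (eD P.complex h i j hij).symm.dualMap f := LinearEquiv.apply_symm_apply _ _
    have h2 := LinearMap.congr_fun h1 (eD P.complex h i j hij x)
    rw [LinearEquiv.dualMap_apply, LinearEquiv.symm_apply_apply] at h2
    exact h2
  have hinj : ∀ i j hij (a b : P.complex.X j), (∀ x, eD P.complex h i j hij x a =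
      eD P.complex h i j hij x b) → a = b := by
    intro i j hij a b hab
    apply (Module.evalEquiv S (P.complex.X j)).injective
    apply LinearMap.ext
    intro t
    obtain ⟨x, rfl⟩ := (eD P.complex h i j hij).surjective t
    exact hab x
  let p : P.complex.X 0 →ₗ[S] M := (P.π.f 0).hom
  have hp : Function.Surjective p := (ModuleCat.epi_iff_surjective (P.π.f 0)).1 inferInstance
  have hpk : ∀ x, p x = 0 ↔ ∃ y, (P.complex.d 1 0).hom y = x := by
    intro x
    constructor
    · exact (ShortComplex.moduleCat_exact_iff _).1 P.exact₀ x
    · rintro ⟨y, rfl⟩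
      exact congrArg (fun t => t.hom y) P.complex_d_comp_π_f_zero
  have hd : (dualCx P.complex h).d (h+1) h = 0 := by
    apply ModuleCat.hom_ext
    apply LinearMap.ext
    intro x
    rw [dualCx_zero P.complex h (h+1) (by simp) x, map_zero, map_zero]
  have hφ : Function.Surjective (p ∘ₗ (ev h 0 rfl).toLinearMap) :=
    hp.comp (ev h 0 rfl).surjective
  rcases h with _ | k
  · refine homology_linYo_zero _ hd _ (p ∘ₗ (ev 0 0 rfl).toLinearMap) hφ ?_
    intro f hf
    obtain ⟨y, hy⟩ := (hpk _).1 hf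
    have := hz 1 (by simp)
    rw [Subsingleton.elim y 0, map_zero] at hy
    exact (LinearEquiv.map_eq_zero_iff (ev 0 0 rfl)).1 hy.symm
  · refine homology_linYo_succ _ k hd _ (p ∘ₗ (ev (k+1) 0 rfl).toLinearMap) hφ ?_
    intro f
    refine (hpk _).trans ?_
    have key : ∀ (g : (dualCx P.complex (k+1)).X k →ₗ[S] S),
        ((P.complex.d 1 0).hom (ev k 1 rfl g) = ev (k+1) 0 rfl f ↔
          g ∘ₗ ((dualCx P.complex (k+1)).d (k+1) k).hom = f) := by
      intro g
      have h1 : ∀ x, (g ∘ₗ ((dualCx P.complex (k+1)).d (k+1) k).hom) x =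
          eD P.complex (k+1) (k+1) 0 rfl x ((P.complex.d 1 0).hom (ev k 1 rfl g)) := by
        intro x
        rw [LinearMap.comp_apply, ← hev k 1 rfl g, eD_d P.complex (k+1) k 0 rfl]
        rfl
      constructor
      · intro hy
        apply LinearMap.ext
        intro x
        rw [h1, hy, hev]
      · intro hy
        apply hinj (k+1) 0 rfl
        intro x
        rw [← h1, hy, hev]
    constructor
    · rintro ⟨y, hy⟩
      obtain ⟨g, rfl⟩ := (ev k 1 rfl).surjective y
      exact ⟨g, (key g).1 hy⟩
    · rintro ⟨g, hg⟩
      exact ⟨_, (key g).2 hg⟩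

theorem duality_of_res {M : ModuleCat.{0} S} (P : ProjectiveResolution M) (h : ℕ)
    (hfin : ∀ n, Module.Finite S (P.complex.X n))
    (hz : ∀ n, h < n → Subsingleton (P.complex.X n))
    (hv0 : 0 < h → ∀ f : Module.Dual S (P.complex.X 0), f ∘ₗ (P.complex.d 1 0).hom = 0 → f = 0)
    (hv1 : ∀ i, i + 1 < h → ∀ f : Module.Dual S (P.complex.X (i+1)),
      f ∘ₗ (P.complex.d (i+2) (i+1)).hom = 0 →
      ∃ g : Module.Dual S (P.complex.X i), g ∘ₗ (P.complex.d (i+1) i).hom = f) :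
    Nonempty (M ≅ ((Ext S (ModuleCat S) h).obj (Opposite.op
      (((Ext S (ModuleCat S) h).obj (Opposite.op M)).obj (ModuleCat.of S S)))).obj
        (ModuleCat.of S S)) := by
  let N : ModuleCat S := ModuleCat.of S ((dualCx P.complex h).X 0 ⧸
    LinearMap.range ((dualCx P.complex h).d 1 0).hom)
  let Q : ProjectiveResolution N := resOfExact (dualCx P.complex h)
    (dualCx_proj _ _ (fun n => P.projective n) hfin)
    (ModuleCat.ofHom (LinearMap.range ((dualCx P.complex h).d 1 0).hom).mkQ)
    (by
      ext x
      exact (Submodule.Quotient.mk_eq_zero _).2 ⟨x, rfl⟩)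
    (Submodule.mkQ_surjective _)
    (fun x hx => (Submodule.Quotient.mk_eq_zero _).1 hx)
    (by
      intro n x hx
      rw [dualCx_d] at hx ⊢
      exact dualD_exact P.complex h hv0 hv1 n x hx)
  obtain ⟨eN⟩ := dual_step1 P.complex h hz
  obtain ⟨eM⟩ := dual_step2 P h hfin hz
  let e1 : _ ≅ N := P.isoExt (R := S) h (ModuleCat.of S S) ≪≫ eN
  let e2 : _ ≅ M := Q.isoExt (R := S) h (ModuleCat.of S S) ≪≫ eM
  exact ⟨e2.symm ≪≫ ((Ext S (ModuleCat S) h).mapIso e1.op).app _⟩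
end

section
open CategoryTheory Limits

variable {S : Type} [CommRing S]

theorem exists_finite_res [IsNoetherianRing S] (h : ℕ) : ∀ (M : ModuleCat.{0} S)
    [Module.Finite S M], HasProjectiveDimensionLT M (h+1) →
    ∃ P : ProjectiveResolution M, (∀ n, Module.Finite S (P.complex.X n)) ∧
      ∀ n, h < n → Subsingleton (P.complex.X n) := by
  induction h with
  | zero =>
    intro M _ hM
    have : Projective M := projective_iff_hasProjectiveDimensionLT_one.2 hM
    have hsub : ∀ n, 0 < n → Subsingleton ((ProjectiveResolution.self M).complex.X n) := by
      intro n hn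
      rw [← ModuleCat.isZero_iff_subsingleton]
      apply HomologicalComplex.isZero_single_obj_X
      simp; omega
    refine ⟨ProjectiveResolution.self M, ?_, hsub⟩
    intro n
    rcases n with _ | n
    · change Module.Finite S M
      infer_instance
    · have := hsub (n+1) (by omega)
      infer_instance
  | succ h ih =>
    intro M _ hM
    obtain ⟨F, _, _, _, _, f, surjf⟩ := Module.exists_finite_presentation S M
    have hS := LinearMap.shortExact_shortComplexKer surjf
    have hK := (hS.hasProjectiveDimensionLT_X₃_iff h inferInstance).1 hM
    obtain ⟨P, hP1, hP2⟩ := ih (ModuleCat.of S (LinearMap.ker f)) hK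
    let p0 : P.complex.X 0 →ₗ[S] LinearMap.ker f := (P.π.f 0).hom
    let g : P.complex.X 0 ⟶ ModuleCat.of S F := P.π.f 0 ≫ ModuleCat.ofHom (LinearMap.ker f).subtype
    have w : P.complex.d 1 0 ≫ g = 0 := by
      apply ModuleCat.hom_ext
      apply LinearMap.ext
      intro x
      have h1 : p0 ((P.complex.d 1 0).hom x) = 0 :=
        congrArg (fun t => t.hom x) P.complex_d_comp_π_f_zero
      exact congrArg Subtype.val h1
    have hp : Function.Surjective p0 := (ModuleCat.epi_iff_surjective (P.π.f 0)).1 inferInstance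
    have hpk : ∀ x, p0 x = 0 → ∃ y, (P.complex.d 1 0).hom y = x := by
      intro x
      exact (ShortComplex.moduleCat_exact_iff _).1 P.exact₀ x
    have hpk1 : ∀ n x, (P.complex.d (n+1) n).hom x = 0 →
        ∃ y, (P.complex.d (n+2) (n+1)).hom y = x := by
      intro n x
      exact (ShortComplex.moduleCat_exact_iff _).1 (P.exact_succ n) x
    let D := ChainComplex.augment P.complex g w
    refine ⟨resOfExact D ?_ (M := M) (ModuleCat.ofHom f) ?_ surjf ?_ ?_, ?_, ?_⟩
    · intro n
      rcases n with _ | n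
      · change Projective (ModuleCat.of S F)
        infer_instance
      · exact P.projective n
    · ext x
      exact (p0 x).2
    · intro x hx
      obtain ⟨y, hy⟩ := hp ⟨x, hx⟩
      exact ⟨y, congrArg Subtype.val hy⟩
    · intro n x hx
      rcases n with _ | n
      · exact hpk x (Subtype.ext hx)
      · exact hpk1 n x hx
    · intro n
      rcases n with _ | n
      · change Module.Finite S F
        infer_instance
      · exact hP1 n
    · intro n hn
      rcases n with _ | n
      · omega
      · exact hP2 n (by omega)

theorem duality_main [IsNoetherianRing S] (h : ℕ) (M : ModuleCat.{0} S) [Module.Finite S M]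
    (hpd : HasProjectiveDimensionLT M (h+1))
    (hv : ∀ i < h, Subsingleton (Abelian.Ext M (ModuleCat.of S S) i)) :
    Nonempty (M ≅ ((Ext S (ModuleCat S) h).obj (Opposite.op
      (((Ext S (ModuleCat S) h).obj (Opposite.op M)).obj (ModuleCat.of S S)))).obj
        (ModuleCat.of S S)) := by
  obtain ⟨P, hfin, hz⟩ := exists_finite_res h M hpd
  refine duality_of_res P h hfin hz ?_ ?_
  · intro h0 f hf
    have h1 : Subsingleton (M ⟶ ModuleCat.of S S) :=
      Abelian.Ext.homEquiv₀.subsingleton_congr.mp (hv 0 h0)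
    have hw : P.complex.d 1 0 ≫ ModuleCat.ofHom f = 0 := by
      apply ModuleCat.hom_ext
      exact hf
    let t := P.exact₀.desc (ModuleCat.ofHom f) hw
    have ht : P.π.f 0 ≫ t = ModuleCat.ofHom f := P.exact₀.g_desc _ hw
    have ht0 : t = 0 := Subsingleton.elim (α := M ⟶ ModuleCat.of S S) _ _
    rw [ht0] at ht
    have := congrArg ModuleCat.Hom.hom ht
    exact this.symm.trans (by ext; rfl)
  · intro i hi f hf
    have hw : P.complex.d (i+2) (i+1) ≫ ModuleCat.ofHom f = 0 := by
      apply ModuleCat.hom_ext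
      exact hf
    have := hv (i+1) hi
    obtain ⟨g, hg⟩ := (P.extMk_eq_zero_iff (ModuleCat.ofHom f) (i+2) rfl hw i rfl).1
      (Subsingleton.elim _ _)
    exact ⟨g.hom, congrArg ModuleCat.Hom.hom hg⟩

end

section
open CategoryTheory Limits

variable {S : Type} [CommRing S]

theorem extSub_of_iso {X Y N : ModuleCat.{0} S} (e : X ≅ Y) (i : ℕ)
    (h : Subsingleton (Abelian.Ext Y N i)) : Subsingleton (Abelian.Ext X N i) := by
  have key : ∀ x : Abelian.Ext X N i, x = 0 := by
    intro x
    have h1 : (Abelian.Ext.mk₀ e.hom).comp ((Abelian.Ext.mk₀ e.inv).comp x (zero_add i)) (zero_add i)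
        = x := by simp
    rw [← h1, Subsingleton.elim ((Abelian.Ext.mk₀ e.inv).comp x (zero_add i)) 0,
      Abelian.Ext.comp_zero]
  exact ⟨fun a b => by rw [key a, key b]⟩

theorem ext_smul_zero {X N : ModuleCat.{0} S} (r : S) (hr : ∀ m : X, r • m = 0) (i : ℕ)
    (x : Abelian.Ext X N i) : r • x = 0 := by
  have h0 : r • 𝟙 X = 0 := by
    ext m
    exact hr m
  have h1 : (Abelian.Ext.mk₀ (r • 𝟙 X)).comp x (zero_add i) = r • x := by
    rw [Abelian.Ext.mk₀_smul, Abelian.Ext.smul_comp, Abelian.Ext.mk₀_id_comp]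
  rw [← h1, h0, Abelian.Ext.mk₀_zero, Abelian.Ext.zero_comp]

theorem ext_vanish_regular (k : ModuleCat.{0} S) (rs : List S) :
    ∀ (N : ModuleCat.{0} S) (_ : RingTheory.Sequence.IsWeaklyRegular N rs)
      (_ : ∀ r ∈ rs, ∀ m : k, r • m = 0) (j : ℕ) (_ : j < rs.length),
      Subsingleton (Abelian.Ext k N j) := by
  induction rs with
  | nil => intro N _ _ j hj; simp at hj
  | cons r rs ih =>
    intro N hN hk j hj
    rw [RingTheory.Sequence.isWeaklyRegular_cons_iff] at hN
    have hS := hN.1.smulShortComplex_shortExact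
    have key : ∀ x : Abelian.Ext k N j, x = 0 := by
      intro x
      have hx : x.comp (Abelian.Ext.mk₀ (N.smulShortComplex r).f) (add_zero j) = 0 := by
        have h1 : x.comp (Abelian.Ext.mk₀ (r • 𝟙 N)) (add_zero j) = r • x := by
          rw [Abelian.Ext.mk₀_smul, Abelian.Ext.comp_smul, Abelian.Ext.comp_mk₀_id]
        refine Eq.trans h1 (ext_smul_zero r (hk r (by simp)) j x)
      rcases j with _ | j
      · have := hS.mono_f
        apply Abelian.Ext.postcomp_mk₀_injective_of_mono k (N.smulShortComplex r).f
        exact hx.trans (map_zero _).symm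
      · obtain ⟨y, hy⟩ := Abelian.Ext.covariant_sequence_exact₁ k hS x hx (n₀ := j) rfl
        have hsub := ih (ModuleCat.of S (QuotSMulTop r N)) hN.2
          (fun r' hr' => hk r' (by simp [hr'])) j (by simpa using hj)
        have hy0 : y = 0 := hsub.elim _ _
        rw [← hy, hy0, Abelian.Ext.zero_comp]
        rfl
    exact ⟨fun a b => by rw [key a, key b]⟩

theorem ext_nakayama [IsLocalRing S] [IsNoetherianRing S] (M N : ModuleCat.{0} S)
    [Module.Finite S M] [Module.Finite S N] (x : S) (hx : x ∈ maximalIdeal S)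
    (reg : IsSMulRegular M x) (i : ℕ)
    (h : Subsingleton (Abelian.Ext (ModuleCat.of S (QuotSMulTop x M)) N (i+1))) :
    Subsingleton (Abelian.Ext M N i) := by
  have hS := reg.smulShortComplex_shortExact
  by_contra ntr
  rw [not_subsingleton_iff_nontrivial] at ntr
  have hj : x ∈ (Module.annihilator S (Abelian.Ext M N i)).jacobson :=
    (IsLocalRing.maximalIdeal_le_jacobson _) hx
  refine Submodule.top_ne_pointwise_smul_of_mem_jacobson_annihilator hj ?_
  rw [eq_comm, eq_top_iff]
  intro y _
  have h0 : hS.extClass.comp y (add_comm 1 i) = 0 := h.elim _ _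
  obtain ⟨z, hz⟩ := Abelian.Ext.contravariant_sequence_exact₁ hS N y (add_comm 1 i) h0
  have h1 : ∀ z : Abelian.Ext M N i,
      (Abelian.Ext.mk₀ (x • 𝟙 M)).comp z (zero_add i) = x • z := by
    intro z
    rw [Abelian.Ext.mk₀_smul, Abelian.Ext.smul_comp, Abelian.Ext.mk₀_id_comp]
  have h2 : x • (show Abelian.Ext M N i from z) = y := (h1 z).symm.trans hz
  rw [← h2]
  exact Submodule.smul_mem_pointwise_smul _ _ ⊤ trivial

theorem ext_vanish_dim [IsLocalRing S] [IsNoetherianRing S] (N : ModuleCat.{0} S)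
    [Module.Finite S N] (e : ℕ) : ∀ (i : ℕ)
    (_ : ∀ j, i ≤ j → j ≤ i + e →
      Subsingleton (Abelian.Ext (ModuleCat.of S (S ⧸ maximalIdeal S)) N j))
    (M : Type) [AddCommGroup M] [Module S M] [Module.Finite S M]
    (_ : ∀ p : PrimeSpectrum S, Module.annihilator S M ≤ p.asIdeal → Order.coheight p ≤ e),
    Subsingleton (Abelian.Ext (ModuleCat.of S M) N i) := by
  induction e using Nat.strong_induction_on with
  | _ e ih =>
  intro i hk M _ _ hfin
  induction hfin using IsNoetherianRing.induction_on_isQuotientEquivQuotientPrime S with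
  | subsingleton M =>
    intro _
    have hz : IsZero (ModuleCat.of S M) := (ModuleCat.isZero_iff_subsingleton).2 inferInstance
    have := hz.hasProjectiveDimensionLT_zero
    exact HasProjectiveDimensionLT.subsingleton _ 0 i (by omega) N
  | exact N₁ N₂ N₃ f g hf hg hfg h₁ h₃ =>
    intro h2
    have s1 := h₁ (fun p hp => h2 p ((LinearMap.annihilator_le_of_injective f hf).trans hp))
    have s3 := h₃ (fun p hp => h2 p ((LinearMap.annihilator_le_of_surjective g hg).trans hp))
    have hS := ModuleCat.shortComplex_shortExact
      (ModuleCat.shortComplexOfCompEqZero f g hfg.linearMap_comp_eq_zero) hfg hf hg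
    have key : ∀ x : Abelian.Ext (ModuleCat.of S N₂) N i, x = 0 := by
      intro x
      obtain ⟨y, hy⟩ := Abelian.Ext.contravariant_sequence_exact₂ hS N x (s1.elim _ _)
      rw [← hy, s3.elim y 0, Abelian.Ext.comp_zero]
    exact ⟨fun a b => by rw [key a, key b]⟩
  | quotient M p eM =>
    intro hM
    have hann : Module.annihilator S M = p.asIdeal := by
      rw [eM.annihilator_eq, Ideal.annihilator_quotient]
    have hp := hM p hann.le
    by_cases hpm : p.asIdeal = maximalIdeal S
    · rw [hpm] at eM
      exact extSub_of_iso eM.toModuleIso i (hk i le_rfl (by omega))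
    · have hlt : p.asIdeal < maximalIdeal S :=
        lt_of_le_of_ne (IsLocalRing.le_maximalIdeal p.2.ne_top) hpm
      obtain ⟨x, hxm, hxp⟩ := SetLike.exists_of_lt hlt
      have reg : IsSMulRegular M x := by
        rw [eM.isSMulRegular_congr]
        intro a b hab
        obtain ⟨a, rfl⟩ := Ideal.Quotient.mk_surjective a
        obtain ⟨b, rfl⟩ := Ideal.Quotient.mk_surjective b
        have h1 : Ideal.Quotient.mk p.asIdeal (x * a) = Ideal.Quotient.mk p.asIdeal (x * b) := hab
        rw [Ideal.Quotient.eq] at h1 ⊢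
        rw [← mul_sub] at h1
        exact (p.2.mem_or_mem h1).resolve_left hxp
      have hco : ∀ q : PrimeSpectrum S, Module.annihilator S (QuotSMulTop x M) ≤ q.asIdeal →
          Order.coheight q + 1 ≤ e := by
        intro q hq
        refine (Order.coheight_add_one_le (b := p) ?_).trans hp
        rw [← PrimeSpectrum.asIdeal_lt_asIdeal]
        refine lt_of_le_of_ne ?_ ?_
        · rw [← hann]
          exact (LinearMap.annihilator_le_of_surjective (M' := QuotSMulTop x M)
            (Submodule.mkQ _) (Submodule.mkQ_surjective _)).trans hq
        · intro heq
          apply hxp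
          rw [heq]
          exact hq (QuotSMulTop.mem_annihilator M x)
      refine ext_nakayama (ModuleCat.of S M) N x hxm reg i ?_
      rcases e with _ | e
      · have hntM : Nontrivial M := by
          have := p.2
          exact eM.toEquiv.nontrivial
        have hnt : Nontrivial (QuotSMulTop x M) :=
          nontrivial_quotSMulTop_of_mem_maximalIdeal M hxm
        have hle : Module.annihilator S (QuotSMulTop x M) ≤ maximalIdeal S := by
          apply IsLocalRing.le_maximalIdeal
          rw [Ne, Module.annihilator_eq_top_iff]
          exact not_subsingleton _
        have := hco ⟨maximalIdeal S, inferInstance⟩ hle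
        simp at this
      · refine ih e (by omega) (i+1) (fun j h1 h2 => hk j (by omega) (by omega)) _ ?_
        intro q hq
        have := hco q hq
        push_cast at this
        exact (ENat.add_le_add_iff_right (by simp)).1 this

end

section

theorem reg_replace {S : Type} [CommRing S] [IsLocalRing S] (s : Finset S)
    (hs : Ideal.span (s : Set S) = maximalIdeal S) (x : S) (hxm : x ∈ maximalIdeal S)
    (hx2 : x ∉ maximalIdeal S * maximalIdeal S) :
    ∃ t : Finset S, t.card + 1 = s.card ∧
      maximalIdeal S = Ideal.span {x} ⊔ Ideal.span (t : Set S) := by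
  classical
  have hx : x ∈ Ideal.span (s : Set S) := hs ▸ hxm
  obtain ⟨f, hf⟩ := (Submodule.mem_span_finset (R := S)).1 hx
  have hfx := hf.2
  have hsub : ∀ a ∈ s, a ∈ maximalIdeal S := fun a ha => hs ▸ Ideal.subset_span ha
  obtain ⟨a, ha, hu⟩ : ∃ a ∈ s, IsUnit (f a) := by
    by_contra hcon
    push Not at hcon
    apply hx2
    rw [← hfx]
    refine Ideal.sum_mem _ (fun a ha => ?_)
    exact Ideal.mul_mem_mul (hcon a ha) (hsub a ha)
  refine ⟨s.erase a, Finset.card_erase_add_one ha, ?_⟩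
  apply le_antisymm
  · rw [← hs, Ideal.span_le]
    intro b hb
    by_cases hba : b = a
    · subst hba
      obtain ⟨u, hu⟩ := hu
      have h1 : (u : S) * b + ∑ i ∈ s.erase b, f i * i = x := by
        rw [hu, Finset.add_sum_erase s (fun i => f i * i) hb]
        exact hfx
      have h2 : b = (↑u⁻¹ : S) * (x - ∑ i ∈ s.erase b, f i * i) := by
        rw [← h1]; simp
      have h3 : (↑u⁻¹ : S) * (x - ∑ i ∈ s.erase b, f i * i) ∈
          Ideal.span {x} ⊔ Ideal.span ((s.erase b : Finset S) : Set S) := by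
        apply Ideal.mul_mem_left
        apply Ideal.sub_mem
        · exact Ideal.mem_sup_left (Ideal.mem_span_singleton_self x)
        apply Ideal.mem_sup_right
        refine Ideal.sum_mem _ (fun i hi => Ideal.mul_mem_left _ _ (Ideal.subset_span hi))
      rw [← h2] at h3
      exact h3
    · exact Ideal.mem_sup_right (Ideal.subset_span (by simp [hba]; exact hb))
  · rw [sup_le_iff, Ideal.span_le, Ideal.span_le]
    refine ⟨by simpa using hxm, fun b hb => hsub b ?_⟩
    exact Finset.mem_of_mem_erase hb

theorem reg_domain {S : Type} [CommRing S] [IsLocalRing S] [IsNoetherianRing S] (x : S)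
    (hxm : x ∈ maximalIdeal S) (hxq : ∀ q ∈ minimalPrimes S, x ∉ q)
    (hp : (Ideal.span {x}).IsPrime) : IsDomain S := by
  obtain ⟨q, hq, hqx⟩ := Ideal.exists_minimalPrimes_le (I := (⊥ : Ideal S)) (J := Ideal.span {x})
    bot_le
  have hqp : q.IsPrime := hq.1.1
  have hxnq := hxq q hq
  have hq0 : q = ⊥ := by
    apply Submodule.eq_bot_of_le_smul_of_le_jacobson_bot (Ideal.span {x}) q
      (IsNoetherian.noetherian q)
    · intro a ha
      obtain ⟨b, rfl⟩ := Ideal.mem_span_singleton.1 (hqx ha)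
      exact Ideal.mul_mem_mul (Ideal.mem_span_singleton_self x)
        ((hqp.mem_or_mem ha).resolve_left hxnq)
    · rw [IsLocalRing.jacobson_eq_maximalIdeal _ bot_ne_top]
      rw [Ideal.span_le]; simpa using hxm
  rw [hq0] at hqp
  exact IsDomain.of_bot_isPrime S

open scoped Pointwise in
theorem reg_seq (d : ℕ) : ∀ (S : Type) [CommRing S] [IsLocalRing S] [IsNoetherianRing S]
    (s : Finset S) (_ : Ideal.span (s : Set S) = maximalIdeal S) (_ : s.card = d)
    (_ : (d : WithBot ℕ∞) ≤ ringKrullDim S),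
    IsDomain S ∧ ∃ rs : List S, rs.length = d ∧ RingTheory.Sequence.IsWeaklyRegular S rs ∧
      Ideal.ofList rs = maximalIdeal S := by
  classical
  induction d with
  | zero =>
    intro S _ _ _ s hs hc _
    rw [Finset.card_eq_zero] at hc
    subst hc
    simp at hs
    refine ⟨?_, [], rfl, RingTheory.Sequence.IsWeaklyRegular.nil _ _, by simp [hs]⟩
    have := (IsLocalRing.isField_iff_maximalIdeal_eq (R := S)).2 hs.symm
    exact this.isDomain
  | succ d ih =>
    intro S _ _ _ s hs hc hd
    have hnm : ∀ q ∈ minimalPrimes S, ¬ maximalIdeal S ≤ q := by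
      intro q hq hle
      have hqp : q.IsPrime := hq.1.1
      have hqm : q = maximalIdeal S := le_antisymm (IsLocalRing.le_maximalIdeal hqp.ne_top) hle
      rw [hqm] at hq
      have h0 := Ideal.height_eq_zero_iff.2 hq
      have h1 := IsLocalRing.maximalIdeal_height_eq_ringKrullDim (R := S)
      rw [h0] at h1
      rw [← h1] at hd
      have hd' : ((d+1 : ℕ) : ℕ∞) ≤ 0 := by exact_mod_cast hd
      simp at hd'
    have hm2 : ¬ maximalIdeal S ≤ maximalIdeal S * maximalIdeal S := by
      intro hle
      have : maximalIdeal S = ⊥ := by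
        apply Submodule.eq_bot_of_le_smul_of_le_jacobson_bot (maximalIdeal S) (maximalIdeal S)
          (IsNoetherian.noetherian _) hle
        rw [IsLocalRing.jacobson_eq_maximalIdeal _ bot_ne_top]
      obtain ⟨q, hq⟩ := Ideal.nonempty_minimalPrimes (bot_ne_top : (⊥ : Ideal S) ≠ ⊤)
      exact hnm q hq (this ▸ bot_le)
    have hfin : (minimalPrimes S).Finite := minimalPrimes.finite_of_isNoetherianRing S
    have hav : ¬ ((maximalIdeal S : Set S) ⊆ ⋃ i ∈ ((insert (maximalIdeal S * maximalIdeal S)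
        hfin.toFinset : Finset (Ideal S)) : Set (Ideal S)), (i : Set S)) := by
      rw [Ideal.subset_union_prime (f := fun i => i) (maximalIdeal S * maximalIdeal S)
        (maximalIdeal S * maximalIdeal S)]
      · rintro ⟨i, hi, hle⟩
        rw [Finset.mem_insert] at hi
        rcases hi with rfl | hi
        · exact hm2 hle
        · exact hnm i (hfin.mem_toFinset.1 hi) hle
      · intro i hi h1 _
        rw [Finset.mem_insert] at hi
        exact (hfin.mem_toFinset.1 (hi.resolve_left h1)).1.1
    obtain ⟨x, hxm, hxav⟩ := Set.not_subset.1 hav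
    simp only [Set.mem_iUnion, not_exists] at hxav
    have hx2 : x ∉ maximalIdeal S * maximalIdeal S := hxav _ (by simp)
    have hxq : ∀ q ∈ minimalPrimes S, x ∉ q := fun q hq => hxav q (by
      simp only [Finset.coe_insert, Set.Finite.coe_toFinset]; exact Or.inr hq)
    obtain ⟨t, htc, ht⟩ := reg_replace s hs x hxm hx2
    have hxle : Ideal.span {x} ≤ maximalIdeal S := by rw [ht]; exact le_sup_left
    have hnt : Nontrivial (S ⧸ Ideal.span {x}) := Ideal.Quotient.nontrivial_iff.2
      (fun h => (Ideal.IsPrime.ne_top (I := maximalIdeal S) inferInstance)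
        (top_le_iff.1 (h ▸ hxle)))
    have hloc : IsLocalRing (S ⧸ Ideal.span {x}) :=
      IsLocalRing.of_surjective' (Ideal.Quotient.mk _) Ideal.Quotient.mk_surjective
    have hmap : (maximalIdeal S).map (Ideal.Quotient.mk (Ideal.span {x})) =
        maximalIdeal (S ⧸ Ideal.span {x}) := by
      have := IsLocalRing.map_maximalIdeal_of_surjective (Ideal.Quotient.mk (Ideal.span {x}))
        Ideal.Quotient.mk_surjective
      exact this
    have hmx : (Ideal.span {x}).map (Ideal.Quotient.mk (Ideal.span {x})) = ⊥ :=
      Ideal.map_quotient_self _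
    have hmt : (Ideal.span (t : Set S)).map (Ideal.Quotient.mk (Ideal.span {x})) =
        maximalIdeal (S ⧸ Ideal.span {x}) := by
      rw [← hmap, ht, Ideal.map_sup, hmx, bot_sup_eq]
    have hspan : Ideal.span ((t.image (Ideal.Quotient.mk (Ideal.span {x})) : Finset _) : Set _)
        = maximalIdeal (S ⧸ Ideal.span {x}) := by
      rw [← hmt, Ideal.map_span, Finset.coe_image]
    have hdim : (d : WithBot ℕ∞) ≤ ringKrullDim (S ⧸ Ideal.span {x}) := by
      have h1 := ringKrullDim_le_ringKrullDim_quotient_add_card ({x} : Finset S) (by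
        rw [IsLocalRing.ringJacobson_eq_maximalIdeal]; simpa using hxm)
      have h2 := hd.trans h1
      rw [Finset.card_singleton, Nat.cast_add, Nat.cast_one] at h2
      have hc1 : (({x} : Finset S) : Set S) = {x} := Finset.coe_singleton x
      rw [hc1] at h2
      exact (ENat.WithBot.add_le_add_one_right_iff).1 h2
    have hcard : (t.image (Ideal.Quotient.mk (Ideal.span {x}))).card = d := by
      apply le_antisymm
      · exact Finset.card_image_le.trans (by omega)
      · have h1 := ringKrullDim_le_spanFinrank_maximalIdeal (R := S ⧸ Ideal.span {x})
        have h2 := Submodule.spanFinrank_span_le_ncard_of_finite (R := S ⧸ Ideal.span {x})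
          (Finset.finite_toSet (t.image (Ideal.Quotient.mk (Ideal.span {x}))))
        rw [Set.ncard_coe_finset] at h2
        have h3 := hdim.trans h1
        rw [← hspan] at h3
        have h4 := h3.trans (Nat.mono_cast (α := WithBot ℕ∞) h2)
        exact_mod_cast h4
    obtain ⟨hdom, rs, hlen, hreg, hof⟩ := ih _ _ hspan hcard hdim
    have hprime : (Ideal.span {x}).IsPrime := (Ideal.Quotient.isDomain_iff_prime _).1 hdom
    have hSd := reg_domain x hxm hxq hprime
    refine ⟨hSd, ?_⟩
    obtain ⟨rs', rfl⟩ : ∃ rs' : List S, rs'.map (algebraMap S (S ⧸ Ideal.span {x})) = rs :=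
      (List.map_surjective_iff.2 Ideal.Quotient.mk_surjective) rs
    have hx0 : x ≠ 0 := fun h => hx2 (h ▸ Ideal.zero_mem _)
    refine ⟨x :: rs', by simpa using hlen, ?_, ?_⟩
    · rw [RingTheory.Sequence.isWeaklyRegular_cons_iff]
      refine ⟨?_, ?_⟩
      · intro a b hab
        exact mul_left_cancel₀ hx0 hab
      · rw [RingTheory.Sequence.isWeaklyRegular_map_algebraMap_iff] at hreg
        have heq : (x • (⊤ : Submodule S S)) = Ideal.span {x} := by
          ext a
          rw [Submodule.mem_smul_pointwise_iff_exists, Ideal.mem_span_singleton']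
          constructor
          · rintro ⟨b, _, rfl⟩
            exact ⟨b, mul_comm _ _⟩
          · rintro ⟨b, rfl⟩
            exact ⟨b, trivial, mul_comm _ _⟩
        refine (LinearEquiv.isWeaklyRegular_congr (Submodule.quotEquivOfEq _ _ heq) rs').2 hreg
    · rw [Ideal.ofList_cons]
      have h1 : (Ideal.ofList rs').map (Ideal.Quotient.mk (Ideal.span {x})) =
        (maximalIdeal S).map (Ideal.Quotient.mk (Ideal.span {x})) := by
        rw [Ideal.map_ofList, hmap]; exact hof
      have h2 := congrArg (Ideal.comap (Ideal.Quotient.mk (Ideal.span {x}))) h1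
      rw [Ideal.comap_map_of_surjective' _ Ideal.Quotient.mk_surjective,
        Ideal.comap_map_of_surjective' _ Ideal.Quotient.mk_surjective, Ideal.mk_ker,
        sup_eq_left.2 hxle] at h2
      rw [sup_comm, h2]

end

section
open CategoryTheory Limits

theorem pd_residue {S : Type} [CommRing S] [IsLocalRing S] [IsNoetherianRing S] (d : ℕ)
    (rs : List S) (hlen : rs.length = d) (hw : RingTheory.Sequence.IsWeaklyRegular S rs)
    (hof : Ideal.ofList rs = maximalIdeal S) :
    HasProjectiveDimensionLT (ModuleCat.of S (S ⧸ maximalIdeal S)) (d + 1) := by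
  have h1 := ModuleCat.projectiveDimension_quotient_eq_add_length_of_isWeaklyRegular
    (ModuleCat.of S S) rs hw (fun r hr => hof ▸ Ideal.subset_span hr)
  have h0 : projectiveDimension (ModuleCat.of S S) ≤ ((0 : ℕ) : WithBot ℕ∞) := by
    rw [projectiveDimension_le_iff]
    have : Projective (ModuleCat.of S S) := ModuleCat.projective_of_free
      (Module.Basis.singleton Unit S)
    infer_instance
  have heq : (Ideal.ofList rs • (⊤ : Submodule S S)) = maximalIdeal S := by
    rw [hof]; simp
  have e : ModuleCat.of S (S ⧸ (Ideal.ofList rs • (⊤ : Submodule S S))) ≅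
      ModuleCat.of S (S ⧸ maximalIdeal S) :=
    (Submodule.quotEquivOfEq _ _ heq).toModuleIso
  have h2 := projectiveDimension_eq_of_iso e
  have h3 : projectiveDimension (ModuleCat.of S (S ⧸ maximalIdeal S)) ≤ (d : WithBot ℕ∞) := by
    rw [← h2]
    refine h1.trans_le ?_
    rw [hlen]
    calc _ ≤ ((0 : ℕ) : WithBot ℕ∞) + (d : WithBot ℕ∞) := by gcongr
      _ = _ := by simp
  exact (projectiveDimension_le_iff _ _).1 h3

theorem pd_le_of_regular {S : Type} [CommRing S] [IsLocalRing S] [IsNoetherianRing S] (d : ℕ)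
    (hdim : ringKrullDim S = (d : WithBot ℕ∞))
    (rs : List S) (hlen : rs.length = d) (hw : RingTheory.Sequence.IsWeaklyRegular S rs)
    (hof : Ideal.ofList rs = maximalIdeal S) (M : Type) [AddCommGroup M] [Module S M]
    [Module.Finite S M] : HasProjectiveDimensionLT (ModuleCat.of S M) (d + 1) := by
  have hk := pd_residue d rs hlen hw hof
  apply ModuleCat.hasProjectiveDimensionLT_of_forall_finite
  intro L hL
  refine ext_vanish_dim L d (d + 1) (fun j hj _ => ?_) M (fun p _ => ?_)
  · exact HasProjectiveDimensionLT.subsingleton _ (d + 1) j hj L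
  · have h1 := Order.coheight_le_krullDim p
    have h2 : Order.krullDim (PrimeSpectrum S) = (d : WithBot ℕ∞) := hdim
    rw [h2] at h1
    exact_mod_cast h1

theorem ext_vanish_low {S : Type} [CommRing S] [IsLocalRing S] [IsNoetherianRing S] (d h : ℕ)
    (hdim : ringKrullDim S = (d : WithBot ℕ∞)) (hhd : h ≤ d)
    (rs : List S) (hlen : rs.length = d) (hw : RingTheory.Sequence.IsWeaklyRegular S rs)
    (hof : Ideal.ofList rs = maximalIdeal S) (M : Type) [AddCommGroup M] [Module S M]
    [Module.Finite S M]
    (hht : ∀ p : PrimeSpectrum S, Module.annihilator S M ≤ p.asIdeal → (h : ℕ∞) ≤ Order.height p)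
    (i : ℕ) (hi : i < h) :
    Subsingleton (Abelian.Ext (ModuleCat.of S M) (ModuleCat.of S S) i) := by
  refine ext_vanish_dim (ModuleCat.of S S) (d - h) i (fun j _ hj => ?_) M (fun p hp => ?_)
  · refine ext_vanish_regular (ModuleCat.of S (S ⧸ maximalIdeal S)) rs (ModuleCat.of S S) hw
      (fun r hr m => ?_) j (by omega)
    have hr' : r ∈ maximalIdeal S := hof ▸ Ideal.subset_span hr
    obtain ⟨a, rfl⟩ := Ideal.Quotient.mk_surjective m
    change Ideal.Quotient.mk _ (r * a) = 0
    exact Ideal.Quotient.eq_zero_iff_mem.2 (Ideal.mul_mem_right _ _ hr')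
  · have h2 : Order.krullDim (PrimeSpectrum S) = (d : WithBot ℕ∞) := hdim
    rw [Order.krullDim_eq_iSup_height_add_coheight_of_nonempty] at h2
    have h3 : (⨆ a : PrimeSpectrum S, Order.height a + Order.coheight a) = (d : ℕ∞) := by
      exact_mod_cast h2
    have h4 : Order.height p + Order.coheight p ≤ (d : ℕ∞) := by
      rw [← h3]
      exact le_iSup (fun a : PrimeSpectrum S => Order.height a + Order.coheight a) p
    have h5 : (h : ℕ∞) + Order.coheight p ≤ (d : ℕ∞) :=
      (add_le_add_left (hht p hp) _).trans h4
    have h6 : Order.coheight p ≠ ⊤ := by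
      intro ht
      rw [ht] at h5
      simp at h5
    obtain ⟨c, hc⟩ := ENat.ne_top_iff_exists.1 h6
    rw [← hc] at h5 ⊢
    have h7 : h + c ≤ d := by exact_mod_cast h5
    have h8 : c ≤ d - h := by omega
    exact_mod_cast h8

theorem ext_double_duality_aux {S : Type} [CommRing S] [IsLocalRing S]
    (hreg : IsRegLocal S) (d h : ℕ) (hdim : ringKrullDim S = (d : WithBot ℕ∞)) (hhd : h ≤ d)
    (M : Type) [AddCommGroup M] [Module S M] [Module.Finite S M]
    (hht : idealHeight (Module.annihilator S M) = (h : ℕ∞))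
    (hdepth : moduleDepth S M = ((d - h : ℕ) : ℕ∞)) :
    Nonempty ((ModuleCat.of S M) ≅
      ExtMod S h (ExtMod S h (ModuleCat.of S M) (ModuleCat.of S S)) (ModuleCat.of S S)) := by
  obtain ⟨hN, s, hs, hc⟩ := hreg
  have hcd : s.card = d := by
    rw [hdim] at hc
    exact_mod_cast hc
  obtain ⟨_, rs, hlen, hw, hof⟩ := reg_seq d S s hs hcd hdim.ge
  have hht' : ∀ p : PrimeSpectrum S, Module.annihilator S M ≤ p.asIdeal →
      (h : ℕ∞) ≤ Order.height p := by
    intro p hp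
    rw [← hht]
    exact iInf₂_le p hp
  have hnt : Nontrivial M := by
    by_contra hcon
    rw [not_nontrivial_iff_subsingleton] at hcon
    have hann : Module.annihilator S M = ⊤ := Module.annihilator_eq_top_iff.2 hcon
    have : idealHeight (Module.annihilator S M) = ⊤ := by
      rw [hann]
      refine iInf₂_eq_top.2 (fun p hp => ?_)
      exact absurd (top_le_iff.1 hp) p.isPrime.ne_top
    rw [this] at hht
    simp at hht
  have hne : Nonempty {n : ℕ∞ | ∃ rs : List S, (rs.length : ℕ∞) = n ∧
      (∀ r ∈ rs, r ∈ maximalIdeal S) ∧ RingTheory.Sequence.IsWeaklyRegular M rs} :=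
    ⟨0, [], by simp, by simp, RingTheory.Sequence.IsWeaklyRegular.nil _ _⟩
  have hlt : moduleDepth S M < ⊤ := by
    rw [hdepth]
    exact ENat.natCast_lt_top _
  have hmem := ENat.sSup_mem_of_nonempty_of_lt_top (s := {n : ℕ∞ | ∃ rs : List S,
    (rs.length : ℕ∞) = n ∧ (∀ r ∈ rs, r ∈ maximalIdeal S) ∧
      RingTheory.Sequence.IsWeaklyRegular M rs}) hlt
  obtain ⟨qs, hql, hqm, hqw⟩ := hmem
  have hql' : qs.length = d - h := by
    have h1 : (qs.length : ℕ∞) = ((d - h : ℕ) : ℕ∞) := hql.trans hdepth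
    exact_mod_cast h1
  have hpd := ModuleCat.projectiveDimension_quotient_eq_add_length_of_isWeaklyRegular
    (ModuleCat.of S M) qs hqw hqm
  have hpd2 : projectiveDimension (ModuleCat.of S
      (M ⧸ (Ideal.ofList qs • (⊤ : Submodule S M)))) ≤ (d : WithBot ℕ∞) :=
    (projectiveDimension_le_iff _ _).2 (pd_le_of_regular d hdim rs hlen hw hof _)
  have hpd3 : projectiveDimension (ModuleCat.of S M) ≤ (h : WithBot ℕ∞) := by
    have h1 := hpd.symm.trans_le hpd2
    have h2 : (d : WithBot ℕ∞) = (h : WithBot ℕ∞) + ((d - h : ℕ) : WithBot ℕ∞) := by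
      rw [← Nat.cast_add, Nat.add_sub_cancel' hhd]
    rw [h2, hql'] at h1
    exact ENat.WithBot.add_le_add_natCast_right_iff.1 h1
  exact duality_main h (ModuleCat.of S M) ((projectiveDimension_le_iff _ _).1 hpd3)
    (ext_vanish_low d h hdim hhd rs hlen hw hof M hht')
end

/-- Over a regular local ring `S` of dimension `d`, a finitely generated module `M` with
`ht(Ann M) = h` and `depth M = d - h` is recovered by double Ext-duality:
`M ≅ Ext^h_S(Ext^h_S(M,S),S)`. -/
theorem ext_double_duality {S : Type} [CommRing S] [IsLocalRing S]
    (hreg : IsRegLocal S) (d h : ℕ) (hdim : ringKrullDim S = (d : WithBot ℕ∞)) (hhd : h ≤ d)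
    (M : Type) [AddCommGroup M] [Module S M] [Module.Finite S M]
    (hht : idealHeight (Module.annihilator S M) = (h : ℕ∞))
    (hdepth : moduleDepth S M = ((d - h : ℕ) : ℕ∞)) :
    Nonempty ((ModuleCat.of S M) ≅
      ExtMod S h (ExtMod S h (ModuleCat.of S M) (ModuleCat.of S S)) (ModuleCat.of S S)) := by
  exact ext_double_duality_aux hreg d h hdim hhd M hht hdepth

end
end

section
/- Let (R,m) be a local normal Cohen-Macaulay domain of dimension d with canonical ideal J_1, and I_1 an ideal of pure height 1 with components disjoint from those of J_1 such that I_1 ∩ J_1 = x_1 R is principal. Then for all i, Hom_R(J_1^{(mi+1)}, J_1) ≅ I_1^{(mi)}, via the isomorphism J_1 ≅ I_1^{(mi)} ∩ J_1^{(mi+1)}. -/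
open IsLocalRing

noncomputable section

namespace HomSymb

open scoped Pointwise

lemma eq_of_height_le_one {R : Type} [CommRing R] [IsDomain R] (P : PrimeSpectrum R)
    (h : Order.height P ≤ 1) (q : Ideal R) (hq : q.IsPrime) (hq0 : q ≠ ⊥) (hqP : q ≤ P.asIdeal) :
    q = P.asIdeal := by
  by_contra hne
  have h1 : (⟨q, hq⟩ : PrimeSpectrum R) < P := lt_of_le_of_ne hqP (fun e => hne (by rw [← e]))
  have h0 : (⟨⊥, Ideal.isPrime_bot⟩ : PrimeSpectrum R) < ⟨q, hq⟩ :=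
    lt_of_le_of_ne (by change (⊥ : Ideal R) ≤ q; exact bot_le)
      (fun e => hq0 (congrArg PrimeSpectrum.asIdeal e).symm)
  have e1 := Order.height_add_one_le h1
  have e0 := Order.height_add_one_le h0
  have e2 : (1 : ℕ∞) + 1 ≤ 1 :=
    (add_le_add_left (le_trans le_add_self e0) 1).trans (e1.trans h)
  exact absurd e2 (by decide)

lemma mem_minimalPrimes_of_height {R : Type} [CommRing R] [IsDomain R] (P : PrimeSpectrum R)
    (h : Order.height P ≤ 1) (I : Ideal R) (hI : I ≠ ⊥) (hIP : I ≤ P.asIdeal) :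
    P.asIdeal ∈ I.minimalPrimes := by
  refine ⟨⟨P.2, hIP⟩, ?_⟩
  rintro q ⟨hq, hIq⟩ hqP
  refine (eq_of_height_le_one P h q hq ?_ hqP).ge
  rintro rfl
  exact hI (le_bot_iff.mp hIq)

lemma exists_assoc {R : Type} [CommRing R] [IsNoetherianRing R] (N : Ideal R) (r : R)
    (hr : r ∉ N) : ∃ P : PrimeSpectrum R, IsAssociatedPrime P.asIdeal (R ⧸ N) ∧
      (∃ y, y ∉ N ∧ ∀ q, q ∈ P.asIdeal ↔ q * y ∈ N) ∧ ∀ s, s * r ∈ N → s ∈ P.asIdeal := by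
  have hr' : (Ideal.Quotient.mk N r) ≠ 0 := by rwa [Ne, Ideal.Quotient.eq_zero_iff_mem]
  obtain ⟨P, hP, hle⟩ := exists_le_isAssociatedPrime_of_isNoetherianRing R _ hr'
  obtain ⟨hp, y, hy⟩ := isAssociatedPrime_iff.mp hP
  obtain ⟨y, rfl⟩ := Ideal.Quotient.mk_surjective y
  have key : ∀ (z q : R), q ∈ (⊥ : Submodule R (R ⧸ N)).colon {Ideal.Quotient.mk N z} ↔
      q * z ∈ N := by
    intro z q
    rw [Submodule.mem_colon_singleton, Submodule.mem_bot, ← Ideal.Quotient.eq_zero_iff_mem,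
      map_mul]
    rfl
  have hy' : ∀ q, q ∈ P ↔ q * y ∈ N := fun q => by rw [← key, ← hy]
  refine ⟨⟨P, hp⟩, hP, ⟨y, ?_, hy'⟩, fun s hs => hle ((key r s).mpr hs)⟩
  intro hyN
  exact hp.ne_top ((Ideal.eq_top_iff_one P).mpr ((hy' 1).mpr (by simpa using hyN)))

lemma height_assoc_principal {R : Type} [CommRing R] [IsNoetherianRing R] [IsDomain R]
    [IsIntegrallyClosed R] (x : R) (hx : x ≠ 0) (P : PrimeSpectrum R) (y : R)
    (hy : y ∉ Ideal.span {x}) (hP : ∀ q, q ∈ P.asIdeal ↔ q * y ∈ Ideal.span {x}) :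
    Order.height P ≤ 1 := by
  by_cases hA : ∀ p ∈ P.asIdeal, ∀ u, p * y = u * x → u ∈ P.asIdeal
  · exfalso
    let K := FractionRing R
    have hxK : algebraMap R K x ≠ 0 := by
      simpa using hx
    have hint : IsIntegral R (algebraMap R K y / algebraMap R K x) := by
      refine isIntegral_of_smul_mem_submodule 
        (Submodule.map (Algebra.linearMap R K) P.asIdeal)
        ?_ ?_ _ ?_
      · rw [Submodule.ne_bot_iff]
        refine ⟨algebraMap R K x, ⟨x, ?_, rfl⟩, hxK⟩
        exact (hP x).mpr (Ideal.mul_mem_right _ _ (Ideal.mem_span_singleton_self x))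
      · exact Submodule.FG.map _ (IsNoetherian.noetherian _)
      · rintro _ ⟨p, hp, rfl⟩
        obtain ⟨u, hu⟩ := Ideal.mem_span_singleton'.mp ((hP p).mp hp)
        refine ⟨u, hA p hp u hu.symm, ?_⟩
        simp only [Algebra.linearMap_apply, smul_eq_mul]
        rw [div_mul_eq_mul_div, eq_div_iff hxK, ← map_mul, ← map_mul, hu, mul_comm]
    obtain ⟨z, hz⟩ := IsIntegrallyClosed.algebraMap_eq_of_integral hint
    refine hy (Ideal.mem_span_singleton'.mpr ⟨z, ?_⟩)
    apply IsFractionRing.injective R K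
    rw [map_mul, hz, div_mul_cancel₀ _ hxK]
  · push Not at hA
    obtain ⟨p, hp, u, hu, huP⟩ := hA
    have hmin : P.asIdeal ∈ (Ideal.span {p}).minimalPrimes := by
      refine ⟨⟨P.2, (Ideal.span_singleton_le_iff_mem _).mpr hp⟩, ?_⟩
      rintro q' ⟨hq', hpq'⟩ hle q hq
      obtain ⟨t, ht⟩ := Ideal.mem_span_singleton'.mp ((hP q).mp hq)
      have e : q * u = p * t := by
        apply mul_right_cancel₀ hx
        linear_combination p * ht.symm - q * hu
      have : q * u ∈ q' := by
        rw [e]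
        exact Ideal.mul_mem_right _ _ (hpq' (Ideal.mem_span_singleton_self p))
      exact (hq'.mem_or_mem this).resolve_right (fun h => huP (hle h))
    rw [← PrimeSpectrum.height_eq_orderHeight]
    exact Ideal.height_le_one_of_isPrincipal_of_mem_minimalPrimes _ _ hmin

lemma length_le_coheight {R : Type} [CommRing R] [IsLocalRing R] [IsNoetherianRing R]
    (rs : List R) : ∀ (M : Type) [AddCommGroup M] [Module R M] [Module.Finite R M],
    (∀ r ∈ rs, r ∈ maximalIdeal R) → RingTheory.Sequence.IsWeaklyRegular M rs →
    ∀ P : PrimeSpectrum R, IsAssociatedPrime P.asIdeal M →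
      (rs.length : ℕ∞) ≤ Order.coheight P := by
  induction rs with
  | nil => intros; simp
  | cons r rs ih =>
    intro M _ _ _ hmem hreg P hP
    rw [RingTheory.Sequence.isWeaklyRegular_cons_iff] at hreg
    obtain ⟨hr, hreg⟩ := hreg
    obtain ⟨hp, y, hy⟩ := isAssociatedPrime_iff.mp hP
    have hyP : ∀ q, q ∈ P.asIdeal ↔ q • y = 0 := fun q => by
      rw [hy, Submodule.mem_colon_singleton, Submodule.mem_bot]
    have hy0 : y ≠ 0 := by
      rintro rfl
      exact hp.ne_top ((Ideal.eq_top_iff_one _).mpr ((hyP 1).mpr (by simp)))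
    have hrP : r ∉ P.asIdeal := fun h => hy0 (hr.right_eq_zero_of_smul ((hyP r).mp h))
    let N : Submodule R M :=
      { carrier := {m | ∀ p ∈ P.asIdeal, p • m = 0}
        zero_mem' := by simp
        add_mem' := by
          intro a b ha hb p hp
          rw [smul_add, ha p hp, hb p hp, add_zero]
        smul_mem' := by
          intro c a ha p hp
          rw [smul_comm, ha p hp, smul_zero] }
    have hyN : y ∈ N := fun p hp => (hyP p).mp hp
    have hex : ∃ m ∈ N, m ∉ r • (⊤ : Submodule R M) := by
      by_contra hcon
      push Not at hcon
      have hle : N ≤ Ideal.span {r} • N := by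
        intro m hm
        obtain ⟨m', -, e⟩ := (Submodule.mem_smul_pointwise_iff_exists _ _ _).mp (hcon m hm)
        have hm' : m' ∈ N := by
          intro p hp
          apply hr.right_eq_zero_of_smul
          rw [smul_comm, e]
          exact hm p hp
        rw [← e]
        exact Submodule.smul_mem_smul (Ideal.mem_span_singleton_self r) hm'
      have : N = ⊥ := Submodule.eq_bot_of_le_smul_of_le_jacobson_bot (Ideal.span {r}) N
        (IsNoetherian.noetherian _) hle
        (((Ideal.span_singleton_le_iff_mem _).mpr (hmem r (by simp))).trans
          (IsLocalRing.maximalIdeal_le_jacobson _))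
      rw [this] at hyN
      exact hy0 hyN
    obtain ⟨m, hmN, hm⟩ := hex
    have hm0 : (Submodule.Quotient.mk m : QuotSMulTop r M) ≠ 0 := by
      rwa [Ne, Submodule.Quotient.mk_eq_zero]
    obtain ⟨Q, hQ, hle⟩ := exists_le_isAssociatedPrime_of_isNoetherianRing R _ hm0
    have hrQ : r ∈ Q := by
      apply hle
      rw [Submodule.mem_colon_singleton, Submodule.mem_bot, ← Submodule.Quotient.mk_smul,
        Submodule.Quotient.mk_eq_zero]
      exact Submodule.smul_mem_pointwise_smul _ _ _ trivial
    have hPQ : P.asIdeal ≤ Q := by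
      intro p hp
      apply hle
      rw [Submodule.mem_colon_singleton, Submodule.mem_bot, ← Submodule.Quotient.mk_smul,
        hmN p hp, Submodule.Quotient.mk_zero]
    have hlt : P < ⟨Q, hQ.isPrime⟩ := lt_of_le_of_ne hPQ (fun e => hrP (by rw [e]; exact hrQ))
    have h1 := ih (QuotSMulTop r M) (fun a ha => hmem a (by simp [ha])) hreg ⟨Q, hQ.isPrime⟩ hQ
    have h2 := Order.coheight_add_one_le hlt
    push_cast [List.length_cons]
    exact (add_le_add_left h1 1).trans h2

lemma height_assoc_canonical {R : Type} [CommRing R] [IsLocalRing R] [IsNoetherianRing R]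
    (J : Ideal R) (hJ : IsCanonicalIdeal R J) (P : PrimeSpectrum R)
    (hP : IsAssociatedPrime P.asIdeal (R ⧸ J)) : Order.height P ≤ 1 := by
  obtain ⟨-, -, d', -, hd, hdep, -⟩ := hJ
  have h1 : (d' : ℕ∞) ≤ Order.coheight P := by
    rw [← hdep]
    refine sSup_le ?_
    rintro n ⟨rs, rfl, hmem, hreg⟩
    exact length_le_coheight rs _ hmem hreg P hP
  have h2 : ((Order.height P + Order.coheight P : ℕ∞) : WithBot ℕ∞) ≤ (d' : WithBot ℕ∞) + 1 := by
    rw [hd]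
    unfold ringKrullDim
    rw [Order.krullDim_eq_iSup_height_add_coheight_of_nonempty]
    exact WithBot.coe_le_coe.mpr (le_iSup (fun a => Order.height a + Order.coheight a) P)
  have h3 : Order.height P + (d' : ℕ∞) ≤ 1 + (d' : ℕ∞) := by
    refine (add_le_add_right h1 _).trans ?_
    rw [add_comm 1]
    exact_mod_cast h2
  exact (ENat.add_le_add_iff_right (ENat.natCast_ne_top d')).mp h3

lemma pow_mul_mem {R : Type} [CommRing R] (I : Ideal R) (j x : R)
    (h : ∀ a ∈ I, j * a ∈ Ideal.span {x}) (n : ℕ) (a : R) (ha : a ∈ I ^ n) :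
    j ^ n * a ∈ Ideal.span {x ^ n} := by
  have h1 : Ideal.span {j} * I ≤ Ideal.span {x} := by
    rw [Ideal.span_singleton_mul_le_iff]
    exact h
  have h2 := Ideal.pow_right_mono h1 n
  rw [mul_pow, Ideal.span_singleton_pow, Ideal.span_singleton_pow] at h2
  exact h2 (Ideal.mul_mem_mul (Ideal.mem_span_singleton_self _) ha)

lemma mem_symb_of_local {R : Type} [CommRing R] [IsNoetherianRing R] (I : Ideal R) (n : ℕ) (r : R)
    (h : ∀ P ∈ I.minimalPrimes, ∃ s, s ∉ P ∧ s * r ∈ I ^ n) : r ∈ symb I n := by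
  let C : Ideal R := Submodule.comap (LinearMap.mulRight R r) (I ^ n)
  have hC : ∀ s, s ∈ C ↔ s * r ∈ I ^ n := fun s => Iff.rfl
  have hfin := I.finite_minimalPrimes_of_isNoetherianRing
  by_contra hcon
  have hsub : (C : Set R) ⊆ ⋃ P ∈ (hfin.toFinset : Set (Ideal R)), (P : Set R) := by
    intro s hs
    by_contra hs'
    apply hcon
    refine ⟨s, fun P hP hsP => hs' ?_, (hC s).mp hs⟩
    simp only [Set.mem_iUnion]
    exact ⟨P, by simpa using hP, hsP⟩
  obtain ⟨P, hP, hle⟩ := (Ideal.subset_union_prime (f := fun P : Ideal R => P) ⊥ ⊥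
    (fun P hP _ _ => ((Set.Finite.mem_toFinset hfin).mp hP).1.1)).mp hsub
  obtain ⟨s, hs, hsr⟩ := h P ((Set.Finite.mem_toFinset hfin).mp hP)
  exact hs (hle ((hC s).mpr hsr))

lemma core {R : Type} [CommRing R] [IsNoetherianRing R] [IsDomain R] (I J : Ideal R) (x : R)
    (hx0 : x ≠ 0) (hxI : x ∈ I) (hxJ : x ∈ J) (hIJ : ∀ a ∈ I, ∀ b ∈ J, a * b ∈ Ideal.span {x})
    (hI : ∀ P ∈ I.minimalPrimes, ∃ j ∈ J, j ∉ P)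
    (hJ : ∀ P ∈ J.minimalPrimes, ∃ j ∈ I, j ∉ P)
    (hJass : ∀ r, (∀ P ∈ J.minimalPrimes, ∃ s, s ∉ P ∧ s * r ∈ J) → r ∈ J)
    (hxass : ∀ n r, (∀ P ∈ I.minimalPrimes, ∃ s, s ∉ P ∧ s * r ∈ Ideal.span {x ^ n}) →
      (∀ P ∈ J.minimalPrimes, ∃ s, s ∉ P ∧ s * r ∈ Ideal.span {x ^ n}) →
      ∃ t, r = x ^ n * t) (n : ℕ) :
      Nonempty ((↥J) ≃ₗ[R] ↥(symb I n ⊓ symb J (n + 1))) ∧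
      Nonempty ((↥(symb J (n + 1)) →ₗ[R] ↥J) ≃ₗ[R] ↥(symb I n)) := by
  have hpow : ∀ (L : Ideal R) (k : ℕ), L ^ k ≤ symb L k := fun L k a ha =>
    ⟨1, fun P hP h1 => hP.1.1.ne_top ((Ideal.eq_top_iff_one P).mpr h1), by simpa using ha⟩
  have hxn : x ^ n ≠ 0 := pow_ne_zero _ hx0
  have ha : ∀ c ∈ J, x ^ n * c ∈ symb I n ⊓ symb J (n + 1) := fun c hc =>
    ⟨hpow I n (Ideal.mul_mem_right _ _ (Ideal.pow_mem_pow hxI n)),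
      hpow J (n + 1) (by rw [pow_succ]; exact Ideal.mul_mem_mul (Ideal.pow_mem_pow hxJ n) hc)⟩
  have hb : ∀ r ∈ symb I n, r ∈ symb J (n + 1) → ∃ t ∈ J, r = x ^ n * t := by
    rintro r ⟨s, hs, hsr⟩ ⟨s', hs', hsr'⟩
    have h2 : ∀ P ∈ J.minimalPrimes, ∃ s, s ∉ P ∧ s * r ∈ Ideal.span {x ^ (n + 1)} := by
      intro P hP
      have := hP.1.1
      obtain ⟨j, hj, hjP⟩ := hJ P hP
      refine ⟨j ^ (n + 1) * s', fun h => ?_, ?_⟩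
      · rcases this.mem_or_mem h with h | h
        · exact hjP (this.mem_of_pow_mem _ h)
        · exact hs' P hP h
      · rw [mul_assoc]
        exact pow_mul_mem J j x (fun a ha => hIJ j hj a ha) _ _ hsr'
    obtain ⟨t, rfl⟩ := hxass n r (by
      intro P hP
      have := hP.1.1
      obtain ⟨j, hj, hjP⟩ := hI P hP
      refine ⟨j ^ n * s, fun h => ?_, ?_⟩
      · rcases this.mem_or_mem h with h | h
        · exact hjP (this.mem_of_pow_mem _ h)
        · exact hs P hP h
      · rw [mul_assoc]
        exact pow_mul_mem I j x (fun a ha => by rw [mul_comm]; exact hIJ a ha j hj) _ _ hsr) (by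
      intro P hP
      obtain ⟨s, hs, h⟩ := h2 P hP
      refine ⟨s, hs, ?_⟩
      rw [Ideal.mem_span_singleton] at h ⊢
      exact (pow_dvd_pow x (Nat.le_succ n)).trans h)
    refine ⟨t, hJass t fun P hP => ?_, rfl⟩
    obtain ⟨s, hs, h⟩ := h2 P hP
    obtain ⟨w, hw⟩ := Ideal.mem_span_singleton'.mp h
    refine ⟨s, hs, ?_⟩
    have : s * t = w * x := by
      apply mul_left_cancel₀ hxn
      linear_combination -hw
    rw [this]
    exact Ideal.mul_mem_left _ _ hxJ
  constructor
  · let f : J →ₗ[R] ↥(symb I n ⊓ symb J (n + 1)) :=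
      { toFun := fun c => ⟨x ^ n * c, ha c c.2⟩
        map_add' := fun a b => Subtype.ext (mul_add _ _ _)
        map_smul' := fun a b => Subtype.ext (by simp [mul_left_comm]) }
    refine ⟨LinearEquiv.ofBijective f ⟨fun a b h => ?_, fun r => ?_⟩⟩
    · exact Subtype.ext (mul_left_cancel₀ hxn (congrArg Subtype.val h))
    · obtain ⟨t, ht, e⟩ := hb r r.2.1 r.2.2
      exact ⟨⟨t, ht⟩, Subtype.ext e.symm⟩
  · have hex : ∀ (b : symb I n) (a : symb J (n + 1)), ∃ t : J, (b : R) * a = x ^ n * t := by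
      intro b a
      obtain ⟨t, ht, e⟩ := hb (b * a) (Ideal.mul_mem_right _ _ b.2) (Ideal.mul_mem_left _ _ a.2)
      exact ⟨⟨t, ht⟩, e⟩
    choose g hg using hex
    let F : ↥(symb I n) →ₗ[R] (↥(symb J (n + 1)) →ₗ[R] ↥J) :=
      LinearMap.mk₂ R g
        (fun a b c => Subtype.ext (mul_left_cancel₀ hxn (by
          rw [← hg]; push_cast; rw [mul_add, ← hg, ← hg, add_mul])))
        (fun a b c => Subtype.ext (mul_left_cancel₀ hxn (by
          rw [← hg]; push_cast; rw [smul_eq_mul, smul_eq_mul]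
          linear_combination a * hg b c)))
        (fun a b c => Subtype.ext (mul_left_cancel₀ hxn (by
          rw [← hg]; push_cast; rw [mul_add, mul_add, ← hg, ← hg])))
        (fun a b c => Subtype.ext (mul_left_cancel₀ hxn (by
          rw [← hg]; push_cast; rw [smul_eq_mul, smul_eq_mul]
          linear_combination a * hg b c)))
    have hF : ∀ (b : symb I n) (a : symb J (n + 1)), (b : R) * a = x ^ n * (F b a : R) := hg
    let X : symb J (n + 1) := ⟨x ^ (n + 1), hpow J _ (Ideal.pow_mem_pow hxJ _)⟩
    have hX0 : (X : R) ≠ 0 := pow_ne_zero _ hx0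
    refine ⟨(LinearEquiv.ofBijective F ⟨fun b b' h => ?_, fun φ => ?_⟩).symm⟩
    · apply Subtype.ext
      apply mul_right_cancel₀ hX0
      rw [hF, hF, h]
    · have hφ : ∀ a c : symb J (n + 1), (a : R) * (φ c : R) = c * (φ a : R) := by
        intro a c
        have e : (a : R) • c = (c : R) • a := Subtype.ext (mul_comm _ _)
        have := congrArg (fun z => ((φ z : J) : R)) e
        simpa using this
      have hyI : ∀ P ∈ I.minimalPrimes, ∃ s, s ∉ P ∧
          s * (φ X : R) ∈ Ideal.span {x ^ (n + 1)} := by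
        intro P hP
        have := hP.1.1
        obtain ⟨j, hj, hjP⟩ := hI P hP
        refine ⟨j ^ (n + 1), fun h => hjP (this.mem_of_pow_mem _ h), ?_⟩
        rw [hφ ⟨j ^ (n + 1), hpow J _ (Ideal.pow_mem_pow hj _)⟩ X]
        exact Ideal.mul_mem_right _ _ (Ideal.mem_span_singleton_self _)
      obtain ⟨b, hb'⟩ := hxass 1 (φ X : R) (by
        intro P hP
        obtain ⟨s, hs, h⟩ := hyI P hP
        refine ⟨s, hs, ?_⟩
        rw [Ideal.mem_span_singleton] at h ⊢
        exact (pow_dvd_pow x (by omega)).trans h) (by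
        intro P hP
        obtain ⟨j, hj, hjP⟩ := hJ P hP
        refine ⟨j, hjP, ?_⟩
        rw [pow_one]
        exact hIJ j hj _ (φ X).2)
      have hbI : b ∈ symb I n := by
        apply mem_symb_of_local
        intro P hP
        obtain ⟨s, hs, h⟩ := hyI P hP
        obtain ⟨w, hw⟩ := Ideal.mem_span_singleton'.mp h
        refine ⟨s, hs, ?_⟩
        have : s * b = w * x ^ n := by
          apply mul_left_cancel₀ hx0
          rw [hb'] at hw
          linear_combination -hw
        rw [this]
        exact Ideal.mul_mem_left _ _ (Ideal.pow_mem_pow hxI n)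
      refine ⟨⟨b, hbI⟩, LinearMap.ext fun a => Subtype.ext ?_⟩
      apply mul_left_cancel₀ hxn
      rw [← hF]
      apply mul_left_cancel₀ hx0
      have h1 := hφ X a
      rw [hb'] at h1
      have h2 : (X : R) = x ^ (n + 1) := rfl
      rw [h2] at h1
      change x * (b * (a : R)) = _
      linear_combination -h1

end HomSymb

/-- In a CM local normal domain with canonical ideal `J₁` and `I₁` of pure height one with
components disjoint from those of `J₁` and `I₁ ∩ J₁ = (x₁)` principal, one has
`J₁ ≅ I₁^{(mi)} ∩ J₁^{(mi+1)}` and `Hom_R(J₁^{(mi+1)}, J₁) ≅ I₁^{(mi)}`. -/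
theorem hom_of_symbolic_canonical {R : Type} [CommRing R] [IsLocalRing R] [IsNoetherianRing R]
    [IsDomain R] [IsIntegrallyClosed R] (hCM : IsCMLocalRing R) (d : ℕ)
    (hdim : ringKrullDim R = (d : WithBot ℕ∞))
    (J₁ : Ideal R) (hJ : IsCanonicalIdeal R J₁)
    (I₁ : Ideal R) (hI : PureHeightOne I₁)
    (hdisj : I₁.minimalPrimes ∩ J₁.minimalPrimes = ∅)
    (x₁ : R) (hx : I₁ ⊓ J₁ = Ideal.span {x₁}) :
    ∀ m i : ℕ,
      Nonempty ((↥J₁) ≃ₗ[R] ↥(symb I₁ (m * i) ⊓ symb J₁ (m * i + 1))) ∧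
      Nonempty ((↥(symb J₁ (m * i + 1)) →ₗ[R] ↥J₁) ≃ₗ[R] ↥(symb I₁ (m * i))) := by
  intro m i
  have hI0 := hI.1
  have hJ0 := hJ.1
  have hxmem : x₁ ∈ I₁ ⊓ J₁ := by rw [hx]; exact Ideal.mem_span_singleton_self _
  have hIJ : ∀ a ∈ I₁, ∀ b ∈ J₁, a * b ∈ Ideal.span {x₁} := fun a ha b hb => by
    rw [← hx]; exact ⟨Ideal.mul_mem_right _ _ ha, Ideal.mul_mem_left _ _ hb⟩
  have hx0 : x₁ ≠ 0 := by
    rintro rfl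
    obtain ⟨a, ha, ha0⟩ := Submodule.exists_mem_ne_zero_of_ne_bot hI0
    obtain ⟨b, hb, hb0⟩ := Submodule.exists_mem_ne_zero_of_ne_bot hJ0
    have := hIJ a ha b hb
    rw [Ideal.mem_span_singleton, zero_dvd_iff] at this
    exact mul_ne_zero ha0 hb0 this
  have hIh : ∀ P (hP : P ∈ I₁.minimalPrimes),
      Order.height (⟨P, hP.1.1⟩ : PrimeSpectrum R) ≤ 1 := by
    intro P hP
    rw [← hI.2.2 P hP]
    exact le_iInf₂ fun p hp => Order.height_mono hp
  have hJass : ∀ r, (∀ P ∈ J₁.minimalPrimes, ∃ s, s ∉ P ∧ s * r ∈ J₁) → r ∈ J₁ := by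
    intro r h
    by_contra hr
    obtain ⟨P, hP, ⟨y, -, hy⟩, hs⟩ := HomSymb.exists_assoc J₁ r hr
    obtain ⟨s, hsP, hsr⟩ := h P.asIdeal (HomSymb.mem_minimalPrimes_of_height P
      (HomSymb.height_assoc_canonical J₁ hJ P hP) J₁ hJ0
      (fun a ha => (hy a).mpr (Ideal.mul_mem_right _ _ ha)))
    exact hsP (hs s hsr)
  have hJh : ∀ P (hP : P ∈ J₁.minimalPrimes),
      Order.height (⟨P, hP.1.1⟩ : PrimeSpectrum R) ≤ 1 := by
    intro P hP
    apply HomSymb.height_assoc_canonical J₁ hJ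
    apply Module.associatedPrimes.minimalPrimes_annihilator_subset_associatedPrimes R (R ⧸ J₁)
    rwa [Ideal.annihilator_quotient]
  refine HomSymb.core I₁ J₁ x₁ hx0 hxmem.1 hxmem.2 hIJ ?_ ?_ hJass ?_ (m * i)
  · intro P hP
    by_contra! hcon
    have : P ∈ I₁.minimalPrimes ∩ J₁.minimalPrimes :=
      ⟨hP, HomSymb.mem_minimalPrimes_of_height ⟨P, hP.1.1⟩ (hIh P hP) J₁ hJ0 hcon⟩
    rw [hdisj] at this
    exact this
  · intro P hP
    by_contra! hcon
    have : P ∈ I₁.minimalPrimes ∩ J₁.minimalPrimes :=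
      ⟨HomSymb.mem_minimalPrimes_of_height ⟨P, hP.1.1⟩ (hJh P hP) I₁ hI0 hcon, hP⟩
    rw [hdisj] at this
    exact this
  · intro n r h1 h2
    suffices hr : r ∈ Ideal.span {x₁ ^ n} by
      obtain ⟨t, ht⟩ := Ideal.mem_span_singleton'.mp hr
      exact ⟨t, by rw [← ht, mul_comm]⟩
    by_contra hr
    obtain ⟨P, hP, ⟨y, hyx, hy⟩, hs⟩ := HomSymb.exists_assoc _ r hr
    have hh := HomSymb.height_assoc_principal _ (pow_ne_zero n hx0) P y hyx hy
    have hxP : x₁ ∈ P.asIdeal := P.2.mem_of_pow_mem n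
      ((hy _).mpr (Ideal.mul_mem_right _ _ (Ideal.mem_span_singleton_self _)))
    have hle : I₁ ⊓ J₁ ≤ P.asIdeal := by
      rw [hx]; exact (Ideal.span_singleton_le_iff_mem _).mpr hxP
    rcases (P.2.inf_le).mp hle with hle | hle
    · obtain ⟨s, hsP, hsr⟩ := h1 _ (HomSymb.mem_minimalPrimes_of_height P hh I₁ hI0 hle)
      exact hsP (hs s hsr)
    · obtain ⟨s, hsP, hsr⟩ := h2 _ (HomSymb.mem_minimalPrimes_of_height P hh J₁ hJ0 hle)
      exact hsP (hs s hsr)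

end
end

section
/- Let (R,m,k) be an excellent Noetherian local normal domain with infinite residue field, I ⊆ R an ideal, P_1,...,P_t pairwise incomparable primes, W = R \ ∪P_i, and suppose the analytic spread ℓ(I R_{P_i}) ≤ h for each i. Then there exist y_1,...,y_h ∈ I and x ∈ W such that (y_1,...,y_h)R_W is a reduction of I R_W and x^n \overline{I^n} ⊆ \overline{(y_1,...,y_h)^n} for all n. -/
set_option synthInstance.maxHeartbeats 400000
set_option maxHeartbeats 400000

open IsLocalRing

noncomputable section

/-- The multiplicative set `R \ (P₁ ∪ ⋯ ∪ P_t)`. -/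
def complS {R : Type} [CommRing R] {t : ℕ} (P : Fin t → Ideal R)
    (hP : ∀ i, (P i).IsPrime) : Submonoid R where
  carrier := {r | ∀ i, r ∉ P i}
  one_mem' := fun i h1 => (hP i).ne_top ((Ideal.eq_top_iff_one _).mpr h1)
  mul_mem' := by
    intro a b ha hb i hm
    rcases (hP i).mem_or_mem hm with h | h
    · exact ha i h
    · exact hb i h

/-- The fiber cone of the ideal `I` at the prime `P`: the Rees algebra of `I R_P`
modulo the maximal ideal of `R_P`. -/
abbrev fiberConeAt {R : Type} [CommRing R] (I P : Ideal R) [P.IsPrime] : Type :=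
  ↥(reesAlgebra (I.map (algebraMap R (Localization.AtPrime P)))) ⧸
    Ideal.map
      (algebraMap (Localization.AtPrime P)
        (↥(reesAlgebra (I.map (algebraMap R (Localization.AtPrime P))))))
      (maximalIdeal (Localization.AtPrime P))

namespace SGR

section main
open Submodule

section step
variable {k F : Type} [Field k] [CommRing F] [Algebra k F]

def NN (U' U : Submodule k F) : ℕ → Submodule k F
  | 0 => ⊥
  | (d+1) => U' * U ^ d

lemma NN_mul_le (U' U : Submodule k F) (d : ℕ) : NN U' U d * U ≤ NN U' U (d+1) := by
  cases d with
  | zero => simp [NN]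
  | succ d => simp only [NN]; rw [mul_assoc, pow_succ]

lemma multiset_claim {σ : Type} (U' U : Submodule k F) (y : σ → F) (w : σ → k) (z : F)
    (hy : ∀ i, y i ∈ U) (hz : z ∈ U) (hyw : ∀ i, y i - w i • z ∈ U') (s : Multiset σ) :
    (s.map y).prod ∈ U ^ s.card ∧
    (s.map y).prod - (s.map w).prod • z ^ s.card ∈ NN U' U s.card := by
  induction s using Multiset.induction_on with
  | empty => simpa [NN, Submodule.mem_one] using ⟨1, map_one _⟩
  | cons a s ih =>
    obtain ⟨ih1, ih2⟩ := ih
    simp only [Multiset.map_cons, Multiset.prod_cons, Multiset.card_cons]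
    refine ⟨by rw [pow_succ']; exact Submodule.mul_mem_mul (hy a) ih1, ?_⟩
    have e : y a * (s.map y).prod - (w a * (s.map w).prod) • z ^ (s.card + 1)
      = (y a - w a • z) * (s.map y).prod
        + w a • (((s.map y).prod - (s.map w).prod • z ^ s.card) * z) := by
      simp only [Algebra.smul_def, map_mul]; ring
    rw [e]
    refine add_mem (Submodule.mul_mem_mul (hyw a) ih1) (Submodule.smul_mem _ _ ?_)
    exact NN_mul_le _ _ _ (Submodule.mul_mem_mul ih2 hz)

lemma toMultiset_map_prod {σ M : Type} [CommMonoid M] (m : σ →₀ ℕ) (y : σ → M) :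
    (m.toMultiset.map y).prod = ∏ i ∈ m.support, y i ^ m i := by
  classical
  rw [Finsupp.toMultiset_map, Finsupp.prod_toMultiset,
    Finsupp.prod_mapDomain_index (by simp) (by simp [pow_add])]
  rfl

lemma aeval_claim {σ : Type} (U' U : Submodule k F) (y : σ → F) (w : σ → k) (z : F)
    (hy : ∀ i, y i ∈ U) (hz : z ∈ U) (hyw : ∀ i, y i - w i • z ∈ U')
    (f : MvPolynomial σ k) (d : ℕ) (hf : f.IsHomogeneous d) :
    MvPolynomial.aeval y f - (MvPolynomial.eval w f) • z ^ d ∈ NN U' U d := by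
  rw [MvPolynomial.aeval_def, MvPolynomial.eval₂_eq, MvPolynomial.eval_eq, Finset.sum_smul,
    ← Finset.sum_sub_distrib]
  refine Submodule.sum_mem _ fun m hm => ?_
  have hd : m.degree = d := by
    by_contra hne
    exact (MvPolynomial.mem_support_iff.1 hm) (hf.coeff_eq_zero hne)
  have := (multiset_claim U' U y w z hy hz hyw m.toMultiset).2
  rw [Finsupp.card_toMultiset] at this
  rw [← Algebra.smul_def, mul_smul, ← smul_sub]
  refine Submodule.smul_mem _ _ ?_
  have hd' : (m.sum fun _ => id) = d := by rw [← hd]; rfl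
  rw [hd', toMultiset_map_prod, toMultiset_map_prod] at this
  exact this

lemma aeval_mem_pow {σ : Type} (U : Submodule k F) (y : σ → F)
    (hy : ∀ i, y i ∈ U)
    (f : MvPolynomial σ k) (d : ℕ) (hf : f.IsHomogeneous d) :
    MvPolynomial.aeval y f ∈ U ^ d := by
  have := aeval_claim U U y 0 0 hy (zero_mem _) (by simpa using hy) f d hf
  cases d with
  | zero =>
    rw [← MvPolynomial.totalDegree_zero_iff_isHomogeneous, MvPolynomial.totalDegree_eq_zero_iff_eq_C] at hf
    rw [hf]; simp [Submodule.mem_one]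
  | succ d => simpa [NN, pow_succ'] using this

lemma pow_le_claim (U' U : Submodule k F) (z : F) (hzU : z ∈ U)
    (hU : U ≤ U' ⊔ span k {z}) (d : ℕ) : U ^ d ≤ NN U' U d ⊔ span k {z ^ d} := by
  induction d with
  | zero => simp [NN, Submodule.one_eq_span]
  | succ d ih =>
    rw [pow_succ]
    refine (mul_le_mul' ih le_rfl).trans ?_
    rw [Submodule.sup_mul]
    refine sup_le ((NN_mul_le _ _ _).trans le_sup_left) ?_
    refine (mul_le_mul' le_rfl hU).trans ?_
    rw [Submodule.mul_sup]
    refine sup_le (le_sup_of_le_left ?_) (le_sup_of_le_right ?_)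
    · rw [mul_comm]
      refine mul_le_mul' le_rfl ?_
      rw [Submodule.span_singleton_le_iff_mem]
      exact Submodule.pow_mem_pow _ hzU _
    · rw [Submodule.span_mul_span, Set.singleton_mul_singleton, pow_succ]

lemma step {n : ℕ} [Infinite k] (y : Fin (n+1) → F) (f : MvPolynomial (Fin (n+1)) k) (e : ℕ)
    (hf : f.IsHomogeneous (e+1)) (hf0 : f ≠ 0) (hy : MvPolynomial.aeval y f = 0) :
    ∃ y' : Fin n → F, (∀ i, y' i ∈ span k (Set.range y)) ∧
      span k (Set.range y) ^ (e+1) ≤ span k (Set.range y') * span k (Set.range y) ^ e := by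
  obtain ⟨c, hc⟩ : ∃ c, MvPolynomial.eval c f ≠ 0 := by
    by_contra! hcon
    exact hf0 (MvPolynomial.funext (by simpa using hcon))
  have hc0 : ∃ j, c j ≠ 0 := by
    by_contra! hcon
    apply hc
    have : c = 0 := funext hcon
    subst this
    have := aeval_mem_pow (⊥ : Submodule k k) (0 : Fin (n+1) → k) (by simp) f _ hf
    rw [pow_succ, Submodule.mul_bot, Submodule.mem_bot] at this
    simpa [MvPolynomial.aeval_eq_eval] using this
  obtain ⟨j, hj⟩ := hc0
  set w : Fin (n+1) → k := fun i => c i / c j with hw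
  have hwj : w j = 1 := by simp [hw, hj]
  have hwf : MvPolynomial.eval w f ≠ 0 := by
    intro h0
    apply hc
    have := aeval_claim (⊥ : Submodule k k) ⊤ c w (c j) (by simp) (by simp)
      (by intro i; simp [hw, hj]) f _ hf
    simpa [MvPolynomial.aeval_eq_eval, NN, h0] using this
  set U := span k (Set.range y) with hUdef
  have hyU : ∀ i, y i ∈ U := fun i => Submodule.subset_span ⟨i, rfl⟩
  refine ⟨fun i => y (j.succAbove i) - w (j.succAbove i) • y j,
    fun i => sub_mem (hyU _) (Submodule.smul_mem _ _ (hyU _)), ?_⟩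
  set U' := span k (Set.range fun i => y (j.succAbove i) - w (j.succAbove i) • y j) with hU'
  have hU'U : U' ≤ U := by
    rw [hU', Submodule.span_le]
    rintro _ ⟨i, rfl⟩
    exact sub_mem (hyU _) (Submodule.smul_mem _ _ (hyU _))
  have hyw : ∀ i, y i - w i • y j ∈ U' := by
    intro i
    rcases Fin.eq_self_or_eq_succAbove j i with rfl | ⟨i, rfl⟩
    · simp [hwj]
    · exact Submodule.subset_span ⟨i, rfl⟩
  have hUle : U ≤ U' ⊔ span k {y j} := by
    rw [hUdef, Submodule.span_le]
    rintro _ ⟨i, rfl⟩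
    have : y i = (y i - w i • y j) + w i • y j := by abel
    rw [this]
    exact Submodule.add_mem_sup (hyw i) (Submodule.smul_mem _ _ (Submodule.mem_span_singleton_self _))
  have hz : y j ^ (e+1) ∈ NN U' U (e+1) := by
    have := aeval_claim U' U y w (y j) hyU (hyU j) hyw f _ hf
    rw [hy, zero_sub, neg_mem_iff] at this
    exact (Submodule.smul_mem_iff _ hwf).1 this
  have := pow_le_claim U' U (y j) (hyU j) hUle (e+1)
  refine this.trans (sup_le le_rfl ?_)
  rwa [Submodule.span_singleton_le_iff_mem]
end step
section dim
lemma ringKrullDim_le_of_integral {B F : Type} [CommRing B] [CommRing F] [Algebra B F]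
    [Algebra.IsIntegral B F] (hinj : Function.Injective (algebraMap B F)) :
    ringKrullDim B ≤ ringKrullDim F := by
  refine iSup_le fun l => ?_
  obtain ⟨Q, -, hQ, hQc⟩ := Ideal.exists_ideal_over_prime_of_isIntegral (S := F)
    (RelSeries.head l).asIdeal ⊥
    (by change RingHom.ker _ ≤ _; rw [(RingHom.injective_iff_ker_eq_bot _).1 hinj]; exact bot_le)
  have : Q.LiesOver (RelSeries.head l).asIdeal := ⟨hQc.symm⟩
  obtain ⟨L, hL, -⟩ := Ideal.exists_ltSeries_of_hasGoingUp l Q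
  rw [← hL]
  exact le_iSup (fun L : LTSeries (PrimeSpectrum F) => ((L.length : ℕ) : WithBot ℕ∞)) L

variable {k F : Type} [Field k] [CommRing F] [Algebra k F]

lemma one_sup_pow (V : Submodule k F) (N : ℕ) :
    (1 ⊔ V) ^ (N+1) ≤ (1 ⊔ V) ^ N ⊔ V ^ (N+1) := by
  induction N with
  | zero => simp
  | succ N ih =>
    rw [pow_succ' _ (N+1)]
    refine (mul_le_mul' le_rfl ih).trans ?_
    rw [Submodule.mul_sup, ← pow_succ', Submodule.sup_mul, one_mul, ← pow_succ']
    refine sup_le le_sup_left (sup_le (le_sup_of_le_left ?_) le_sup_right)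
    exact pow_le_pow_left' le_sup_right _

lemma finite_of_red {n : ℕ} (V : Submodule k F) (hV : V.FG) (hgen : Algebra.adjoin k (V : Set F) = ⊤)
    (y : Fin n → F) (N : ℕ) (hred : V ^ (N+1) ≤ span k (Set.range y) * V ^ N) :
    (MvPolynomial.aeval y : MvPolynomial (Fin n) k →ₐ[k] F).toRingHom.Finite := by
  set g := (MvPolynomial.aeval y : MvPolynomial (Fin n) k →ₐ[k] F) with hg
  let _ : Algebra (MvPolynomial (Fin n) k) F := g.toRingHom.toAlgebra
  have halg : ∀ b, algebraMap (MvPolynomial (Fin n) k) F b = g b := fun _ => rfl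
  have : IsScalarTower k (MvPolynomial (Fin n) k) F := IsScalarTower.of_algebraMap_eq (by
    intro x; rw [halg]; simp)
  set T := (1 ⊔ V) ^ N with hT
  have hTfg : T.FG := Submodule.FG.pow (Submodule.FG.sup (by rw [Submodule.one_eq_span]; exact ⟨{1}, by simp⟩) hV) _
  set M : Submodule (MvPolynomial (Fin n) k) F := span _ (T : Set F) with hM
  have hMfg : M.FG := by
    obtain ⟨s, hs⟩ := hTfg
    refine ⟨s, ?_⟩
    rw [hM, ← hs]
    exact (Submodule.span_span_of_tower k _ _).symm
  have h1 : (1 : F) ∈ T := by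
    have := Submodule.pow_mem_pow (1 ⊔ V) (x := (1:F)) (Submodule.mem_sup_left (Submodule.mem_one.2 ⟨1, map_one _⟩)) N
    simpa using this
  have hVT : ∀ v ∈ V, ∀ x ∈ T, v * x ∈ M := by
    have key : V * T ≤ M.restrictScalars k := by
      have h2 : V * T ≤ (1 ⊔ V) ^ (N+1) := by
        rw [pow_succ']; exact mul_le_mul' le_sup_right le_rfl
      refine h2.trans ((one_sup_pow V N).trans (sup_le ?_ (hred.trans ?_)))
      · intro x hx; exact Submodule.subset_span hx
      · rw [Submodule.mul_le]
        intro u hu v hv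
        have hvT : v ∈ T := (pow_le_pow_left' (le_sup_right : V ≤ 1 ⊔ V) N : V ^ N ≤ T) hv
        refine Submodule.span_induction (p := fun u _ => u * v ∈ M.restrictScalars k) ?_ ?_ ?_ ?_ hu
        · rintro _ ⟨i, rfl⟩
          have : y i * v = (MvPolynomial.X i : MvPolynomial (Fin n) k) • v := by
            rw [Algebra.smul_def, halg, hg, MvPolynomial.aeval_X]
          rw [this]
          exact M.smul_mem _ (Submodule.subset_span hvT)
        · simp
        · intro a b _ _ ha hb; rw [add_mul]; exact add_mem ha hb
        · intro c a _ ha; rw [smul_mul_assoc]; exact Submodule.smul_mem _ _ ha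
    intro v hv x hx
    exact key (Submodule.mul_mem_mul hv hx)
  have hVM : ∀ v ∈ V, ∀ x ∈ M, v * x ∈ M := by
    intro v hv x hx
    refine Submodule.span_induction (p := fun x _ => v * x ∈ M) ?_ ?_ ?_ ?_ hx
    · intro x hx; exact hVT v hv x hx
    · simp
    · intro a b _ _ ha hb; rw [mul_add]; exact add_mem ha hb
    · intro c a _ ha; rw [mul_smul_comm]; exact M.smul_mem _ ha
  have hall : ∀ f ∈ Algebra.adjoin k (V : Set F), ∀ x ∈ M, f * x ∈ M := by
    intro f hf
    refine Algebra.adjoin_induction (p := fun f _ => ∀ x ∈ M, f * x ∈ M) ?_ ?_ ?_ ?_ hf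
    · exact hVM
    · intro r x hx
      rw [← Algebra.smul_def]
      exact (M.restrictScalars k).smul_mem r hx
    · intro a b _ _ ha hb x hx; rw [add_mul]; exact add_mem (ha x hx) (hb x hx)
    · intro a b _ _ ha hb x hx; rw [mul_assoc]; exact ha _ (hb x hx)
  have hMtop : M = ⊤ := by
    rw [eq_top_iff]
    intro f _
    have := hall f (by rw [hgen]; trivial) 1 (Submodule.subset_span h1)
    simpa using this
  exact ⟨hMtop ▸ hMfg⟩

lemma exists_dep {n h : ℕ} (V : Submodule k F) (hV : V.FG)
    (hgen : Algebra.adjoin k (V : Set F) = ⊤)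
    (y : Fin n → F) (N : ℕ) (hred : V ^ (N+1) ≤ span k (Set.range y) * V ^ N)
    (hdim : ringKrullDim F ≤ (h : WithBot ℕ∞)) (hn : h < n) :
    ∃ p : MvPolynomial (Fin n) k, p ≠ 0 ∧ MvPolynomial.aeval y p = 0 := by
  by_contra! hcon
  have hfin := finite_of_red V hV hgen y N hred
  set g := (MvPolynomial.aeval y : MvPolynomial (Fin n) k →ₐ[k] F) with hg
  let _ : Algebra (MvPolynomial (Fin n) k) F := g.toRingHom.toAlgebra
  have : Module.Finite (MvPolynomial (Fin n) k) F := hfin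
  have hinj : Function.Injective (algebraMap (MvPolynomial (Fin n) k) F) := by
    rw [injective_iff_map_eq_zero]
    intro p hp
    by_contra hp0
    exact hcon p hp0 hp
  have h1 := (ringKrullDim_le_of_integral hinj).trans hdim
  rw [MvPolynomial.ringKrullDim_of_isNoetherianRing] at h1
  simp at h1
  have : n ≤ h := by exact_mod_cast h1
  omega
end dim

section abs
variable {k F : Type} [Field k] [CommRing F] [Algebra k F]

lemma abs_main [Infinite k] (V : Submodule k F) (hV : V.FG)
    (hgen : Algebra.adjoin k (V : Set F) = ⊤)
    (hind : ∀ (D : ℕ) (v : ℕ → F), (∀ d, v d ∈ V ^ d) → ∑ d ∈ Finset.range D, v d = 0 →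
      ∀ d < D, v d = 0)
    (h : ℕ) (hdim : ringKrullDim F ≤ (h : WithBot ℕ∞)) :
    ∃ y : Fin h → F, (∀ l, y l ∈ V) ∧ ∃ N, V ^ (N+1) ≤ span k (Set.range y) * V ^ N := by
  rcases subsingleton_or_nontrivial F with hF | hF
  · exact ⟨0, fun l => by simp, 0, fun x _ => by rw [Subsingleton.elim x 0]; exact zero_mem _⟩
  have key : ∀ m, (∃ y : Fin (h + m) → F, (∀ l, y l ∈ V) ∧
      ∃ N, V ^ (N+1) ≤ span k (Set.range y) * V ^ N) → 
      ∃ y : Fin h → F, (∀ l, y l ∈ V) ∧ ∃ N, V ^ (N+1) ≤ span k (Set.range y) * V ^ N := by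
    intro m
    induction m with
    | zero => exact id
    | succ m ih =>
      rintro ⟨y, hyV, N, hN⟩
      apply ih
      obtain ⟨p, hp0, hp⟩ := exists_dep V hV hgen y N hN hdim (by omega)
      have hcomp : ∀ d, MvPolynomial.aeval y (MvPolynomial.homogeneousComponent d p) = 0 := by
        intro d
        by_cases hd : d < p.totalDegree + 1
        · refine hind (p.totalDegree + 1)
            (fun d => MvPolynomial.aeval y (MvPolynomial.homogeneousComponent d p)) ?_ ?_ d hd
          · intro d
            exact aeval_mem_pow V y hyV _ _ (MvPolynomial.homogeneousComponent_isHomogeneous d p)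
          · rw [← map_sum, MvPolynomial.sum_homogeneousComponent, hp]
        · rw [MvPolynomial.homogeneousComponent_eq_zero _ _ (by omega), map_zero]
      obtain ⟨d, hd⟩ : ∃ d, MvPolynomial.homogeneousComponent d p ≠ 0 := by
        by_contra! hcon
        apply hp0
        rw [← MvPolynomial.sum_homogeneousComponent p]
        exact Finset.sum_eq_zero fun d _ => hcon d
      cases d with
      | zero =>
        exfalso
        have h1 := hcomp 0
        rw [MvPolynomial.homogeneousComponent_zero] at h1 hd
        simp at h1
        exact hd (by rw [h1]; simp)
      | succ e =>
        obtain ⟨y', hy', hle⟩ := step y _ e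
          (MvPolynomial.homogeneousComponent_isHomogeneous (e+1) p) hd (hcomp _)
        set U := span k (Set.range y)
        have hUV : U ≤ V := by
          rw [Submodule.span_le]; rintro _ ⟨i, rfl⟩; exact hyV i
        have hk : ∀ e, V ^ (N + e) ≤ U ^ e * V ^ N := by
          intro e
          induction e with
          | zero => simp
          | succ e ihe =>
            calc V ^ (N + (e+1)) = V * V ^ (N + e) := by rw [← add_assoc, pow_succ']
              _ ≤ V * (U ^ e * V ^ N) := mul_le_mul' le_rfl ihe
              _ = U ^ e * V ^ (N+1) := by rw [pow_succ']; ring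
              _ ≤ U ^ e * (U * V ^ N) := mul_le_mul' le_rfl hN
              _ = U ^ (e+1) * V ^ N := by rw [pow_succ]; ring
        refine ⟨y', fun l => hUV (hy' l), N + e, ?_⟩
        calc V ^ (N + e + 1) ≤ U ^ (e+1) * V ^ N := hk (e+1)
          _ ≤ (span k (Set.range y') * U ^ e) * V ^ N := mul_le_mul' hle le_rfl
          _ ≤ (span k (Set.range y') * V ^ e) * V ^ N :=
            mul_le_mul' (mul_le_mul' le_rfl (pow_le_pow_left' hUV _)) le_rfl
          _ = _ := by rw [pow_add]; ring
  obtain ⟨n, s, hs⟩ := Submodule.fg_iff_exists_fin_generating_family.1 hV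
  refine key n ⟨Fin.append 0 s, ?_, 0, ?_⟩
  · intro l
    refine Fin.addCases (fun i => ?_) (fun i => ?_) l
    · simp
    · rw [Fin.append_right, ← hs]; exact Submodule.subset_span ⟨i, rfl⟩
  · rw [zero_add, pow_one, pow_zero, mul_one]
    nth_rewrite 1 [← hs]
    rw [Submodule.span_le]
    rintro _ ⟨i, rfl⟩
    exact Submodule.subset_span ⟨Fin.natAdd h i, by simp⟩
end abs

section loc
open IsLocalRing Polynomial

variable {A : Type} [CommRing A] (I m : Ideal A)

/-- `m Rees` coefficientwise. -/
lemma mem_map_iff (f : reesAlgebra I) :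
    f ∈ m.map (algebraMap A (reesAlgebra I)) ↔ ∀ i, (f : A[X]).coeff i ∈ m * I ^ i := by
  constructor
  · intro hf
    refine Submodule.span_induction
      (p := fun (f : reesAlgebra I) _ => ∀ i, (f : A[X]).coeff i ∈ m * I ^ i) ?_ ?_ ?_ ?_ hf
    · rintro _ ⟨a, ha, rfl⟩ i
      have : ((algebraMap A (reesAlgebra I) a : reesAlgebra I) : A[X]) = C a := rfl
      rw [this, coeff_C]
      split_ifs with h0
      · subst h0; simpa using ha
      · exact zero_mem _
    · intro i; simp
    · intro a b _ _ ha hb i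
      simpa using add_mem (ha i) (hb i)
    · intro c a _ ha i
      have : ((c • a : reesAlgebra I) : A[X]) = c * a := rfl
      rw [this, coeff_mul]
      refine Ideal.sum_mem _ fun x hx => ?_
      rw [← Finset.HasAntidiagonal.mem_antidiagonal.1 hx, pow_add, mul_left_comm]
      exact Ideal.mul_mem_mul (c.2 x.1) (ha x.2)
  · intro hf
    have hmon : ∀ i (c : A), c ∈ m * I ^ i → ∃ g ∈ m.map (algebraMap A (reesAlgebra I)),
        (g : A[X]) = monomial i c := by
      intro i c hc
      refine Submodule.mul_induction_on hc ?_ ?_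
      · intro a ha b hb
        refine ⟨algebraMap A (reesAlgebra I) a * ⟨monomial i b, reesAlgebra.monomial_mem.2 hb⟩,
          Ideal.mul_mem_right _ _ (Ideal.mem_map_of_mem _ ha), ?_⟩
        change C a * monomial i b = _
        rw [C_mul_monomial]
      · rintro x y ⟨g, hg, hgx⟩ ⟨g', hg', hgy⟩
        exact ⟨g + g', add_mem hg hg', by simp [hgx, hgy]⟩
    choose g hg hge using fun i => hmon i _ (hf i)
    have : f = ∑ i ∈ (f : A[X]).support, g i := by
      apply Subtype.ext
      rw [AddSubmonoidClass.coe_finsetSum]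
      simp only [hge]
      exact (f : A[X]).as_sum_support
    rw [this]
    exact sum_mem fun i _ => hg i


variable {I}
/-- The Rees monomial. -/
def mon {d : ℕ} {e : A} (he : e ∈ I ^ d) : reesAlgebra I :=
  ⟨monomial d e, reesAlgebra.monomial_mem.2 he⟩

lemma coe_mon {d : ℕ} {e : A} (he : e ∈ I ^ d) : (mon he : A[X]) = monomial d e := rfl

abbrev FC (I m : Ideal A) : Type := reesAlgebra I ⧸ m.map (algebraMap A (reesAlgebra I))

variable {m}
lemma fc_smul (a : A) (f : reesAlgebra I) :
    (Ideal.Quotient.mk m a) • (Ideal.Quotient.mk (m.map (algebraMap A (reesAlgebra I))) f : FC I m)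
      = Ideal.Quotient.mk _ (algebraMap A (reesAlgebra I) a * f) := by
  rw [Algebra.smul_def, map_mul]; rfl

variable (I m)
/-- classes of `e t^d`, `e ∈ K`. -/
def WW (K : Ideal A) (d : ℕ) : Submodule (A ⧸ m) (FC I m) where
  carrier := {w | ∃ e ∈ K, ∃ f : reesAlgebra I, (f : A[X]) = monomial d e ∧
    Ideal.Quotient.mk _ f = w}
  zero_mem' := ⟨0, zero_mem _, 0, by simp, by simp⟩
  add_mem' := by
    rintro _ _ ⟨e, he, f, hf, rfl⟩ ⟨e', he', f', hf', rfl⟩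
    exact ⟨e + e', add_mem he he', f + f', by simp [hf, hf'], by simp⟩
  smul_mem' := by
    rintro c _ ⟨e, he, f, hf, rfl⟩
    obtain ⟨a, rfl⟩ := Ideal.Quotient.mk_surjective c
    refine ⟨a * e, Ideal.mul_mem_left _ _ he, algebraMap A (reesAlgebra I) a * f, ?_,
      (fc_smul a f).symm⟩
    change C a * (f : A[X]) = _
    rw [hf, C_mul_monomial]

lemma WW_mul_le (K K' : Ideal A) (d d' : ℕ) :
    WW I m K d * WW I m K' d' ≤ WW I m (K * K') (d + d') := by
  rw [Submodule.mul_le]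
  rintro _ ⟨e, he, f, hf, rfl⟩ _ ⟨e', he', f', hf', rfl⟩
  refine ⟨e * e', Ideal.mul_mem_mul he he', f * f', ?_, by simp⟩
  change (f : A[X]) * f' = _
  rw [hf, hf', monomial_mul_monomial]

lemma WW_pow_le (d : ℕ) : WW I m I 1 ^ d ≤ WW I m (I ^ d) d := by
  induction d with
  | zero =>
    rw [Submodule.pow_zero, Submodule.one_le]
    exact ⟨1, by simp, 1, by simp, by simp⟩
  | succ d ih =>
    rw [_root_.pow_succ I, Submodule.pow_succ]
    exact (mul_le_mul' ih le_rfl).trans (WW_mul_le I m _ _ _ _)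

lemma le_WW_mul (K K' : Ideal A) (d d' : ℕ) (hK : K ≤ I ^ d) (hK' : K' ≤ I ^ d') :
    WW I m (K * K') (d + d') ≤ WW I m K d * WW I m K' d' := by
  rintro _ ⟨e, he, f, hf, rfl⟩
  have : ∃ g : reesAlgebra I, (g : A[X]) = monomial (d + d') e ∧
      Ideal.Quotient.mk (m.map (algebraMap A (reesAlgebra I))) g ∈ WW I m K d * WW I m K' d' := by
    refine Submodule.mul_induction_on he ?_ ?_
    · intro a ha b hb
      refine ⟨mon (hK ha) * mon (hK' hb), ?_, ?_⟩
      · change (mon (hK ha) : A[X]) * mon (hK' hb) = _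
        rw [coe_mon, coe_mon, monomial_mul_monomial]
      · rw [map_mul]
        exact Submodule.mul_mem_mul ⟨a, ha, _, rfl, rfl⟩ ⟨b, hb, _, rfl, rfl⟩
    · rintro x y ⟨g, hg, hgm⟩ ⟨g', hg', hgm'⟩
      exact ⟨g + g', by simp [hg, hg'], by rw [map_add]; exact add_mem hgm hgm'⟩
  obtain ⟨g, hg, hgm⟩ := this
  have : f = g := Subtype.ext (hf.trans hg.symm)
  rwa [this]

lemma le_WW_pow (d : ℕ) : WW I m (I ^ d) d ≤ WW I m I 1 ^ d := by
  induction d with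
  | zero =>
    rintro _ ⟨e, he, f, hf, rfl⟩
    rw [Submodule.pow_zero, Submodule.mem_one]
    refine ⟨Ideal.Quotient.mk m e, ?_⟩
    have : f = algebraMap A (reesAlgebra I) e := Subtype.ext hf
    rw [this]; rfl
  | succ d ih =>
    rw [_root_.pow_succ I, Submodule.pow_succ]
    exact (le_WW_mul I m _ _ _ _ le_rfl (by simp)).trans (mul_le_mul' ih le_rfl)

lemma WW_fg (hI : I.FG) : (WW I m I 1).FG := by
  obtain ⟨n, s, hs⟩ := Submodule.fg_iff_exists_fin_generating_family.1 hI
  have hsI : ∀ i, s i ∈ I ^ 1 := fun i => by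
    rw [pow_one, ← hs]; exact Submodule.subset_span ⟨i, rfl⟩
  set T : Set (FC I m) := Set.range fun i => Ideal.Quotient.mk _ (mon (hsI i)) with hT
  have : WW I m I 1 = Submodule.span _ T := by
    apply le_antisymm
    · rintro _ ⟨e, he, f, hf, rfl⟩
      have : ∃ g : reesAlgebra I, (g : A[X]) = monomial 1 e ∧
          Ideal.Quotient.mk (m.map (algebraMap A (reesAlgebra I))) g ∈
            Submodule.span (A ⧸ m) T := by
        rw [← hs] at he
        refine Submodule.span_induction (p := fun e _ => ∃ g : reesAlgebra I,
          (g : A[X]) = monomial 1 e ∧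
          Ideal.Quotient.mk (m.map (algebraMap A (reesAlgebra I))) g ∈
            Submodule.span (A ⧸ m) T) ?_ ?_ ?_ ?_ he
        · rintro _ ⟨i, rfl⟩
          exact ⟨mon (hsI i), rfl, Submodule.subset_span ⟨i, rfl⟩⟩
        · exact ⟨0, by simp, by simp⟩
        · rintro x y _ _ ⟨g, hg, hgm⟩ ⟨g', hg', hgm'⟩
          exact ⟨g + g', by simp [hg, hg'], by rw [map_add]; exact add_mem hgm hgm'⟩
        · rintro a x _ ⟨g, hg, hgm⟩
          refine ⟨algebraMap A (reesAlgebra I) a * g, ?_, ?_⟩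
          · change C a * (g : A[X]) = _
            rw [hg, C_mul_monomial, smul_eq_mul]
          · rw [← fc_smul]
            exact Submodule.smul_mem _ _ hgm
      obtain ⟨g, hg, hgm⟩ := this
      have : f = g := Subtype.ext (hf.trans hg.symm)
      rwa [this]
    · rw [Submodule.span_le]
      rintro _ ⟨i, rfl⟩
      exact ⟨s i, by simpa using hsI i, _, rfl, rfl⟩
  rw [this]
  exact Submodule.fg_span (Set.finite_range _)

lemma WW_gen : Algebra.adjoin (A ⧸ m) (WW I m I 1 : Set (FC I m)) = ⊤ := by
  rw [eq_top_iff]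
  intro w _
  obtain ⟨f, rfl⟩ := Ideal.Quotient.mk_surjective w
  have hpow : ∀ d, WW I m I 1 ^ d ≤
      Subalgebra.toSubmodule (Algebra.adjoin (A ⧸ m) (WW I m I 1 : Set (FC I m))) := by
    intro d
    induction d with
    | zero => rw [Submodule.pow_zero, Submodule.one_le]; exact Subalgebra.one_mem _
    | succ d ih =>
      rw [Submodule.pow_succ, Submodule.mul_le]
      intro a ha b hb
      exact Subalgebra.mul_mem _ (ih ha) (Algebra.subset_adjoin hb)
  have : f = ∑ i ∈ (f : A[X]).support, mon (f.2 i) := by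
    apply Subtype.ext
    rw [AddSubmonoidClass.coe_finsetSum]
    simp only [coe_mon]
    exact (f : A[X]).as_sum_support
  rw [this, map_sum]
  refine sum_mem fun i _ => ?_
  exact hpow i (le_WW_pow I m i ⟨_, f.2 i, _, rfl, rfl⟩)

lemma WW_ind (D : ℕ) (v : ℕ → FC I m) (hv : ∀ d, v d ∈ WW I m I 1 ^ d)
    (hsum : ∑ d ∈ Finset.range D, v d = 0) : ∀ d < D, v d = 0 := by
  intro d hd
  choose e he f hf hfv using fun d => WW_pow_le I m d (hv d)
  have h1 : ∑ d ∈ Finset.range D, f d ∈ m.map (algebraMap A (reesAlgebra I)) := by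
    rw [← Ideal.Quotient.eq_zero_iff_mem, map_sum]
    simpa [hfv] using hsum
  have h2 := (mem_map_iff I m _).1 h1 d
  rw [AddSubmonoidClass.coe_finsetSum, finsetSum_coeff] at h2
  simp only [hf, coeff_monomial] at h2
  rw [Finset.sum_ite_eq' , if_pos (Finset.mem_range.2 hd)] at h2
  rw [← hfv d, Ideal.Quotient.eq_zero_iff_mem, mem_map_iff]
  intro i
  rw [hf, coeff_monomial]
  split_ifs with hi
  · subst hi; exact h2
  · exact zero_mem _

lemma local_red [m.IsMaximal] [Infinite (A ⧸ m)] (hI : I.FG) (h : ℕ)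
    (hdim : ringKrullDim (FC I m) ≤ (h : WithBot ℕ∞)) :
    ∃ b : Fin h → A, (∀ l, b l ∈ I) ∧ ∃ N : ℕ,
      I ^ (N+1) ≤ Ideal.span (Set.range b) * I ^ N ⊔ m * I ^ (N+1) := by
  let _ : Field (A ⧸ m) := Ideal.Quotient.field m
  obtain ⟨y, hyV, N, hN⟩ := abs_main (k := A ⧸ m) (F := FC I m) (WW I m I 1) (WW_fg I m hI)
    (WW_gen I m) (WW_ind I m) h hdim
  choose b hb f hf hfy using hyV
  refine ⟨b, hb, N, ?_⟩
  intro c hc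
  have h1 := hN (le_WW_pow I m (N+1) ⟨c, hc, mon hc, rfl, rfl⟩)
  have hU : Submodule.span (A ⧸ m) (Set.range y) ≤ WW I m (Ideal.span (Set.range b)) 1 := by
    rw [Submodule.span_le]
    rintro _ ⟨l, rfl⟩
    exact ⟨b l, Ideal.subset_span ⟨l, rfl⟩, f l, hf l, hfy l⟩
  have h2 := WW_mul_le I m _ _ _ _ (mul_le_mul' hU (WW_pow_le I m N) h1)
  obtain ⟨e, he, g, hg, hge⟩ := h2
  rw [Ideal.Quotient.eq, mem_map_iff] at hge
  have h3 := hge (N+1)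
  have h4 : ((g - mon hc : reesAlgebra I) : A[X]).coeff (N+1) = e - c := by
    change ((g : A[X]) - (mon hc : A[X])).coeff (N+1) = _
    rw [hg, coe_mon, add_comm 1 N]; simp
  rw [h4] at h3
  have : c = e + (-(e - c)) := by ring
  rw [this]
  exact Submodule.add_mem_sup he (neg_mem h3)
end loc

section glob
open IsLocalRing

lemma infinite_quot {R : Type} [CommRing R] [IsLocalRing R] [Infinite (ResidueField R)]
    (P : Ideal R) [P.IsPrime] :
    Infinite (Localization.AtPrime P ⧸ maximalIdeal (Localization.AtPrime P)) := by
  have h1 : Infinite (R ⧸ P) :=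
    Infinite.of_surjective (β := ResidueField R)
      (Ideal.Quotient.factor (le_maximalIdeal (Ideal.IsPrime.ne_top inferInstance)))
      (Ideal.Quotient.factor_surjective _)
  refine Infinite.of_injective (Ideal.quotientMap (maximalIdeal (Localization.AtPrime P))
    (algebraMap R (Localization.AtPrime P)) (I := P)
    (Localization.AtPrime.under_maximalIdeal (I := P)).ge) ?_
  exact Ideal.quotientMap_injective' (Localization.AtPrime.under_maximalIdeal (I := P)).le

lemma per_prime {R : Type} [CommRing R] [IsNoetherianRing R] [IsLocalRing R]
    [Infinite (ResidueField R)] (I P : Ideal R) [P.IsPrime] (h : ℕ)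
    (hdim : ringKrullDim (FC (I.map (algebraMap R (Localization.AtPrime P)))
      (maximalIdeal (Localization.AtPrime P))) ≤ (h : WithBot ℕ∞)) :
    ∃ y : Fin h → R, (∀ l, y l ∈ I) ∧ ∃ N : ℕ,
      (I.map (algebraMap R (Localization.AtPrime P))) ^ (N+1) ≤
        (Ideal.span (Set.range fun l => algebraMap R (Localization.AtPrime P) (y l))) *
          (I.map (algebraMap R (Localization.AtPrime P))) ^ N ⊔
        maximalIdeal (Localization.AtPrime P) *
          (I.map (algebraMap R (Localization.AtPrime P))) ^ (N+1) := by
  have := infinite_quot P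
  obtain ⟨b, hb, N, hN⟩ := local_red (I.map (algebraMap R (Localization.AtPrime P)))
    (maximalIdeal (Localization.AtPrime P))
    (Ideal.FG.map (IsNoetherian.noetherian I) _) h hdim
  have hb' : ∀ l, ∃ (a : I) (s : P.primeCompl),
      b l * algebraMap R (Localization.AtPrime P) s = algebraMap R _ (a : R) := by
    intro l
    obtain ⟨⟨a, s⟩, h1⟩ := (IsLocalization.mem_map_algebraMap_iff P.primeCompl _).1 (hb l)
    exact ⟨a, s, h1⟩
  choose a s has using hb'
  refine ⟨fun l => a l, fun l => (a l).2, N, hN.trans (sup_le_sup (mul_le_mul' ?_ le_rfl) le_rfl)⟩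
  rw [Ideal.span_le]
  rintro _ ⟨l, rfl⟩
  have hu : IsUnit (algebraMap R (Localization.AtPrime P) (s l)) :=
    IsLocalization.map_units _ (s l)
  obtain ⟨u, hu⟩ := hu
  have : b l = ↑u⁻¹ * algebraMap R (Localization.AtPrime P) (a l) := by
    rw [← has l, ← hu, mul_comm (b l), ← mul_assoc, Units.inv_mul, one_mul]
  rw [this]
  exact Ideal.mul_mem_left _ _ (Ideal.subset_span ⟨l, rfl⟩)

lemma pull_back {R : Type} [CommRing R] (P K L : Ideal R) [P.IsPrime] (hK : K.FG)
    (hKL : K.map (algebraMap R (Localization.AtPrime P)) ≤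
      L.map (algebraMap R (Localization.AtPrime P))) :
    ∃ s ∉ P, Ideal.span {s} * K ≤ L := by
  obtain ⟨T, rfl⟩ := hK
  have h1 : ∀ g ∈ T, ∃ s ∉ P, s * g ∈ L := by
    intro g hg
    have := hKL (Ideal.mem_map_of_mem _ (Ideal.subset_span hg))
    rw [IsLocalization.algebraMap_mem_map_algebraMap_iff P.primeCompl] at this
    obtain ⟨s, hs, h2⟩ := this
    exact ⟨s, hs, h2⟩
  choose! s hs hsg using h1
  refine ⟨∏ g ∈ T, s g, ?_, ?_⟩
  · rw [Ideal.IsPrime.prod_mem_iff]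
    rintro ⟨g, hg, h2⟩
    exact hs g hg h2
  · rw [Ideal.span_singleton_mul_le_iff]
    intro z hz
    refine Submodule.span_induction (p := fun z _ => (∏ g ∈ T, s g) * z ∈ L) ?_ ?_ ?_ ?_ hz
    · intro g hg
      classical
      rw [← Finset.mul_prod_erase T s hg, mul_comm (s g), mul_assoc]
      exact Ideal.mul_mem_left _ _ (hsg g hg)
    · simp
    · intro a b _ _ ha hb; rw [mul_add]; exact add_mem ha hb
    · intro c a _ ha; rw [smul_eq_mul, mul_left_comm]; exact Ideal.mul_mem_left _ _ ha

lemma avoid {R : Type} [CommRing R] {t : ℕ} (P : Fin t → Ideal R) (hP : ∀ i, (P i).IsPrime)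
    (C : Ideal R) (hC : ∀ i, ¬ C ≤ P i) : ∃ x ∈ C, ∀ i, x ∉ P i := by
  cases t with
  | zero => exact ⟨0, zero_mem _, fun i => i.elim0⟩
  | succ t =>
    by_contra! hcon
    have h1 : (C : Set R) ⊆ ⋃ i ∈ ((Finset.univ : Finset (Fin (t+1))) : Set (Fin (t+1))), P i := by
      intro x hx
      obtain ⟨i, hi⟩ := hcon x hx
      simp only [Set.mem_iUnion]
      exact ⟨i, by simp, hi⟩
    rw [Ideal.subset_union_prime 0 0 (fun i _ _ _ => hP i)] at h1
    obtain ⟨i, -, hi⟩ := h1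
    exact hC i hi

lemma exists_red {R : Type} [CommRing R] [IsLocalRing R]
    [IsNoetherianRing R] [Infinite (ResidueField R)]
    (I : Ideal R) {t : ℕ} (P : Fin t → Ideal R) (hP : ∀ i, (P i).IsPrime)
    (hinc : ∀ i j, i ≠ j → ¬ P i ≤ P j)
    (h : ℕ)
    (hspread : ∀ i : Fin t,
      ringKrullDim (FC (I.map (algebraMap R (Localization.AtPrime (P i))))
      (maximalIdeal (Localization.AtPrime (P i)))) ≤ (h : WithBot ℕ∞)) :
    ∃ (y : Fin h → R) (x : R) (N : ℕ), (∀ l, y l ∈ I) ∧ (∀ i, x ∉ P i) ∧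
      Ideal.span {x} * I ^ (N+1) ≤ Ideal.span (Set.range y) * I ^ N := by
  choose y hyI N hN using fun i => per_prime I (P i) h (hspread i)
  have hr : ∀ j, ∃ r, r ∉ P j ∧ ∀ i, i ≠ j → r ∈ P i := by
    intro j
    have h1 : ¬ ((Finset.univ.erase j).inf P ≤ P j) := by
      rw [Ideal.IsPrime.inf_le' (hP j)]
      rintro ⟨i, hi, hle⟩
      exact hinc i j (Finset.ne_of_mem_erase hi) hle
    obtain ⟨r, hr1, hr2⟩ := SetLike.not_le_iff_exists.1 h1
    refine ⟨r, hr2, fun i hi => ?_⟩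
    rw [Submodule.mem_finsetInf] at hr1
    exact hr1 i (by simp [hi])
  choose r hrj hri using hr
  set z : Fin h → R := fun l => ∑ j, r j * y j l with hz
  have hzI : ∀ l, z l ∈ I := fun l => sum_mem fun j _ => Ideal.mul_mem_left _ _ (hyI j l)
  set J := Ideal.span (Set.range z) with hJ
  have hloc : ∀ j, ∃ s ∉ P j, Ideal.span {s} * I ^ (N j + 1) ≤ J * I ^ (N j) := by
    intro j
    apply pull_back (P j) _ _ (IsNoetherian.noetherian _)
    rw [Ideal.map_mul, Ideal.map_pow, Ideal.map_pow]
    set al := algebraMap R (Localization.AtPrime (P j)) with hal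
    set m := maximalIdeal (Localization.AtPrime (P j)) with hm
    set IA := I.map al with hIA
    set JA := J.map al with hJA
    have hal_mem : ∀ a ∈ P j, al a ∈ m := by
      intro a ha
      have := (Localization.AtPrime.under_maximalIdeal (I := P j)).ge ha
      exact this
    have hy1 : Ideal.span (Set.range fun l => al (y j l)) ≤ JA ⊔ m * IA := by
      rw [Ideal.span_le]
      rintro _ ⟨l, rfl⟩
      have hu : IsUnit (al (r j)) :=
        IsLocalization.map_units (M := (P j).primeCompl) _ ⟨r j, hrj j⟩
      have e : al (z l) = al (r j) * al (y j l) +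
          ∑ i ∈ Finset.univ.erase j, al (r i) * al (y i l) := by
        rw [hz]
        simp only [map_sum, map_mul]
        rw [Finset.add_sum_erase _ (fun i => al (r i) * al (y i l)) (Finset.mem_univ j)]
      have hmem : al (r j) * al (y j l) ∈ JA ⊔ m * IA := by
        have : al (r j) * al (y j l) = al (z l) +
          -(∑ i ∈ Finset.univ.erase j, al (r i) * al (y i l)) := by rw [e]; ring
        rw [this]
        refine Submodule.add_mem_sup (Ideal.mem_map_of_mem _ (Ideal.subset_span ⟨l, rfl⟩))
          (neg_mem (sum_mem fun i hi => ?_))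
        exact Ideal.mul_mem_mul (hal_mem _ (hri i j (Finset.ne_of_mem_erase hi).symm))
          (Ideal.mem_map_of_mem _ (hyI i l))
      exact (Ideal.unit_mul_mem_iff_mem _ hu).1 hmem
    have hle : IA ^ (N j + 1) ≤ JA * IA ^ (N j) ⊔ m • IA ^ (N j + 1) := by
      refine (hN j).trans (sup_le ?_ le_sup_right)
      refine (mul_le_mul' hy1 le_rfl).trans ?_
      rw [Ideal.sup_mul, mul_assoc, ← pow_succ', smul_eq_mul]
    refine Submodule.le_of_le_smul_of_le_jacobson_bot ?_ (maximalIdeal_le_jacobson _) hle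
    rw [hIA, ← Ideal.map_pow]
    exact Ideal.FG.map (IsNoetherian.noetherian _) _
  set M := Finset.univ.sup N with hM
  have hloc' : ∀ j, ¬ (J * I ^ M).colon (I ^ (M+1) : Ideal R) ≤ P j := by
    intro j hle
    obtain ⟨s, hs, hsle⟩ := hloc j
    apply hs
    apply hle
    rw [Submodule.mem_colon]
    have hNM : N j ≤ M := Finset.le_sup (Finset.mem_univ j)
    obtain ⟨d, hd⟩ := Nat.exists_eq_add_of_le hNM
    have h2 : Ideal.span {s} * I ^ (M + 1) ≤ J * I ^ M := by
      calc Ideal.span {s} * I ^ (M + 1) = (Ideal.span {s} * I ^ (N j + 1)) * I ^ d := by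
            rw [hd, mul_assoc, ← pow_add]; congr 2; ring
        _ ≤ (J * I ^ (N j)) * I ^ d := mul_le_mul' hsle le_rfl
        _ = _ := by rw [hd, mul_assoc, ← pow_add]
    intro a ha
    exact h2 (Ideal.mul_mem_mul (Ideal.mem_span_singleton_self s) ha)
  obtain ⟨x, hxC, hx⟩ := avoid P hP _ hloc'
  refine ⟨z, x, M, hzI, hx, ?_⟩
  rw [Ideal.span_singleton_mul_le_iff]
  intro a ha
  exact Submodule.mem_colon.1 hxC a ha
end glob
end main

section intcl

lemma memIntCl_of_mul_le {R : Type} [CommRing R] [IsDomain R] [IsNoetherianRing R]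
    (J M : Ideal R) (hM : M ≠ ⊥) (r : R) (hr : Ideal.span {r} * M ≤ J * M) : memIntCl J r := by
  have hmem : ∀ a ∈ M, r * a ∈ J * M := fun a ha =>
    hr (Ideal.mul_mem_mul (Ideal.mem_span_singleton_self r) ha)
  set f : Module.End R M := algebraMap R (Module.End R M) r with hf
  have hrange : LinearMap.range f ≤ J • (⊤ : Submodule R M) := by
    rintro _ ⟨a, rfl⟩
    have h1 : (((f a : M)) : R) ∈ J • M := by
      have : ((f a : M) : R) = r * a := by simp [hf]
      rw [this]; exact hmem a a.2
    have h2 : (J • (⊤ : Submodule R M)).map M.subtype = J • M := by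
      rw [Submodule.map_smul'', Submodule.map_top, Submodule.range_subtype]
    rw [← h2] at h1
    obtain ⟨b, hb, hbe⟩ := h1
    have : b = f a := Subtype.ext hbe
    rwa [← this]
  obtain ⟨p, hmon, -, hcoef, hp⟩ :=
    LinearMap.exists_monic_and_natDegree_eq_and_coeff_mem_pow_and_aeval_eq_zero R f J hrange
  obtain ⟨a, haM, ha0⟩ := Submodule.exists_mem_ne_zero_of_ne_bot hM
  have heval : p.eval r = 0 := by
    have h1 : Polynomial.aeval f p = algebraMap R (Module.End R M) (p.eval r) := by
      rw [hf, Polynomial.aeval_algebraMap_apply, Polynomial.coe_aeval_eq_eval]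
    rw [hp] at h1
    have h2 := congrArg (fun g : Module.End R M => ((g ⟨a, haM⟩ : M) : R)) h1
    simp at h2
    rcases h2 with h2 | h2
    · exact h2
    · exact absurd h2 ha0
  have hd : 0 < p.natDegree := by
    rcases Nat.eq_zero_or_pos p.natDegree with h0 | h0
    · rw [Polynomial.eq_one_of_monic_natDegree_zero hmon h0] at heval
      simp at heval
    · exact h0
  refine ⟨p.natDegree, hd, fun j => p.coeff (p.natDegree - j), ?_, ?_⟩
  · intro j _ hj
    have := hcoef (p.natDegree - j)
    rwa [Nat.sub_sub_self hj] at this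
  · rw [Polynomial.eval_eq_sum_range, Finset.sum_range_succ, hmon.coeff_natDegree, one_mul,
      add_comm] at heval
    rw [← heval]
    congr 1
    refine Finset.sum_bij' (fun j _ => p.natDegree - j) (fun j _ => p.natDegree - j) ?_ ?_ ?_ ?_ ?_
    · intro j hj; simp at hj ⊢; omega
    · intro j hj; simp at hj ⊢; omega
    · intro j hj; simp at hj ⊢; omega
    · intro j hj; simp at hj ⊢; omega
    · intro j hj; rfl

lemma exists_of_memIntCl {R : Type} [CommRing R] (L : Ideal R) (r : R) (hr : memIntCl L r) :
    ∃ d : ℕ, Ideal.span {r} * (L ⊔ Ideal.span {r}) ^ d ≤ L * (L ⊔ Ideal.span {r}) ^ d := by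
  obtain ⟨t, ht, a, ha, hsum⟩ := hr
  obtain ⟨d, rfl⟩ : ∃ d, t = d + 1 := ⟨t - 1, by omega⟩
  set S := L ⊔ Ideal.span {r} with hS
  have hL : L ≤ S := le_sup_left
  have hrS : r ∈ S := Ideal.mem_sup_right (Ideal.mem_span_singleton_self r)
  have hsp : ∀ d, Ideal.span {r ^ d} ≤ S ^ d := fun d => by
    rw [Ideal.span_singleton_le_iff_mem]; exact Ideal.pow_mem_pow hrS d
  have key : ∀ d, S ^ (d+1) ≤ L * S ^ d ⊔ Ideal.span {r ^ (d+1)} := by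
    intro d
    induction d with
    | zero => simp [hS]
    | succ d ih =>
      rw [pow_succ S (d+1)]
      refine (mul_le_mul' ih le_rfl).trans ?_
      rw [Ideal.sup_mul, mul_assoc, ← pow_succ]
      refine sup_le le_sup_left ?_
      nth_rewrite 1 [hS]
      rw [Ideal.mul_sup]
      refine sup_le (le_sup_of_le_left ?_) (le_sup_of_le_right ?_)
      · rw [mul_comm]; exact mul_le_mul' le_rfl (hsp _)
      · rw [Ideal.span_singleton_mul_span_singleton, ← pow_succ]
  have hrt : r ^ (d+1) ∈ L * S ^ d := by
    have : r ^ (d+1) = -∑ j ∈ Finset.Icc 1 (d+1), a j * r ^ (d + 1 - j) :=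
      eq_neg_of_add_eq_zero_left hsum
    rw [this]
    refine neg_mem (sum_mem fun j hj => ?_)
    obtain ⟨hj1, hj2⟩ := Finset.mem_Icc.1 hj
    obtain ⟨i, rfl⟩ : ∃ i, j = i + 1 := ⟨j - 1, by omega⟩
    have h1 : a (i+1) * r ^ (d + 1 - (i+1)) ∈ L ^ (i+1) * S ^ (d - i) := by
      rw [Nat.add_sub_add_right]
      exact Ideal.mul_mem_mul (ha _ hj1 hj2) (Ideal.pow_mem_pow hrS _)
    have h2 : L ^ (i+1) * S ^ (d - i) ≤ L * S ^ d := by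
      calc L ^ (i+1) * S ^ (d - i) = L * (L ^ i * S ^ (d - i)) := by rw [pow_succ']; ring
        _ ≤ L * (S ^ i * S ^ (d - i)) :=
          mul_le_mul' le_rfl (mul_le_mul' (Ideal.pow_right_mono hL i) le_rfl)
        _ = _ := by rw [← pow_add]; congr 2; omega
    exact h2 h1
  refine ⟨d, ?_⟩
  have h3 : Ideal.span {r} * S ^ d ≤ S ^ (d+1) := by
    rw [pow_succ']
    exact mul_le_mul' le_sup_right le_rfl
  refine h3.trans ((key d).trans (sup_le le_rfl ?_))
  rwa [Ideal.span_singleton_le_iff_mem]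

lemma intcl_main {R : Type} [CommRing R] [IsDomain R] [IsNoetherianRing R] (I J : Ideal R)
    (x : R) (N : ℕ) (hx : Ideal.span {x} * I ^ (N+1) ≤ J * I ^ N) (n : ℕ) (r : R)
    (hr : memIntCl (I ^ n) r) : memIntCl (J ^ n) (x ^ n * r) := by
  rcases Nat.eq_zero_or_pos n with rfl | hn
  · exact ⟨1, one_pos, fun _ => -(x ^ 0 * r), by
      intro j _ _; rw [pow_zero, Ideal.one_eq_top, Ideal.top_pow]; trivial, by simp⟩
  by_cases hI : I = ⊥
  · have hr0 : r = 0 := by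
      obtain ⟨t, ht, a, ha, hsum⟩ := hr
      rw [Finset.sum_eq_zero, add_zero] at hsum
      · exact pow_eq_zero_iff (by omega) |>.1 hsum
      · intro j hj
        obtain ⟨hj1, hj2⟩ := Finset.mem_Icc.1 hj
        have := ha j hj1 hj2
        rw [hI, ← pow_mul, ← Ideal.zero_eq_bot, zero_pow (by positivity)] at this
        rw [(Submodule.mem_bot R).1 this, zero_mul]
    exact ⟨1, one_pos, fun _ => 0, by simp, by simp [hr0]⟩
  obtain ⟨d, hd⟩ := exists_of_memIntCl _ _ hr
  set S := I ^ n ⊔ Ideal.span {r} with hS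
  have hIn : ∀ n, I ^ n ≠ ⊥ := fun n => by
    rw [← Ideal.zero_eq_bot] at hI ⊢
    exact pow_ne_zero _ hI
  have hS0 : S ≠ ⊥ := fun h0 => hIn n (le_bot_iff.1 (h0 ▸ le_sup_left))
  have hxn : ∀ n, Ideal.span {x} ^ n * I ^ n * I ^ N ≤ J ^ n * I ^ N := by
    intro n
    induction n with
    | zero => simp
    | succ n ih =>
      calc Ideal.span {x} ^ (n+1) * I ^ (n+1) * I ^ N
          = (Ideal.span {x} ^ n * I ^ n) * (Ideal.span {x} * I ^ (N+1)) := by ring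
        _ ≤ (Ideal.span {x} ^ n * I ^ n) * (J * I ^ N) := mul_le_mul' le_rfl hx
        _ = J * (Ideal.span {x} ^ n * I ^ n * I ^ N) := by ring
        _ ≤ J * (J ^ n * I ^ N) := mul_le_mul' le_rfl ih
        _ = _ := by ring
  apply memIntCl_of_mul_le (J ^ n) (S ^ d * I ^ N)
  · rw [← Ideal.zero_eq_bot] at hS0 ⊢
    have := hIn N
    rw [← Ideal.zero_eq_bot] at this
    exact mul_ne_zero (pow_ne_zero _ hS0) this
  · rw [← Ideal.span_singleton_mul_span_singleton, ← Ideal.span_singleton_pow]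
    calc Ideal.span {x} ^ n * Ideal.span {r} * (S ^ d * I ^ N)
        = (Ideal.span {r} * S ^ d) * (Ideal.span {x} ^ n * I ^ N) := by ring
      _ ≤ (I ^ n * S ^ d) * (Ideal.span {x} ^ n * I ^ N) := mul_le_mul' hd le_rfl
      _ = S ^ d * (Ideal.span {x} ^ n * I ^ n * I ^ N) := by ring
      _ ≤ S ^ d * (J ^ n * I ^ N) := mul_le_mul' le_rfl (hxn n)
      _ = _ := by ring
end intcl

end SGR

/-- Existence of simultaneous generic reductions: if `ℓ(I R_{Pᵢ}) ≤ h` for pairwise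
incomparable primes `P₁,…,P_t`, then there are `y₁,…,y_h ∈ I` and `x ∈ W = R \ ∪Pᵢ` with
`(y₁,…,y_h) R_W` a reduction of `I R_W` and `x^n \overline{Iⁿ} ⊆ \overline{(y₁,…,y_h)ⁿ}`
for all `n`. -/
theorem simultaneous_generic_reductions {R : Type} [CommRing R] [IsLocalRing R]
    [IsNoetherianRing R] [IsDomain R] [IsIntegrallyClosed R]
    [Infinite (ResidueField R)]
    (I : Ideal R) {t : ℕ} (P : Fin t → Ideal R) (hP : ∀ i, (P i).IsPrime)
    (hinc : ∀ i j, i ≠ j → ¬ P i ≤ P j)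
    (h : ℕ)
    (hspread : ∀ i : Fin t,
      ringKrullDim (@fiberConeAt R _ I (P i) (hP i)) ≤ (h : WithBot ℕ∞)) :
    ∃ (y : Fin h → R) (x : R),
      (∀ l, y l ∈ I) ∧ (∀ i, x ∉ P i) ∧
      (((Ideal.span (Set.range y)).map
          (algebraMap R (Localization (complS P hP)))).IsReductionOf
        (I.map (algebraMap R (Localization (complS P hP))))) ∧
      (∀ (n : ℕ) (r : R), memIntCl (I ^ n) r →
        memIntCl ((Ideal.span (Set.range y)) ^ n) (x ^ n * r)) := by
  obtain ⟨y, x, N, hyI, hx, hle⟩ := SGR.exists_red I P hP hinc h hspread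
  have hJI : Ideal.span (Set.range y) ≤ I := by
    rw [Ideal.span_le]
    rintro _ ⟨l, rfl⟩
    exact hyI l
  refine ⟨y, x, hyI, hx, ⟨Ideal.map_mono hJI, N, le_antisymm ?_ ?_⟩,
    fun n r hr => SGR.intcl_main I _ x N hle n r hr⟩
  · have h1 := Ideal.map_mono (f := algebraMap R (Localization (complS P hP))) hle
    have hu : IsUnit (algebraMap R (Localization (complS P hP)) x) :=
      IsLocalization.map_units (M := complS P hP) _ ⟨x, hx⟩
    rw [Ideal.map_mul, Ideal.map_mul, Ideal.map_pow, Ideal.map_pow, Ideal.map_span,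
      Set.image_singleton, Ideal.span_singleton_eq_top.2 hu, Ideal.top_mul] at h1
    exact h1
  · rw [pow_succ']
    exact mul_le_mul' (Ideal.map_mono hJI) le_rfl

end
end
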